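/- arXiv:2105.06925 — 2 statements merged into one kernel-verified Lean document; each statement's English description precedes it below -/
import Mathlib

section
/- Let s ≥ 3 be a natural number and let ε > 0. There is a constant c(s, ε) > 0 such that for every natural number m with m ≢ 0, 4, 7 (mod 8), the set S_{3,m} is non-empty and satisfies r_s(S_{3,m}) ≥ c(s, ε) · |S_{3,m}|^{s − 3 − ε} and E_{s,2}(S_{3,m}) ≥ c(s, ε) · |S_{3,m}|^{2s − 3 − ε}. -/
open Finset

noncomputable section

/-- The set of lattice points on the sphere of radius `√m` in `ℤ^d`. -/
def latSphere (d m : ℕ) : Set (Fin d → ℤ) := {x | ∑ i, x i ^ 2 = (m : ℤ)}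

/-- The additive energy `E_{s,2}(A)`: the number of `2s`-tuples
`(x₁, …, x_{2s}) ∈ A^{2s}` with `x₁ + ⋯ + x_s = x_{s+1} + ⋯ + x_{2s}`. -/
def addEnergy {V : Type*} [AddCommMonoid V] (s : ℕ) (A : Set V) : ℕ :=
  Nat.card {p : (Fin s → V) × (Fin s → V) //
    (∀ i, p.1 i ∈ A) ∧ (∀ i, p.2 i ∈ A) ∧ ∑ i, p.1 i = ∑ i, p.2 i}

/-- The representation function `r_s(A, n)`: the number of `s`-tuples
`(x₁, …, x_s) ∈ A^s` with `x₁ + ⋯ + x_s = n`. -/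
def repCount {V : Type*} [AddCommMonoid V] (s : ℕ) (A : Set V) (n : V) : ℕ :=
  Nat.card {x : Fin s → V // (∀ i, x i ∈ A) ∧ ∑ i, x i = n}

section PartP1

/-- Reduction of a positive definite binary form. -/
lemma binary_red (p q r D : ℤ) (hp : 0 < p) (hD : p * r - q ^ 2 = D) (hD0 : 0 < D) :
    ∃ a b c d : ℤ, a * d - b * c = 1 ∧ 0 < p * a ^ 2 + 2 * q * a * c + r * c ^ 2 ∧
      3 * (p * a ^ 2 + 2 * q * a * c + r * c ^ 2) ^ 2 ≤ 4 * D := by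
  induction hn : p.toNat using Nat.strong_induction_on generalizing p q r with
  | _ n ih =>
    obtain ⟨k, hk⟩ : ∃ k : ℤ, 2 * |q + k * p| ≤ p := by
      refine ⟨-((2 * q + p) / (2 * p)), ?_⟩
      have h1 := Int.emod_add_mul_ediv (2 * q + p) (2 * p)
      have h2 := Int.emod_nonneg (2 * q + p) (by omega : 2 * p ≠ 0)
      have h3 := Int.emod_lt_of_pos (2 * q + p) (by omega : 0 < 2 * p)
      set t := (2 * q + p) / (2 * p)
      have : 2 * |q + -t * p| = |2 * (q + -t * p)| := by rw [abs_mul]; norm_num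
      rw [this, abs_le]
      constructor <;> nlinarith
    have hq2 : 4 * (q + k * p) ^ 2 ≤ p ^ 2 := by
      have := abs_nonneg (q + k * p)
      rw [← sq_abs (q + k * p)]
      nlinarith
    by_cases h : 3 * p ^ 2 ≤ 4 * D
    · exact ⟨1, 0, 0, 1, by ring, by nlinarith, by ring_nf; ring_nf at h; linarith⟩
    · push Not at h
      set q' := q + k * p with hq'
      set r' := p * k ^ 2 + 2 * q * k + r with hr'
      have hdet : p * r' - q' ^ 2 = D := by rw [hq', hr', ← hD]; ring
      have hr0 : 0 < r' := by
        by_contra hcon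
        push Not at hcon
        nlinarith [sq_nonneg q']
      have hlt : r' < p := by
        by_contra hcon
        push Not at hcon
        nlinarith
      obtain ⟨a, b, c, d, h1, h2, h3⟩ := ih r'.toNat (by omega) r' (-q') p hr0 (by linarith) rfl
      refine ⟨k * a - c, k * b - d, a, b, by linarith, ?_, ?_⟩
      · have e : p * (k * a - c) ^ 2 + 2 * q * (k * a - c) * a + r * a ^ 2 =
          r' * a ^ 2 + 2 * (-q') * a * c + p * c ^ 2 := by rw [hq', hr']; ring
        rw [e]; exact h2
      · have e : p * (k * a - c) ^ 2 + 2 * q * (k * a - c) * a + r * a ^ 2 =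
          r' * a ^ 2 + 2 * (-q') * a * c + p * c ^ 2 := by rw [hq', hr']; ring
        rw [e]; exact h3

/-- the Gram matrix with given entries -/
def gram (a b c d e f : ℤ) : Matrix (Fin 3) (Fin 3) ℤ := !![a, d, e; d, b, f; e, f, c]

def IsStd (A : Matrix (Fin 3) (Fin 3) ℤ) : Prop :=
  ∃ U : Matrix (Fin 3) (Fin 3) ℤ, U.transpose * A * U = 1

lemma IsStd.of_conj {A V : Matrix (Fin 3) (Fin 3) ℤ} 
    (h : IsStd (V.transpose * A * V)) : IsStd A := by
  obtain ⟨U, hU⟩ := h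
  refine ⟨V * U, ?_⟩
  rw [Matrix.transpose_mul, ← hU]
  simp only [Matrix.mul_assoc]

lemma shear_exists (p q : ℤ) (hp : 0 < p) : ∃ k : ℤ, 4 * (q + k * p) ^ 2 ≤ p ^ 2 := by
  obtain ⟨k, hk⟩ : ∃ k : ℤ, 2 * |q + k * p| ≤ p := by
    refine ⟨-((2 * q + p) / (2 * p)), ?_⟩
    have h1 := Int.emod_add_mul_ediv (2 * q + p) (2 * p)
    have h2 := Int.emod_nonneg (2 * q + p) (by omega : 2 * p ≠ 0)
    have h3 := Int.emod_lt_of_pos (2 * q + p) (by omega : 0 < 2 * p)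
    set t := (2 * q + p) / (2 * p)
    have : 2 * |q + -t * p| = |2 * (q + -t * p)| := by rw [abs_mul]; norm_num
    rw [this, abs_le]
    constructor <;> nlinarith
  refine ⟨k, ?_⟩
  have := abs_nonneg (q + k * p)
  rw [← sq_abs (q + k * p)]
  nlinarith

lemma gram_conj (a b c d e f v11 v12 v13 v21 v22 v23 v31 v32 v33 : ℤ) :
    (!![v11, v12, v13; v21, v22, v23; v31, v32, v33] : Matrix (Fin 3) (Fin 3) ℤ).transpose
      * gram a b c d e f * !![v11, v12, v13; v21, v22, v23; v31, v32, v33] =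
    gram (a*v11^2 + b*v21^2 + c*v31^2 + 2*d*v11*v21 + 2*e*v11*v31 + 2*f*v21*v31)
      (a*v12^2 + b*v22^2 + c*v32^2 + 2*d*v12*v22 + 2*e*v12*v32 + 2*f*v22*v32)
      (a*v13^2 + b*v23^2 + c*v33^2 + 2*d*v13*v23 + 2*e*v13*v33 + 2*f*v23*v33)
      (a*v11*v12 + b*v21*v22 + c*v31*v32 + d*(v11*v22+v21*v12) + e*(v11*v32+v31*v12)
        + f*(v21*v32+v31*v22))
      (a*v11*v13 + b*v21*v23 + c*v31*v33 + d*(v11*v23+v21*v13) + e*(v11*v33+v31*v13)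
        + f*(v21*v33+v31*v23))
      (a*v12*v13 + b*v22*v23 + c*v32*v33 + d*(v12*v23+v22*v13) + e*(v12*v33+v32*v13)
        + f*(v22*v33+v32*v23)) := by
  unfold gram
  ext i j
  fin_cases i <;> fin_cases j <;> simp [Matrix.mul_apply, Fin.sum_univ_three] <;> ring

set_option maxHeartbeats 1000000 in
lemma ternary_std (a b c d e f : ℤ) (ha : 0 < a) (hab : 0 < a * b - d ^ 2)
    (hdet : a * b * c + 2 * d * e * f - a * f ^ 2 - b * e ^ 2 - c * d ^ 2 = 1) :
    IsStd (gram a b c d e f) := by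
  induction hn : a.toNat using Nat.strong_induction_on generalizing a b c d e f with
  | _ n ih =>
    obtain ⟨u, v, w, z, hu, hpos, hle⟩ := binary_red (a * b - d ^ 2) (a * f - d * e) (a * c - e ^ 2)
      a hab (by linear_combination a * hdet) ha
    apply IsStd.of_conj (V := !![1, 0, 0; 0, u, v; 0, w, z])
    rw [gram_conj]
    set b1 := a*0^2 + b*u^2 + c*w^2 + 2*d*0*u + 2*e*0*w + 2*f*u*w with hb1
    set c1 := a*0^2 + b*v^2 + c*z^2 + 2*d*0*v + 2*e*0*z + 2*f*v*z with hc1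
    set d1 := a*1*0 + b*0*u + c*0*w + d*(1*u+0*0) + e*(1*w+0*0) + f*(0*w+0*u) with hd1
    set e1 := a*1*0 + b*0*v + c*0*z + d*(1*v+0*0) + e*(1*z+0*0) + f*(0*z+0*v) with he1
    set f1 := a*0*0 + b*u*v + c*w*z + d*(0*v+u*0) + e*(0*z+w*0) + f*(u*z+w*v) with hf1
    have ea : a*1^2 + b*0^2 + c*0^2 + 2*d*1*0 + 2*e*1*0 + 2*f*0*0 = a := by ring
    rw [ea]
    have hdet1 : a * b1 * c1 + 2 * d1 * e1 * f1 - a * f1 ^ 2 - b1 * e1 ^ 2 - c1 * d1 ^ 2 = 1 := by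
      rw [hb1, hc1, hd1, he1, hf1]
      have : (u * z - v * w) ^ 2 = 1 := by rw [hu]; ring
      linear_combination (u * z - v * w)^2 * hdet + this
    have hm : a * b1 - d1 ^ 2 =
        (a * b - d ^ 2) * u ^ 2 + 2 * (a * f - d * e) * u * w + (a * c - e ^ 2) * w ^ 2 := by
      rw [hb1, hd1]; ring
    rw [← hm] at hpos hle
    clear_value b1 c1 d1 e1 f1
    obtain ⟨k, hk⟩ := shear_exists a d1 ha
    obtain ⟨l, hl⟩ := shear_exists a e1 ha
    apply IsStd.of_conj (V := !![1, k, l; 0, 1, 0; 0, 0, 1])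
    rw [gram_conj]
    have ea : a*1^2 + b1*0^2 + c1*0^2 + 2*d1*1*0 + 2*e1*1*0 + 2*f1*0*0 = a := by ring
    rw [ea]
    set b2 := a*k^2 + b1*1^2 + c1*0^2 + 2*d1*k*1 + 2*e1*k*0 + 2*f1*1*0 with hb2
    set c2 := a*l^2 + b1*0^2 + c1*1^2 + 2*d1*l*0 + 2*e1*l*1 + 2*f1*0*1 with hc2
    set d2 := a*1*k + b1*0*1 + c1*0*0 + d1*(1*1+0*k) + e1*(1*0+0*k) + f1*(0*0+0*1) with hd2
    set e2 := a*1*l + b1*0*0 + c1*0*1 + d1*(1*0+0*l) + e1*(1*1+0*l) + f1*(0*1+0*0) with he2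
    set f2 := a*k*l + b1*1*0 + c1*0*1 + d1*(k*0+1*l) + e1*(k*1+0*l) + f1*(1*1+0*0) with hf2
    have hdet2 : a * b2 * c2 + 2 * d2 * e2 * f2 - a * f2 ^ 2 - b2 * e2 ^ 2 - c2 * d2 ^ 2 = 1 := by
      rw [hb2, hc2, hd2, he2, hf2]
      linear_combination hdet1
    have hm2 : a * b1 - d1 ^ 2 = a * b2 - d2 ^ 2 := by rw [hb2, hd2]; ring
    rw [hm2] at hpos hle
    have hd2' : d2 = d1 + k * a := by rw [hd2]; ring
    have he2' : e2 = e1 + l * a := by rw [he2]; ring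
    rw [← hd2'] at hk
    rw [← he2'] at hl
    clear_value b2 c2 d2 e2 f2
    have hb2pos : 0 < b2 := by
      have : 0 < a * b2 := by linarith [sq_nonneg d2]
      exact (pos_iff_pos_of_mul_pos this).1 ha
    clear hdet hab hdet1 hu hm hm2 hd2' he2'
    by_cases hba : b2 < a
    ·
      apply IsStd.of_conj (V := !![0, 1, 0; 1, 0, 0; 0, 0, 1])
      rw [gram_conj]
      ring_nf
      apply ih b2.toNat (by omega) b2 a c2 d2 f2 e2 hb2pos (by linarith) (by linarith) rfl
    · push Not at hba
      have ha1 : a = 1 := by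
        by_contra hne
        have h2 : 2 ≤ a := by omega
        have h3 : 3 * a ^ 2 ≤ 4 * (a * b2 - d2 ^ 2) := by
          have := mul_le_mul_of_nonneg_left hba ha.le
          linarith [sq a]
        have h4 : 9 * a ^ 4 ≤ 16 * (a * b2 - d2 ^ 2) ^ 2 := by
          have := pow_le_pow_left₀ (by positivity) h3 2
          linarith [this]
        have h5 : 27 * a ^ 4 ≤ 64 * a := by linarith
        have h6 : 8 ≤ a ^ 3 := by
          have : (2:ℤ) ^ 3 ≤ a ^ 3 := pow_le_pow_left₀ (by norm_num) h2 3
          linarith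
        have h7 := mul_le_mul_of_nonneg_left h6 ha.le
        have h8 : a * a ^ 3 = a ^ 4 := by ring
        linarith
      subst ha1
      have hd0 : d2 = 0 := by
        have : d2 ^ 2 = 0 := by
          have h := sq_nonneg d2
          have : 4 * d2 ^ 2 ≤ 1 := by simpa using hk
          omega
        exact pow_eq_zero_iff (two_ne_zero) |>.1 this
      have he0 : e2 = 0 := by
        have : e2 ^ 2 = 0 := by
          have h := sq_nonneg e2
          have : 4 * e2 ^ 2 ≤ 1 := by simpa using hl
          omega
        exact pow_eq_zero_iff (two_ne_zero) |>.1 this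
      subst hd0 he0
      have hb1' : b2 = 1 := by
        have h1 : 3 * b2 ^ 2 ≤ 4 := by simpa using hle
        by_contra hne
        have h2 : 2 ≤ b2 := by omega
        have h3 : 2 * 2 ≤ b2 * b2 := mul_le_mul h2 h2 (by norm_num) hb2pos.le
        linarith [sq b2]
      subst hb1'
      apply IsStd.of_conj (V := !![1, 0, 0; 0, 1, -f2; 0, 0, 1])
      rw [gram_conj]
      refine ⟨1, ?_⟩
      have hc : c2 = f2 ^ 2 + 1 := by linarith
      subst hc
      unfold gram
      ext i j
      fin_cases i <;> fin_cases j <;> simp <;> ring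

/-- if the ternary form is positive with determinant one, its last diagonal entry is primitively
a sum of three squares -/
lemma rep_of_gram (a b n d e f : ℤ) (ha : 0 < a) (hab : 0 < a * b - d ^ 2)
    (hdet : a * b * n + 2 * d * e * f - a * f ^ 2 - b * e ^ 2 - n * d ^ 2 = 1) :
    ∃ x y z p q r : ℤ, x ^ 2 + y ^ 2 + z ^ 2 = n ∧ p * x + q * y + r * z = 1 := by
  obtain ⟨U, hU⟩ := ternary_std a b n d e f ha hab hdet
  have hU' : IsUnit U.det := by
    have := congrArg Matrix.det hU
    rw [Matrix.det_mul, Matrix.det_one] at this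
    exact IsUnit.of_mul_eq_one_right _ this
  set W := U⁻¹ with hW
  have h1 : U * W = 1 := Matrix.mul_nonsing_inv _ hU'
  have h2 : W * U = 1 := Matrix.nonsing_inv_mul _ hU'
  have h3 : gram a b n d e f = W.transpose * W := by
    have e1 : W.transpose * (U.transpose * gram a b n d e f * U) * W = W.transpose * W := by
      rw [hU, Matrix.mul_one]
    rw [← e1]
    have e2 : W.transpose * U.transpose = 1 := by
      rw [← Matrix.transpose_mul, h1, Matrix.transpose_one]
    calc gram a b n d e f = (W.transpose * U.transpose) * gram a b n d e f * (U * W) := by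
          rw [e2, h1, Matrix.one_mul, Matrix.mul_one]
      _ = _ := by simp only [Matrix.mul_assoc]
  have h4 := congrFun (congrFun h3 2) 2
  have h5 := congrFun (congrFun h1 2) 2
  simp [gram, Matrix.mul_apply, Fin.sum_univ_three] at h4 h5
  exact ⟨W 0 2, W 1 2, W 2 2, U 2 0, U 2 1, U 2 2, by rw [h4]; ring, h5⟩

end PartP1

section PartP2

open scoped NumberTheorySymbols in
lemma jac_neg_one_of {b : ℕ} (h : b % 4 = 1) : J(-1 | b) = 1 := by
  rw [jacobiSym.at_neg_one (Nat.odd_iff.2 (by omega)), ZMod.χ₄_nat_one_mod_four h]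

open scoped NumberTheorySymbols in
lemma jac_neg_one_of' {b : ℕ} (h : b % 4 = 3) : J(-1 | b) = -1 := by
  rw [jacobiSym.at_neg_one (Nat.odd_iff.2 (by omega)), ZMod.χ₄_nat_three_mod_four h]

/-- From the residue condition to a primitive representation. -/
lemma rep_of_residue (n d k : ℕ) (hd : 0 < d) (hdn : 1 < d * n) (t : ℤ)
    (hk : (k : ℤ) = d * n - 1) (h : (k : ℤ) ∣ t ^ 2 + d) :
    ∃ x y z p q r : ℤ, x ^ 2 + y ^ 2 + z ^ 2 = n ∧ p * x + q * y + r * z = 1 := by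
  obtain ⟨a, ha⟩ := h
  have hk0 : (0 : ℤ) < k := by rw [hk]; have : (1 : ℤ) < d * n := by exact_mod_cast hdn
                               linarith
  have hd0 : (0 : ℤ) < d := by exact_mod_cast hd
  have ha0 : 0 < a := by
    have : 0 < (k : ℤ) * a := by rw [← ha]; positivity
    exact (pos_iff_pos_of_mul_pos this).1 hk0
  refine rep_of_gram a k n t 1 0 ha0 (by linarith) ?_
  linear_combination (-(n : ℤ)) * ha - hk

open scoped NumberTheorySymbols in
lemma sq_of_jac (p d : ℕ) (hp : p.Prime) (h : J(-(d : ℤ) | p) = 1) :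
    ∃ t : ℤ, (p : ℤ) ∣ t ^ 2 + d := by
  haveI := Fact.mk hp
  obtain ⟨r, hr⟩ := ZMod.isSquare_of_jacobiSym_eq_one h
  refine ⟨(r.val : ℤ), ?_⟩
  rw [← ZMod.intCast_zmod_eq_zero_iff_dvd]
  push_cast at hr ⊢
  rw [ZMod.natCast_zmod_val, sq, ← hr]; ring

open scoped NumberTheorySymbols in
/-- Primitive version of the three squares theorem. -/
lemma three_squares_primitive (m : ℕ) (h0 : m % 8 ≠ 0) (h4 : m % 8 ≠ 4) (h7 : m % 8 ≠ 7) :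
    ∃ x y z p q r : ℤ, x ^ 2 + y ^ 2 + z ^ 2 = m ∧ p * x + q * y + r * z = 1 := by
  by_cases hm1 : m = 1
  · subst hm1; exact ⟨1, 0, 0, 1, 0, 0, by norm_num, by norm_num⟩
  by_cases hm2 : m % 4 = 2
  ·
    have hcop : (m - 1).Coprime (4 * m) := by
      apply Nat.Coprime.mul_right
      · have : (m - 1) % 2 = 1 := by omega
        have h2 : Nat.Coprime (m - 1) 2 := (Nat.coprime_two_right).2 (Nat.odd_iff.2 this)
        exact Nat.Coprime.pow_right 2 h2
      · have := Nat.coprime_self_add_right (m := m - 1) (n := 1)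
        rw [show m - 1 + 1 = m by omega] at this
        simp [this]
    obtain ⟨p, hpgt, hp, hmod⟩ := Nat.forall_exists_prime_gt_and_modEq (4 * m) (q := 4 * m)
      (by omega) hcop
    obtain ⟨j, hj⟩ := (Nat.modEq_iff_dvd' (by omega : m - 1 ≤ p)).1 hmod.symm
    have hpe : p + 1 = (4 * j + 1) * m := by
      have : p = 4 * m * j + (m - 1) := by omega
      rw [this, add_assoc, show m - 1 + 1 = m by omega]; ring
    have hp4 : p % 4 = 1 := by
      have : p = 4 * (m * j) + (m - 1) := by rw [← mul_assoc]; omega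
      omega
    have hdodd : Odd (4 * j + 1) := ⟨2 * j, by ring⟩
    have hJ : J(-((4 * j + 1 : ℕ) : ℤ) | p) = 1 := by
      rw [neg_eq_neg_one_mul, jacobiSym.mul_left, jac_neg_one_of hp4, one_mul,
        jacobiSym.quadratic_reciprocity_one_mod_four (by omega) (Nat.odd_iff.2 (by omega))]
      rw [jacobiSym.mod_left' (a₂ := -1), jac_neg_one_of (by omega)]
      apply Int.ModEq.symm
      rw [Int.modEq_iff_dvd]
      refine ⟨m, ?_⟩
      have : ((p : ℤ) + 1) = (4 * j + 1) * m := by exact_mod_cast hpe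
      push_cast
      linarith
    obtain ⟨t, ht⟩ := sq_of_jac p (4 * j + 1) hp hJ
    refine rep_of_residue m (4 * j + 1) p (by omega) (by rw [← hpe]; have := hp.pos; omega) t ?_ ht
    have : ((p : ℤ) + 1) = (4 * j + 1) * m := by exact_mod_cast hpe
    push_cast
    linarith
  ·
    have hodd : m % 8 = 1 ∨ m % 8 = 3 ∨ m % 8 = 5 := by omega
    obtain ⟨c, hc, hc1⟩ : ∃ c : ℕ, (m % 8 = 1 ∧ c = 3 ∨ m % 8 = 3 ∧ c = 1 ∨ m % 8 = 5 ∧ c = 3) ∧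
        (c = 1 ∨ c = 3) := by
      rcases hodd with h | h | h
      · exact ⟨3, by simp [h], by simp⟩
      · exact ⟨1, by simp [h], by simp⟩
      · exact ⟨3, by simp [h], by simp⟩
    obtain ⟨a, ha⟩ : ∃ a, 2 * a + 1 = c * m := by
      refine ⟨(c * m - 1) / 2, ?_⟩
      rcases hc1 with rfl | rfl <;> omega
    have ha4 : (m % 8 = 5 ∧ a % 4 = 3) ∨ (m % 8 ≠ 5 ∧ a % 4 = 1) := by
      rcases hc with ⟨h, rfl⟩ | ⟨h, rfl⟩ | ⟨h, rfl⟩ <;> omega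
    have hcop : a.Coprime (4 * m) := by
      apply Nat.Coprime.mul_right
      · have : a % 2 = 1 := by omega
        have h2 : Nat.Coprime a 2 := (Nat.coprime_two_right).2 (Nat.odd_iff.2 this)
        exact Nat.Coprime.pow_right 2 h2
      · have h1 : Nat.Coprime a (c * m) := by
          rw [← ha]
          exact (Nat.coprime_mul_right_add_right a 1 2).2 (Nat.coprime_one_right a)
        exact Nat.Coprime.coprime_mul_left_right h1
    obtain ⟨p, hpgt, hp, hmod⟩ := Nat.forall_exists_prime_gt_and_modEq (4 * m) (q := 4 * m)
      (by omega) hcop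
    have hap : a ≤ p := by rcases hc1 with rfl | rfl <;> omega
    obtain ⟨j, hj⟩ := (Nat.modEq_iff_dvd' hap).1 hmod.symm
    have hpe : 2 * p + 1 = (8 * j + c) * m := by
      have : p = 4 * m * j + a := by omega
      rw [this, add_mul, ← ha]; ring
    have hp4 : (m % 8 = 5 ∧ p % 4 = 3) ∨ (m % 8 ≠ 5 ∧ p % 4 = 1) := by
      have : p = 4 * (m * j) + a := by rw [← mul_assoc]; omega
      omega
    set d := 8 * j + c with hd
    have hdodd : Odd d := by rw [Nat.odd_iff]; omega
    have hpodd : Odd p := by rw [Nat.odd_iff]; omega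
    have hJ2 : J((p : ℤ) | d) = J(-1 | d) * J(2 | d) := by
      have h1 : J(2 * (p : ℤ) | d) = J(-1 | d) := by
        apply jacobiSym.mod_left'
        apply Int.ModEq.symm
        rw [Int.modEq_iff_dvd]
        refine ⟨m, ?_⟩
        have : (2 * (p : ℤ) + 1) = d * m := by exact_mod_cast hpe
        linarith
      rw [jacobiSym.mul_left] at h1
      have h2 : J(2 | d) ^ 2 = 1 := by
        apply jacobiSym.sq_one
        have : Nat.Coprime 2 d := (Nat.coprime_two_left).2 hdodd
        simpa [Int.gcd] using this
      rw [← h1]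
      linear_combination (-J((p : ℤ) | d)) * h2
    have hJ : J(-(d : ℤ) | p) = 1 := by
      rw [neg_eq_neg_one_mul, jacobiSym.mul_left]
      rcases hc with ⟨h, hc⟩ | ⟨h, hc⟩ | ⟨h, hc⟩
      · rw [jac_neg_one_of (by omega), one_mul,
          jacobiSym.quadratic_reciprocity_one_mod_four' hdodd (by omega), hJ2,
          jac_neg_one_of' (by omega), jacobiSym.at_two hdodd, ZMod.χ₈_nat_eq_if_mod_eight,
          if_neg (by omega), if_neg (by omega)]
        norm_num
      · rw [jac_neg_one_of (by omega), one_mul,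
          jacobiSym.quadratic_reciprocity_one_mod_four' hdodd (by omega), hJ2,
          jac_neg_one_of (by omega), jacobiSym.at_two hdodd, ZMod.χ₈_nat_eq_if_mod_eight,
          if_neg (by omega), if_pos (by omega)]
        norm_num
      · rw [jac_neg_one_of' (by omega),
          jacobiSym.quadratic_reciprocity_three_mod_four (by omega) (by omega), hJ2,
          jac_neg_one_of' (by omega), jacobiSym.at_two hdodd, ZMod.χ₈_nat_eq_if_mod_eight,
          if_neg (by omega), if_neg (by omega)]
        norm_num
    obtain ⟨t, ht⟩ := sq_of_jac p d hp hJ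
    obtain ⟨t', ht', hodd'⟩ : ∃ t' : ℤ, (p : ℤ) ∣ t' ^ 2 + d ∧ t' % 2 = 1 := by
      rcases Int.emod_two_eq_zero_or_one t with h | h
      · refine ⟨t + p, ?_, ?_⟩
        · have : (t + p) ^ 2 + (d : ℤ) = (t ^ 2 + d) + p * (2 * t + p) := by ring
          rw [this]
          exact dvd_add ht (dvd_mul_right _ _)
        · have : (p : ℤ) % 2 = 1 := by have := Nat.odd_iff.1 hpodd; omega
          omega
      · exact ⟨t, ht, h⟩
    refine rep_of_residue m d (2 * p) (by omega) (by rw [← hpe]; have := hp.pos; omega) t' ?_ ?_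
    · have : (2 * (p : ℤ) + 1) = d * m := by exact_mod_cast hpe
      push_cast
      linarith
    · push_cast
      apply IsCoprime.mul_dvd
      · rw [Int.isCoprime_iff_gcd_eq_one]
        have : Nat.Coprime 2 p := (Nat.coprime_two_left).2 hpodd
        simpa [Int.gcd] using this
      · have h1 : (d : ℤ) % 2 = 1 := by have := Nat.odd_iff.1 hdodd; omega
        have h2 : t' ^ 2 % 2 = 1 := by rw [pow_two, Int.mul_emod, hodd']; rfl
        omega
      · exact ht'

end PartP2

section PartP3

open scoped Quaternion
open Quaternion (normSq)

lemma self_mul_star' (β : ℍ[ℤ]) : β * star β = (Int.cast (normSq β) : ℍ[ℤ]) := by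
  rw [Quaternion.self_mul_star]
  ext <;> simp

def mkQ (a b c d : ℤ) : ℍ[ℤ] := ⟨a, b, c, d⟩
@[simp] lemma mkQ_re (a b c d : ℤ) : (mkQ a b c d).re = a := rfl
@[simp] lemma mkQ_imI (a b c d : ℤ) : (mkQ a b c d).imI = b := rfl
@[simp] lemma mkQ_imJ (a b c d : ℤ) : (mkQ a b c d).imJ = c := rfl
@[simp] lemma mkQ_imK (a b c d : ℤ) : (mkQ a b c d).imK = d := rfl

lemma intCast_quat_ne {z : ℤ} (h : z ≠ 0) : (Int.cast z : ℍ[ℤ]) ≠ 0 := by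
  intro h'
  have := congrArg QuaternionAlgebra.re h'
  simp at this
  exact h this

/-- even norm elements are divisible by an element of norm two -/
lemma even_norm_div (ρ : ℍ[ℤ]) (h : Even (normSq ρ)) :
    ∃ u ρ' : ℍ[ℤ], normSq u = 2 ∧ ρ = u * ρ' := by
  rw [Quaternion.normSq_def'] at h
  obtain ⟨a, ha⟩ : ∃ a, a = ρ.re := ⟨_, rfl⟩
  obtain ⟨b, hb⟩ : ∃ a, a = ρ.imI := ⟨_, rfl⟩
  obtain ⟨c, hc⟩ : ∃ a, a = ρ.imJ := ⟨_, rfl⟩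
  obtain ⟨d, hd⟩ : ∃ a, a = ρ.imK := ⟨_, rfl⟩
  rw [← ha, ← hb, ← hc, ← hd] at h
  simp only [Int.even_add, Int.even_pow, ne_eq, OfNat.ofNat_ne_zero, not_false_eq_true,
    and_true] at h
  have key : (a % 2 = b % 2 ∧ c % 2 = d % 2) ∨ (a % 2 = c % 2 ∧ b % 2 = d % 2) ∨
      (a % 2 = d % 2 ∧ b % 2 = c % 2) := by
    simp only [Int.even_iff] at h
    omega
  rcases key with ⟨h1, h2⟩ | ⟨h1, h2⟩ | ⟨h1, h2⟩
  · refine ⟨mkQ 1 1 0 0, mkQ ((a + b) / 2) ((b - a) / 2) ((c + d) / 2) ((d - c) / 2), ?_, ?_⟩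
    · rw [Quaternion.normSq_def']; norm_num
    · ext <;> simp [← ha, ← hb, ← hc, ← hd] <;> omega
  · refine ⟨mkQ 1 0 1 0, mkQ ((a + c) / 2) ((b - d) / 2) ((c - a) / 2) ((b + d) / 2), ?_, ?_⟩
    · rw [Quaternion.normSq_def']; norm_num
    · ext <;> simp [← ha, ← hb, ← hc, ← hd] <;> omega
  · refine ⟨mkQ 1 0 0 1, mkQ ((a + d) / 2) ((b + c) / 2) ((c - b) / 2) ((d - a) / 2), ?_, ?_⟩
    · rw [Quaternion.normSq_def']; norm_num
    · ext <;> simp [← ha, ← hb, ← hc, ← hd] <;> omega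

lemma odd_elt (J : Ideal ℍ[ℤ]) (n : ℤ) (hn : Odd n) (hJ : (n : ℍ[ℤ]) ∈ J) (ρ : ℍ[ℤ])
    (hρ : ρ ∈ J) (h0 : ρ ≠ 0) : ∃ ρ' ∈ J, Odd (normSq ρ') ∧ normSq ρ' ≤ normSq ρ := by
  induction hN : (normSq ρ).toNat using Nat.strong_induction_on generalizing ρ with
  | _ N ih =>
    by_cases hodd : Odd (normSq ρ)
    · exact ⟨ρ, hρ, hodd, le_rfl⟩
    · obtain ⟨u, ρ', hu, rfl⟩ := even_norm_div ρ (Int.not_odd_iff_even.1 hodd)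
      have hne : ρ' ≠ 0 := by rintro rfl; simp at h0
      have hpos : 0 < normSq ρ' :=
        lt_of_le_of_ne (Quaternion.normSq_nonneg) (Ne.symm (Quaternion.normSq_ne_zero.2 hne))
      have h2 : (2 : ℍ[ℤ]) * ρ' ∈ J := by
        have : star u * (u * ρ') = 2 * ρ' := by
          rw [← mul_assoc, Quaternion.star_mul_self, hu]
          rfl
        rw [← this]
        exact J.mul_mem_left _ hρ
      have h3 : (n : ℍ[ℤ]) * ρ' ∈ J := by
        rw [(Int.cast_commute n ρ').eq]
        exact J.mul_mem_left _ hJ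
      obtain ⟨k, hk⟩ := hn
      have h4 : ρ' ∈ J := by
        have : ρ' = (n : ℍ[ℤ]) * ρ' - (k : ℍ[ℤ]) * (2 * ρ') := by
          rw [hk]; push_cast; noncomm_ring
        rw [this]
        exact J.sub_mem h3 (J.mul_mem_left _ h2)
      have hnorm : normSq (u * ρ') = 2 * normSq ρ' := by rw [map_mul, hu]
      obtain ⟨ρ'', h5, h6, h7⟩ := ih (normSq ρ').toNat (by omega) ρ' h4 hne rfl
      exact ⟨ρ'', h5, h6, by omega⟩

lemma sq_lt_of_odd (e N : ℤ) (hN : Odd N) (h : 4 * e ^ 2 ≤ N ^ 2) : 4 * e ^ 2 < N ^ 2 := by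
  rcases h.lt_or_eq with h | h
  · exact h
  · exfalso
    have h1 : Odd (N ^ 2) := hN.pow
    rw [← h] at h1
    have h2 : Even (4 * e ^ 2) := ⟨2 * e ^ 2, by ring⟩
    exact (Int.not_even_iff_odd.2 h1) h2

lemma ideal_principal (J : Ideal ℍ[ℤ]) (n : ℤ) (hn : Odd n) (hJ : (n : ℍ[ℤ]) ∈ J) :
    ∃ β ∈ J, β ≠ 0 ∧ ∀ α ∈ J, ∃ γ, α = γ * β := by
  have hex : ∃ N : ℕ, ∃ β ∈ J, Odd (normSq β) ∧ normSq β = N := by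
    refine ⟨(n ^ 2).toNat, n, hJ, ?_, ?_⟩
    · rw [Quaternion.normSq_intCast]; exact hn.pow
    · rw [Quaternion.normSq_intCast, Int.toNat_of_nonneg (sq_nonneg _)]; rfl
  classical
  obtain ⟨β, hβ, hodd, hN⟩ := Nat.find_spec hex
  have hmin := fun k hk => Nat.find_min hex (m := k) hk
  set N := Nat.find hex
  have hβ0 : β ≠ 0 := by rintro rfl; simp at hodd
  have hNpos : 0 < normSq β :=
    lt_of_le_of_ne (Quaternion.normSq_nonneg) (Ne.symm (Quaternion.normSq_ne_zero.2 hβ0))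
  refine ⟨β, hβ, hβ0, fun α hα => ?_⟩
  set w := α * star β with hw
  obtain ⟨k1, h1⟩ := shear_exists (normSq β) w.re hNpos
  obtain ⟨k2, h2⟩ := shear_exists (normSq β) w.imI hNpos
  obtain ⟨k3, h3⟩ := shear_exists (normSq β) w.imJ hNpos
  obtain ⟨k4, h4⟩ := shear_exists (normSq β) w.imK hNpos
  replace h1 := sq_lt_of_odd _ _ hodd h1
  replace h2 := sq_lt_of_odd _ _ hodd h2
  replace h3 := sq_lt_of_odd _ _ hodd h3
  replace h4 := sq_lt_of_odd _ _ hodd h4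
  set γ : ℍ[ℤ] := mkQ (-k1) (-k2) (-k3) (-k4) with hγ
  refine ⟨γ, ?_⟩
  by_contra hne
  set ρ := α - γ * β with hρ
  have hρ0 : ρ ≠ 0 := sub_ne_zero.2 hne
  have hρJ : ρ ∈ J := J.sub_mem hα (J.mul_mem_left _ hβ)
  have hlt : normSq ρ < normSq β := by
    have e1 : ρ * star β = w - γ * (Int.cast (normSq β) : ℍ[ℤ]) := by
      rw [hρ, sub_mul, mul_assoc, self_mul_star']
    have e2 : normSq ρ * normSq β = normSq (w - γ * (Int.cast (normSq β) : ℍ[ℤ])) := by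
      rw [← e1, map_mul, Quaternion.normSq_star]
    rw [Quaternion.normSq_def' (w - _)] at e2
    simp [hγ] at e2
    nlinarith
  obtain ⟨ρ', h5, h6, h7⟩ := odd_elt J n hn hJ ρ hρJ hρ0
  have hnn : 0 ≤ normSq ρ' := Quaternion.normSq_nonneg
  refine hmin (normSq ρ').toNat (by omega) ⟨ρ', h5, h6, by omega⟩

structure PrimPt (m : ℕ) (x : ℍ[ℤ]) : Prop where
  re : x.re = 0
  norm : normSq x = m
  prim : ∃ p q r : ℤ, p * x.imI + q * x.imJ + r * x.imK = 1

lemma star_of_re {x : ℍ[ℤ]} (h : x.re = 0) : star x = -x := by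
  ext <;> simp [h]

lemma PrimPt.isUnit {m : ℕ} {x : ℍ[ℤ]} (h : PrimPt m x) (t k : ℤ) (γ : ℍ[ℤ])
    (hk : (t : ℍ[ℤ]) + x = (k : ℍ[ℤ]) * γ) : IsUnit k := by
  obtain ⟨p, q, r, hp⟩ := h.prim
  have h1 : x.imI = k * γ.imI := by have := congrArg QuaternionAlgebra.imI hk; simpa using this
  have h2 : x.imJ = k * γ.imJ := by have := congrArg QuaternionAlgebra.imJ hk; simpa using this
  have h3 : x.imK = k * γ.imK := by have := congrArg QuaternionAlgebra.imK hk; simpa using this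
  rw [h1, h2, h3] at hp
  exact IsUnit.of_mul_eq_one (p * γ.imI + q * γ.imJ + r * γ.imK) (by linarith)

lemma exists_beta {m : ℕ} {x : ℍ[ℤ]} (hx : PrimPt m x) (n : ℕ) (hn : Odd n) (t : ℤ)
    (ht : (n : ℤ) ∣ t ^ 2 + m) :
    ∃ β y δ : ℍ[ℤ], normSq β = n ∧ (t : ℍ[ℤ]) + x = δ * β ∧ β * x = y * β ∧
      y.re = 0 ∧ normSq y = m := by
  set J : Ideal ℍ[ℤ] := Submodule.span ℍ[ℤ] {((n : ℤ) : ℍ[ℤ]), (t : ℍ[ℤ]) + x} with hJ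
  have hnJ : ((n : ℤ) : ℍ[ℤ]) ∈ J := Submodule.subset_span (by simp)
  have htJ : (t : ℍ[ℤ]) + x ∈ J := Submodule.subset_span (by simp)
  have hnodd : Odd (n : ℤ) := by exact_mod_cast hn
  obtain ⟨β, hβ, hβ0, hdiv⟩ := ideal_principal J n hnodd hnJ
  obtain ⟨γ, hγ⟩ := hdiv _ hnJ
  obtain ⟨δ, hδ⟩ := hdiv _ htJ
  obtain ⟨a, b, hab⟩ := Submodule.mem_span_pair.1 hβ
  simp only [smul_eq_mul] at hab
  have hn0 : (n : ℤ) ≠ 0 := by rintro h; rw [h] at hnodd; simp at hnodd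
  have hNpos : 0 < normSq β :=
    lt_of_le_of_ne (Quaternion.normSq_nonneg) (Ne.symm (Quaternion.normSq_ne_zero.2 hβ0))
  have htx : normSq ((t : ℍ[ℤ]) + x) = t ^ 2 + m := by
    rw [← hx.norm, Quaternion.normSq_def', Quaternion.normSq_def' x]
    simp [hx.re]; ring
  obtain ⟨k, hk⟩ : (n : ℤ) ∣ normSq β := by
    rw [← hab, Quaternion.normSq_add, map_mul, map_mul, htx, Quaternion.normSq_intCast]
    refine dvd_add (dvd_add ?_ ?_) ?_
    · exact Dvd.dvd.mul_left (Dvd.intro _ (by rw [sq]; rfl)) _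
    · exact Dvd.dvd.mul_left ht _
    · apply Dvd.dvd.mul_left
      have : a * ((n : ℤ) : ℍ[ℤ]) * star (b * ((t : ℍ[ℤ]) + x)) =
          ((n : ℤ) : ℍ[ℤ]) * (a * star (b * ((t : ℍ[ℤ]) + x))) := by
        rw [← (Int.cast_commute (n : ℤ) a).eq, mul_assoc]
      rw [this]
      refine ⟨(a * star (b * ((t : ℍ[ℤ]) + x))).re, ?_⟩
      simp
  have hkβ : star β = (k : ℍ[ℤ]) * γ := by
    have h1 : ((n : ℤ) : ℍ[ℤ]) * star β = ((n : ℤ) : ℍ[ℤ]) * ((k : ℍ[ℤ]) * γ) := by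
      calc ((n : ℤ) : ℍ[ℤ]) * star β = γ * (β * star β) := by rw [hγ, mul_assoc]
        _ = γ * (((n : ℤ) * k : ℤ) : ℍ[ℤ]) := by
          rw [self_mul_star', hk]
        _ = _ := by rw [← (Int.cast_commute _ γ).eq]; push_cast; rw [mul_assoc]
    exact mul_left_cancel₀ (intCast_quat_ne hn0) h1
  have hkunit : IsUnit k := by
    refine hx.isUnit t k (δ * star γ) ?_
    have : β = (k : ℍ[ℤ]) * star γ := by
      rw [← star_star β, hkβ, star_mul]
      rw [(Int.cast_commute k (star γ)).eq]
      simp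
    rw [hδ, this, ← mul_assoc, ← (Int.cast_commute k δ).eq, mul_assoc]
  have hk1 : k = 1 := by
    rcases Int.isUnit_iff.1 hkunit with h | h
    · exact h
    · rw [h] at hk
      have : (0 : ℤ) ≤ n := by positivity
      omega
  have hβn : normSq β = n := by rw [hk, hk1, mul_one]
  have hβx : β * x ∈ J := by
    rw [← hab, add_mul]
    refine J.add_mem ?_ ?_
    · rw [mul_assoc, (Int.cast_commute (n : ℤ) x).eq, ← mul_assoc]
      exact J.mul_mem_left _ hnJ
    · have : b * ((t : ℍ[ℤ]) + x) * x = (b * x) * ((t : ℍ[ℤ]) + x) := by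
        rw [mul_assoc, mul_assoc, add_mul, mul_add x, (Int.cast_commute t x).eq]
      rw [this]
      exact J.mul_mem_left _ htJ
  obtain ⟨y, hy⟩ := hdiv _ hβx
  refine ⟨β, y, δ, hβn, hδ, hy, ?_, ?_⟩
  · have h1 : β * x * star β = (y * ((n : ℤ) : ℍ[ℤ])) := by
      rw [hy, mul_assoc, self_mul_star', hβn]
    have h2 : star (β * x * star β) = -(β * x * star β) := by
      rw [star_mul, star_mul, star_star, star_of_re hx.re]; noncomm_ring
    rw [h1, star_mul] at h2
    have h3 := congrArg QuaternionAlgebra.re h2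
    simp at h3
    rcases (mul_eq_zero.1 (show (n : ℤ) * y.re = 0 by linarith)) with h | h
    · exact absurd h hn0
    · exact h
  · have h1 := congrArg normSq hy
    rw [map_mul, map_mul, hx.norm] at h1
    have h2 : normSq β * (m : ℤ) = normSq β * normSq y := by rw [h1, mul_comm]
    exact (mul_left_cancel₀ hNpos.ne' h2).symm

lemma beta_inj {m : ℕ} {x : ℍ[ℤ]} (hx : PrimPt m x) (n : ℕ) (hn : 0 < n) (t t' : ℤ) (β δ δ' : ℍ[ℤ])
    (hβ : normSq β = n) (h1 : (t : ℍ[ℤ]) + x = δ * β) (h2 : (t' : ℍ[ℤ]) + x = δ' * β) :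
    (n : ℤ) ∣ t - t' := by
  have h3 : ((t - t' : ℤ) : ℍ[ℤ]) = (δ - δ') * β := by
    rw [sub_mul, ← h1, ← h2]; push_cast; abel
  have h4 : ((t - t' : ℤ) : ℍ[ℤ]) * star β = ((n : ℤ) : ℍ[ℤ]) * (δ - δ') := by
    rw [h3, mul_assoc, self_mul_star', hβ]
    exact (Int.cast_commute (n : ℤ) (δ - δ')).eq.symm
  set g := Int.gcd n (t - t') with hg
  have hgpos : 0 < g := Int.gcd_pos_of_ne_zero_left _ (by exact_mod_cast hn.ne')
  obtain ⟨a, ha⟩ : (g : ℤ) ∣ n := Int.gcd_dvd_left _ _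
  obtain ⟨b, hb⟩ : (g : ℤ) ∣ t - t' := Int.gcd_dvd_right _ _
  have hcop : IsCoprime a b := by
    have := Int.gcd_eq_gcd_ab n (t - t')
    refine ⟨Int.gcdA n (t - t'), Int.gcdB n (t - t'), ?_⟩
    rw [← hg] at this
    have hg0 : (g : ℤ) ≠ 0 := by exact_mod_cast hgpos.ne'
    apply mul_left_cancel₀ hg0
    generalize Int.gcdA n (t - t') = A at *
    generalize Int.gcdB n (t - t') = B at *
    rw [mul_one]
    conv_rhs => rw [this]
    rw [ha, hb]; ring
  have h5 : (b : ℍ[ℤ]) * star β = (a : ℍ[ℤ]) * (δ - δ') := by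
    rw [ha, hb] at h4
    push_cast at h4
    rw [mul_assoc, mul_assoc] at h4
    refine mul_left_cancel₀ ?_ h4
    exact intCast_quat_ne (by exact_mod_cast hgpos.ne')
  obtain ⟨u, v, huv⟩ := hcop
  have h6 : star β = (a : ℍ[ℤ]) * ((u : ℍ[ℤ]) * star β + (v : ℍ[ℤ]) * (δ - δ')) := by
    rw [← zsmul_eq_mul, ← zsmul_eq_mul] at h5
    rw [← zsmul_eq_mul, ← zsmul_eq_mul, ← zsmul_eq_mul]
    calc star β = (u * a + v * b) • star β := by rw [huv, one_smul]
      _ = (u * a) • star β + v • (b • star β) := by module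
      _ = _ := by rw [h5]; module
  have ha1 : IsUnit a := by
    set W := (u : ℍ[ℤ]) * star β + (v : ℍ[ℤ]) * (δ - δ')
    refine hx.isUnit t a (δ * star W) ?_
    have : β = (a : ℍ[ℤ]) * star W := by
      rw [← star_star β, h6, star_mul, (Int.cast_commute a (star W)).eq]
      simp
    rw [h1, this, ← mul_assoc, ← (Int.cast_commute a δ).eq, mul_assoc]
  obtain ⟨a', ha'⟩ := ha1.exists_right_inv
  refine ⟨a' * b, ?_⟩
  rw [ha, hb]
  linear_combination (-(g : ℤ) * b) * ha'

end PartP3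

section PartP3b

open scoped Quaternion
open Quaternion (normSq)

lemma latSphere_finite (d m : ℕ) : (latSphere d m).Finite := by
  refine Set.Finite.subset (Set.finite_Icc (fun _ : Fin d => -(m : ℤ)) (fun _ => (m : ℤ))) ?_
  intro x hx
  have hx' : ∑ i, x i ^ 2 = (m : ℤ) := hx
  have key : ∀ i, x i ^ 2 ≤ (m : ℤ) := by
    intro i
    rw [← hx']
    exact Finset.single_le_sum (f := fun i => x i ^ 2) (fun j _ => sq_nonneg _) (Finset.mem_univ i)
  constructor
  · intro i
    have := key i
    show -(m : ℤ) ≤ x i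
    nlinarith
  · intro i
    have := key i
    show x i ≤ (m : ℤ)
    nlinarith

lemma lattice_count {m : ℕ} (hm : 0 < m) {x y : ℍ[ℤ]} (hx : PrimPt m x) (hy : y.re = 0) (X : ℕ)
    (F : Finset ℍ[ℤ]) (hF : ∀ q ∈ F, q * x = y * q ∧ 0 < normSq q ∧ normSq q ≤ X) :
    (F.card : ℝ) ≤ 8 * X / √m + 2 * √X + 2 := by
  classical
  rcases F.eq_empty_or_nonempty with rfl | ⟨q0, hq0⟩
  · simp; positivity
  have hex : ∃ N : ℕ, ∃ q : ℍ[ℤ], q * x = y * q ∧ 0 < normSq q ∧ normSq q = N :=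
    ⟨(normSq q0).toNat, q0, (hF q0 hq0).1, (hF q0 hq0).2.1, by
      rw [Int.toNat_of_nonneg (hF q0 hq0).2.1.le]⟩
  obtain ⟨q1, hq1, hpos, hN⟩ := Nat.find_spec hex
  have hmin := fun k hk => Nat.find_min hex (m := k) hk
  have hle : Nat.find hex ≤ X := by
    have h1 := Nat.find_min' hex ⟨q0, (hF q0 hq0).1, (hF q0 hq0).2.1, by
      rw [Int.toNat_of_nonneg (hF q0 hq0).2.1.le]⟩
    have := (hF q0 hq0).2.2
    omega
  set N := Nat.find hex with hNdef
  have hN0 : 0 < N := by omega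
  have hcomm : ∀ q : ℍ[ℤ], q * x = y * q → (star q1 * q) * x = x * (star q1 * q) := by
    intro q hq
    have h1 : star q1 * y = x * star q1 := by
      have := congrArg star hq1
      rw [star_mul, star_mul, star_of_re hx.re, star_of_re hy] at this
      have h2 : x * star q1 = star q1 * y := by
        simpa using this
      exact h2.symm
    rw [mul_assoc, hq, ← mul_assoc, h1, mul_assoc]
  have hnorm : ∀ q : ℍ[ℤ], normSq (star q1 * q) = N * normSq q := by
    intro q; rw [map_mul, Quaternion.normSq_star, hN]
  obtain ⟨p, q, r, hpqr⟩ := hx.prim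
  set K : ℍ[ℤ] → ℤ := fun w => p * (star q1 * w).imI + q * (star q1 * w).imJ + r * (star q1 * w).imK with hK
  have hform : ∀ w : ℍ[ℤ], w * x = y * w → (N : ℤ) * normSq w = (star q1 * w).re ^ 2 + (K w) ^ 2 * m := by
    intro w hw
    have hc := hcomm w hw
    have h1 := congrArg QuaternionAlgebra.imI hc
    have h2 := congrArg QuaternionAlgebra.imJ hc
    have h3 := congrArg QuaternionAlgebra.imK hc
    rw [← hnorm w]
    set c := star q1 * w with hcdef
    have hKw : K w = p * c.imI + q * c.imJ + r * c.imK := rfl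
    clear_value c
    simp only [Quaternion.imI_mul, Quaternion.imJ_mul, Quaternion.imK_mul, hx.re] at h1 h2 h3
    have hn := hx.norm
    rw [Quaternion.normSq_def', hx.re] at hn
    have e1 : c.imI = (p * c.imI + q * c.imJ + r * c.imK) * x.imI := by
      have a1 : c.imI * x.imJ = c.imJ * x.imI := by linarith
      have a2 : c.imI * x.imK = c.imK * x.imI := by linarith
      linear_combination (-c.imI) * hpqr + q * a1 + r * a2
    have e2 : c.imJ = (p * c.imI + q * c.imJ + r * c.imK) * x.imJ := by
      have a1 : c.imI * x.imJ = c.imJ * x.imI := by linarith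
      have a2 : c.imJ * x.imK = c.imK * x.imJ := by linarith
      linear_combination (-c.imJ) * hpqr - p * a1 + r * a2
    have e3 : c.imK = (p * c.imI + q * c.imJ + r * c.imK) * x.imK := by
      have a1 : c.imI * x.imK = c.imK * x.imI := by linarith
      have a2 : c.imJ * x.imK = c.imK * x.imJ := by linarith
      linear_combination (-c.imK) * hpqr - p * a1 - q * a2
    rw [← hKw] at e1 e2 e3
    rw [Quaternion.normSq_def', e1, e2, e3, ← hn]; ring
  set u : ℝ := √(N * X / m) with hu
  set v : ℝ := √(X / N) with hv
  have hu0 : 0 ≤ u := Real.sqrt_nonneg _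
  have hv0 : 0 ≤ v := Real.sqrt_nonneg _
  have hNR : (0 : ℝ) < N := by exact_mod_cast hN0
  have hmR : (0 : ℝ) < m := by exact_mod_cast hm
  have hXR : (N : ℝ) ≤ X := by exact_mod_cast hle
  set f : ℍ[ℤ] → ℤ × ℤ := fun w => (K w, (star q1 * w).re / N) with hf
  set B : Finset (ℤ × ℤ) := (Finset.Icc (-⌊u⌋) ⌊u⌋) ×ˢ (Finset.Icc (-⌊v⌋ - 1) ⌊v⌋) with hB
  have hmaps : ∀ w ∈ F, f w ∈ B := by
    intro w hw
    obtain ⟨w1, w2, w3⟩ := hF w hw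
    have h1 := hform w w1
    have hN' : (0 : ℤ) < N := by exact_mod_cast hN0
    have hb : (star q1 * w).re ^ 2 + (K w) ^ 2 * m ≤ N * X := by
      rw [← h1]; exact mul_le_mul_of_nonneg_left w3 hN'.le
    have hbR : (((star q1 * w).re : ℤ) : ℝ) ^ 2 + ((K w : ℤ) : ℝ) ^ 2 * m ≤ N * X := by exact_mod_cast hb
    set a := (star q1 * w).re
    have k1 : |((K w : ℤ) : ℝ)| ≤ u := by
      apply Real.abs_le_sqrt
      rw [le_div_iff₀ hmR]
      nlinarith [sq_nonneg (a : ℝ)]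
    have a1 : |(a : ℝ) / N| ≤ v := by
      apply Real.abs_le_sqrt
      rw [div_pow, div_le_div_iff₀ (by positivity) hNR]
      have : (a : ℝ) ^ 2 ≤ N * X := by nlinarith [mul_nonneg (sq_nonneg ((K w : ℤ) : ℝ)) hmR.le]
      nlinarith
    rw [abs_le] at k1 a1
    have f1 : a / (N : ℤ) = ⌊(a : ℝ) / N⌋ := by
      rw [Int.floor_div_natCast, Int.floor_intCast]
    simp only [hB, hf, Finset.mem_product, Finset.mem_Icc]
    refine ⟨⟨?_, ?_⟩, ?_, ?_⟩
    · rw [neg_le]; rw [Int.le_floor]; push_cast; linarith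
    · rw [Int.le_floor]; exact k1.2
    · rw [f1, Int.le_floor]
      have h9 : ((-⌊v⌋ - 1 : ℤ) : ℝ) ≤ -v := by
        push_cast
        linarith [Int.lt_floor_add_one v]
      linarith
    · rw [f1]; exact Int.floor_le_floor a1.2
  have hinj : Set.InjOn f F := by
    intro w hw w' hw' hww
    simp only [hf, Prod.mk.injEq] at hww
    by_contra hne
    have hL : (w - w') * x = y * (w - w') := by
      rw [sub_mul, mul_sub, (hF w hw).1, (hF w' hw').1]
    have h1 := hform _ hL
    have hK0 : K (w - w') = 0 := by
      have : K (w - w') = K w - K w' := by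
        simp only [hK, mul_sub, Quaternion.imI_sub, Quaternion.imJ_sub, Quaternion.imK_sub]; ring
      rw [this, hww.1, sub_self]
    have hre : (star q1 * (w - w')).re = (star q1 * w).re - (star q1 * w').re := by
      rw [mul_sub, Quaternion.re_sub]
    rw [hK0, hre] at h1
    have hN' : (0 : ℤ) < N := by exact_mod_cast hN0
    have d1 := Int.mul_ediv_add_emod (star q1 * w).re N
    have d2 := Int.mul_ediv_add_emod (star q1 * w').re N
    have d3 := Int.emod_nonneg (star q1 * w).re hN'.ne'
    have d4 := Int.emod_nonneg (star q1 * w').re hN'.ne'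
    have d5 := Int.emod_lt_of_pos (star q1 * w).re hN'
    have d6 := Int.emod_lt_of_pos (star q1 * w').re hN'
    rw [hww.2] at d1
    have b1 : |(star q1 * w).re - (star q1 * w').re| < N := by
      rw [abs_lt]; constructor <;> linarith
    have b2 : ((star q1 * w).re - (star q1 * w').re) ^ 2 < (N : ℤ) ^ 2 := by
      rw [sq_lt_sq, abs_of_pos hN']; exact b1
    have b3 : normSq (w - w') < N := by
      have : (N : ℤ) * normSq (w - w') < N * N := by rw [h1]; linarith
      exact lt_of_mul_lt_mul_left this hN'.le
    have b4 : 0 < normSq (w - w') :=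
      lt_of_le_of_ne (Quaternion.normSq_nonneg) (Ne.symm (Quaternion.normSq_ne_zero.2 (sub_ne_zero.2 hne)))
    exact hmin (normSq (w - w')).toNat (by omega) ⟨w - w', hL, b4, by omega⟩
  have hcard := Finset.card_le_card_of_injOn f hmaps hinj
  have hcB : (B.card : ℝ) ≤ (2 * u + 1) * (2 * v + 2) := by
    rw [hB, Finset.card_product, Int.card_Icc, Int.card_Icc]
    have fu : 0 ≤ ⌊u⌋ := Int.floor_nonneg.2 hu0
    have fv : 0 ≤ ⌊v⌋ := Int.floor_nonneg.2 hv0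
    have e1 : ((⌊u⌋ + 1 - -⌊u⌋).toNat : ℝ) = 2 * (⌊u⌋ : ℝ) + 1 := by
      have : (((⌊u⌋ + 1 - -⌊u⌋).toNat : ℤ) : ℝ) = ((2 * ⌊u⌋ + 1 : ℤ) : ℝ) := by
        congr 1; rw [Int.toNat_of_nonneg (by omega)]; ring
      rw [Int.cast_natCast] at this; rw [this]; push_cast; ring
    have e2 : ((⌊v⌋ + 1 - (-⌊v⌋ - 1)).toNat : ℝ) = 2 * (⌊v⌋ : ℝ) + 2 := by
      have : (((⌊v⌋ + 1 - (-⌊v⌋ - 1)).toNat : ℤ) : ℝ) = ((2 * ⌊v⌋ + 2 : ℤ) : ℝ) := by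
        congr 1; rw [Int.toNat_of_nonneg (by omega)]; ring
      rw [Int.cast_natCast] at this; rw [this]; push_cast; ring
    rw [Nat.cast_mul, e1, e2]
    have := Int.floor_le u
    have := Int.floor_le v
    have : (0 : ℝ) ≤ ⌊v⌋ := by exact_mod_cast fv
    gcongr
  have huv : u * v = X / √m := by
    rw [hu, hv, ← Real.sqrt_mul (by positivity)]
    have : (N : ℝ) * X / m * (X / N) = X ^ 2 / m := by field_simp
    rw [this, Real.sqrt_div (by positivity), Real.sqrt_sq (by positivity)]
  have hu1 : u ≤ X / √m := by
    rw [← huv]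
    have : 1 ≤ v := by
      rw [hv, Real.one_le_sqrt, le_div_iff₀ hNR]; linarith
    nlinarith
  have hv1 : v ≤ √X := by
    apply Real.sqrt_le_sqrt
    apply div_le_self (by positivity)
    exact_mod_cast hN0
  have : (F.card : ℝ) ≤ B.card := by exact_mod_cast hcard
  have h8 : 8 * (X : ℝ) / √m = 8 * (X / √m) := by ring
  rw [h8]
  nlinarith

/-- pairs (n,t), n odd up to X, t a square root of -m mod n -/
def rootPairs (m X : ℕ) : Finset (ℕ × ℕ) :=
  ((Finset.range (X + 1)) ×ˢ (Finset.range (X + 1))).filter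
    (fun a => Odd a.1 ∧ a.2 < a.1 ∧ (a.1 : ℤ) ∣ (a.2 : ℤ) ^ 2 + m)

lemma rootPairs_card (m : ℕ) (h0 : m % 8 ≠ 0) (h4 : m % 8 ≠ 4) (h7 : m % 8 ≠ 7) (X : ℕ) :
    ((rootPairs m X).card : ℝ) ≤
      (8 * X / √m + 2 * √X + 2) * ((latSphere 3 m).ncard : ℝ) := by
  classical
  have hm : 0 < m := by omega
  obtain ⟨x1, x2, x3, p, q, r, hx, hp⟩ := three_squares_primitive m h0 h4 h7
  set x : ℍ[ℤ] := mkQ 0 x1 x2 x3 with hxdef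
  have hP : PrimPt m x := ⟨rfl, by rw [Quaternion.normSq_def']; simp [hxdef]; linarith, p, q, r, hp⟩
  have hex : ∀ a : ℕ × ℕ, ∃ β y δ : ℍ[ℤ], a ∈ rootPairs m X →
      (normSq β = a.1 ∧ ((a.2 : ℤ) : ℍ[ℤ]) + x = δ * β ∧ β * x = y * β ∧
      y.re = 0 ∧ normSq y = m) := by
    intro a
    by_cases ha : a ∈ rootPairs m X
    · have ha' := (Finset.mem_filter.1 ha).2
      obtain ⟨β, y, δ, h⟩ := exists_beta hP a.1 ha'.1 a.2 ha'.2.2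
      exact ⟨β, y, δ, fun _ => h⟩
    · exact ⟨0, 0, 0, fun h => absurd h ha⟩
  choose β y δ hβ using hex
  set g : ℕ × ℕ → (Fin 3 → ℤ) := fun a => ![(y a).imI, (y a).imJ, (y a).imK] with hg
  have hfin := latSphere_finite 3 m
  set B : ℝ := 8 * X / √m + 2 * √X + 2 with hB
  have hB0 : 0 ≤ B := by positivity
  have key := Finset.card_le_mul_card_image_of_maps_to (s := rootPairs m X) (t := hfin.toFinset)
    (f := g) (by
      intro a ha
      obtain ⟨-, -, -, h1, h2⟩ := hβ a ha
      rw [Set.Finite.mem_toFinset]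
      show ∑ i, g a i ^ 2 = (m : ℤ)
      rw [Quaternion.normSq_def', h1] at h2
      simp [hg, Fin.sum_univ_three]
      linarith) ⌊B⌋₊ (by
      intro z hz
      rw [Nat.le_floor_iff hB0]
      set y0 : ℍ[ℤ] := mkQ 0 (z 0) (z 1) (z 2) with hy0
      set T := (rootPairs m X).filter (fun a => g a = z) with hT
      have hyT : ∀ a ∈ T, y a = y0 := by
        intro a ha
        have h1 := (Finset.mem_filter.1 ha).2
        obtain ⟨-, -, -, h2, -⟩ := hβ a (Finset.mem_filter.1 ha).1
        rw [← h1] at hy0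
        ext
        · rw [hy0, h2]; rfl
        · rw [hy0]; rfl
        · rw [hy0]; rfl
        · rw [hy0]; rfl
      have hinj : Set.InjOn β T := by
        intro a ha a' ha' haa
        have ha1 := (Finset.mem_filter.1 ha).1
        have ha1' := (Finset.mem_filter.1 ha').1
        obtain ⟨b1, b2, -⟩ := hβ a ha1
        obtain ⟨c1, c2, -⟩ := hβ a' ha1'
        have hn : a.1 = a'.1 := by
          have : (a.1 : ℤ) = a'.1 := by rw [← b1, ← c1, haa]
          exact_mod_cast this
        have r1 := (Finset.mem_filter.1 ha1).2
        have r2 := (Finset.mem_filter.1 ha1').2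
        rw [← haa] at c2
        have hd := beta_inj hP a.1 r1.1.pos a.2 a'.2 (β a) (δ a) (δ a') b1 b2 c2
        have ht : a.2 = a'.2 := by
          have hl1 := r1.2.1
          have hl2 := r2.2.1
          have hz : (a.2 : ℤ) - a'.2 = 0 := by
            apply Int.eq_zero_of_abs_lt_dvd hd
            rw [abs_lt]; omega
          omega
        exact Prod.ext hn ht
      rw [← Finset.card_image_of_injOn hinj]
      apply lattice_count hm hP (y := y0) rfl X
      intro q hq
      obtain ⟨a, ha, rfl⟩ := Finset.mem_image.1 hq
      have ha1 := (Finset.mem_filter.1 ha).1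
      obtain ⟨b1, b2, b3, b4, b5⟩ := hβ a ha1
      have r1 := (Finset.mem_filter.1 ha1).2
      have r0 := (Finset.mem_filter.1 ha1).1
      rw [Finset.mem_product, Finset.mem_range, Finset.mem_range] at r0
      refine ⟨by rw [b3, hyT a ha], ?_, ?_⟩
      · rw [b1]; exact_mod_cast r1.1.pos
      · rw [b1]; have := r0.1; exact_mod_cast Nat.lt_succ_iff.1 this)
  rw [Set.ncard_eq_toFinset_card _ hfin]
  calc ((rootPairs m X).card : ℝ) ≤ ((⌊B⌋₊ * hfin.toFinset.card : ℕ) : ℝ) := by exact_mod_cast key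
    _ ≤ _ := by
      push_cast
      exact mul_le_mul_of_nonneg_right (Nat.floor_le hB0) (by positivity)

end PartP3b

section PartP4a

open Filter Topology MeasureTheory Complex

section charsum
variable {q : ℕ} [NeZero q]

lemma char_sum_range (χ : DirichletCharacter ℂ q) (hχ : χ ≠ 1) :
    ∑ k ∈ range q, χ (k : ZMod q) = 0 := by
  obtain ⟨n, rfl⟩ : ∃ n, q = n + 1 := ⟨q - 1, by have := NeZero.pos q; omega⟩
  have h := MulChar.sum_eq_zero_of_ne_one hχ
  rw [← h, ← Fin.sum_univ_eq_sum_range (fun k => χ (k : ZMod (n + 1)))]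
  refine Finset.sum_congr rfl fun i _ => ?_
  congr 1
  exact Fin.cast_val_eq_self i

lemma char_partial_le (χ : DirichletCharacter ℂ q) (hχ : χ ≠ 1) (n : ℕ) :
    ‖∑ k ∈ Icc 1 n, χ (k : ZMod q)‖ ≤ q := by
  have e0 : ∀ n : ℕ, ∑ k ∈ Icc 1 n, χ (k : ZMod q) = ∑ k ∈ range (n + 1), χ (k : ZMod q) - χ 0 := by
    intro n
    rw [Finset.sum_range_succ', Nat.cast_zero, add_sub_cancel_right]
    rw [Finset.range_eq_Ico, Finset.sum_Ico_add' (fun k : ℕ => χ (k : ZMod q)) 0 n 1]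
    rfl
  have hper : Function.Periodic (fun n : ℕ => ∑ k ∈ Icc 1 n, χ (k : ZMod q)) q := by
    intro n
    show ∑ k ∈ Icc 1 (n + q), χ (k : ZMod q) = ∑ k ∈ Icc 1 n, χ (k : ZMod q)
    rw [e0, e0, show n + q + 1 = q + (n + 1) by ring, Finset.sum_range_add, char_sum_range χ hχ]
    simp
  rw [← hper.map_mod_nat n]
  have hlt := Nat.mod_lt n (NeZero.pos q)
  calc ‖∑ k ∈ Icc 1 (n % q), χ (k : ZMod q)‖ ≤ ∑ k ∈ Icc 1 (n % q), (1 : ℝ) :=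
        norm_sum_le_of_le _ fun k _ => χ.norm_le_one _
    _ ≤ q := by simp; exact_mod_cast hlt.le

lemma char_partial_le' (χ : DirichletCharacter ℂ q) (hχ : χ ≠ 1) {δ : ℝ} (h0 : 0 < δ) (h1 : δ ≤ 1)
    (t : ℝ) (ht : 1 ≤ t) :
    ‖∑ k ∈ Icc 1 ⌊t⌋₊, χ (k : ZMod q)‖ ≤ (q : ℝ) ^ δ * t ^ (1 - δ) := by
  set A := ‖∑ k ∈ Icc 1 ⌊t⌋₊, χ (k : ZMod q)‖
  have hA0 : 0 ≤ A := norm_nonneg _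
  have hA1 : A ≤ q := char_partial_le χ hχ _
  have hA2 : A ≤ t := by
    calc A ≤ ∑ k ∈ Icc 1 ⌊t⌋₊, (1 : ℝ) :=
        norm_sum_le_of_le _ fun k _ => χ.norm_le_one _
    _ = ⌊t⌋₊ := by simp
    _ ≤ t := Nat.floor_le (by linarith)
  calc A = A ^ δ * A ^ (1 - δ) := by
        rw [← Real.rpow_add_of_nonneg hA0 h0.le (by linarith)]; simp
    _ ≤ _ := by
      apply mul_le_mul (Real.rpow_le_rpow hA0 hA1 h0.le) (Real.rpow_le_rpow hA0 hA2 (by linarith))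
        (Real.rpow_nonneg hA0 _) (by positivity)

lemma L_formula (χ : DirichletCharacter ℂ q) (hχ : χ ≠ 1) {s : ℂ} (hs : 0 < s.re) :
    χ.LFunction s = s * ∫ t in Set.Ioi (1 : ℝ), (∑ k ∈ Icc 1 ⌊t⌋₊, χ (k : ZMod q)) *
      (t : ℂ) ^ (-(s + 1)) := by
  set S : ℝ → ℂ := fun t => ∑ k ∈ Icc 1 ⌊t⌋₊, χ (k : ZMod q) with hS
  have hmeas : Measurable S :=
    (measurable_from_top (f := fun n : ℕ => ∑ k ∈ Icc 1 n, χ (k : ZMod q))).comp Nat.measurable_floor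
  have hloc : LocallyIntegrable S :=
    (locallyIntegrable_const (q : ℝ)).mono hmeas.aestronglyMeasurable
      (Eventually.of_forall fun t => by
        simp only [Real.norm_natCast]; exact char_partial_le χ hχ _)
  have hmel : ∀ s : ℂ, 0 < s.re → DifferentiableAt ℂ (mellin S) (-s) := by
    intro s hs
    refine mellin_differentiableAt_of_isBigO_rpow (a := 0) (b := (-s).re - 1) (hloc.locallyIntegrableOn _) ?_
      (by simpa using hs) ?_ (by linarith)
    · refine Asymptotics.IsBigO.of_bound (q : ℝ) (Eventually.of_forall fun t => ?_)
      simpa using char_partial_le χ hχ _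
    · refine (Asymptotics.isBigO_zero (E' := ℂ) _ _).congr' ?_ EventuallyEq.rfl
      filter_upwards [Ioo_mem_nhdsGT (show (0 : ℝ) < 1 by norm_num)] with t ht
      have : ⌊t⌋₊ = 0 := Nat.floor_eq_zero.2 ht.2
      simp [hS, this]
  have hmi : ∀ s : ℂ, mellin S (-s) = ∫ t in Set.Ioi (1 : ℝ), S t * (t : ℂ) ^ (-(s + 1)) := by
    intro s
    rw [← integral_Ici_eq_integral_Ioi, mellin]
    rw [setIntegral_eq_of_subset_of_forall_sdiff_eq_zero measurableSet_Ioi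
      (s := Set.Ici (1 : ℝ)) (t := Set.Ioi 0)]
    · refine setIntegral_congr_fun measurableSet_Ici fun t _ => ?_
      show (t : ℂ) ^ (-s - 1) • S t = _
      rw [smul_eq_mul, mul_comm, show -s - 1 = -(s + 1) by ring]
    · intro t ht; exact lt_of_lt_of_le one_pos (Set.mem_Ici.1 ht)
    · intro t ht
      have : t < 1 := not_le.1 ht.2
      have : ⌊t⌋₊ = 0 := Nat.floor_eq_zero.2 this
      simp [hS, this]
  rw [← hmi]
  have hopen : IsOpen {s : ℂ | 0 < s.re} := isOpen_lt continuous_const continuous_re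
  have hd1 : AnalyticOnNhd ℂ χ.LFunction {s : ℂ | 0 < s.re} :=
    (χ.differentiable_LFunction hχ).differentiableOn.analyticOnNhd hopen
  have hd2 : AnalyticOnNhd ℂ (fun s => s * mellin S (-s)) {s : ℂ | 0 < s.re} := by
    refine DifferentiableOn.analyticOnNhd (fun s hs => ?_) hopen
    refine (differentiableAt_id.mul ?_).differentiableWithinAt
    exact (hmel s hs).comp s differentiable_neg.differentiableAt
  have hpre : IsPreconnected {s : ℂ | 0 < s.re} :=
    (convex_halfSpace_re_gt 0).isPreconnected
  refine hd1.eqOn_of_preconnected_of_eventuallyEq hd2 hpre (z₀ := 2) (by simp) ?_ hs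
  have h2 : {s : ℂ | 1 < s.re} ∈ 𝓝 (2 : ℂ) :=
    (isOpen_lt continuous_const continuous_re).mem_nhds (by simp)
  filter_upwards [h2] with s hs
  rw [hmi, χ.LFunction_eq_LSeries hs]
  refine LSeries_eq_mul_integral (fun n => χ (n : ZMod q)) le_rfl (by linarith [show 1 < s.re from hs])
    (χ.LSeriesSummable_of_one_lt_re hs) ?_
  refine Asymptotics.IsBigO.of_bound (q : ℝ) (Eventually.of_forall fun t => ?_)
  simpa using char_partial_le χ hχ t

lemma L_bound (χ : DirichletCharacter ℂ q) (hχ : χ ≠ 1) {δ : ℝ} (h0 : 0 < δ) (h1 : δ ≤ 1)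
    {s : ℂ} (hs : 1 - δ < s.re) :
    ‖χ.LFunction s‖ ≤ ‖s‖ * ((q : ℝ) ^ δ / (s.re + δ - 1)) := by
  rw [L_formula χ hχ (by linarith), norm_mul]
  refine mul_le_mul_of_nonneg_left ?_ (norm_nonneg _)
  have hintg := integrableOn_Ioi_rpow_of_lt (a := -s.re - δ) (c := 1) (by linarith) one_pos
  calc ‖∫ t in Set.Ioi (1 : ℝ), (∑ k ∈ Icc 1 ⌊t⌋₊, χ (k : ZMod q)) * (t : ℂ) ^ (-(s + 1))‖
      ≤ ∫ t in Set.Ioi (1 : ℝ), (q : ℝ) ^ δ * t ^ (-s.re - δ) := by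
        refine norm_integral_le_of_norm_le (hintg.const_mul _) ?_
        refine (ae_restrict_iff' measurableSet_Ioi).2 (Eventually.of_forall fun t ht => ?_)
        have ht1 : (1 : ℝ) < t := ht
        have ht0 : 0 < t := by linarith
        rw [norm_mul, norm_cpow_eq_rpow_re_of_pos ht0]
        calc _ ≤ ((q : ℝ) ^ δ * t ^ (1 - δ)) * t ^ (-(s + 1)).re :=
              mul_le_mul_of_nonneg_right (char_partial_le' χ hχ h0 h1 t ht1.le) (by positivity)
          _ = _ := by
            rw [mul_assoc, ← Real.rpow_add ht0]
            congr 2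
            simp; ring
    _ = _ := by
      rw [integral_const_mul, integral_Ioi_rpow_of_lt (by linarith) one_pos]
      rw [Real.one_rpow]
      rw [div_eq_mul_inv ((q : ℝ) ^ δ)]
      congr 1
      rw [neg_div, ← div_neg, one_div]
      congr 1; ring

/-- real-valuedness -/
lemma L_real (χ : DirichletCharacter ℂ q) (hχ : χ ≠ 1) (h2 : χ ^ 2 = 1) {σ : ℝ} (hs : 0 < σ) :
    (χ.LFunction σ).im = 0 := by
  have hv : ∀ a : ZMod q, ∃ r : ℝ, χ a = r := by
    intro a
    rcases MulChar.isQuadratic_iff_sq_eq_one.2 h2 a with h | h | h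
    · exact ⟨0, by simp [h]⟩
    · exact ⟨1, by simp [h]⟩
    · exact ⟨-1, by simp [h]⟩
  choose r hr using hv
  rw [L_formula χ hχ (by simpa using hs)]
  have : ∫ t in Set.Ioi (1 : ℝ), (∑ k ∈ Icc 1 ⌊t⌋₊, χ (k : ZMod q)) * (t : ℂ) ^ (-((σ : ℂ) + 1))
      = ∫ t in Set.Ioi (1 : ℝ), ((((∑ k ∈ Icc 1 ⌊t⌋₊, r (k : ZMod q)) * t ^ (-(σ + 1)) : ℝ)) : ℂ) := by
    refine setIntegral_congr_fun measurableSet_Ioi fun t ht => ?_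
    have ht0 : (0 : ℝ) ≤ t := by have : (1 : ℝ) < t := ht; linarith
    simp only [hr]
    push_cast
    rw [ofReal_cpow ht0]
    push_cast
    rfl
  have h3 : ∫ t in Set.Ioi (1 : ℝ), ((((∑ k ∈ Icc 1 ⌊t⌋₊, r (k : ZMod q)) * t ^ (-(σ + 1)) : ℝ)) : ℂ) =
      ((∫ t in Set.Ioi (1 : ℝ), ((∑ k ∈ Icc 1 ⌊t⌋₊, r (k : ZMod q)) * t ^ (-(σ + 1))) : ℝ) : ℂ) :=
    integral_ofReal
  rw [this, h3, ← ofReal_mul, ofReal_im]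

lemma L_two (χ : DirichletCharacter ℂ q) : (1 / 4 : ℝ) ≤ (χ.LFunction 2).re := by
  have hsum : LSeriesSummable (fun n => χ (n : ZMod q)) 2 := χ.LSeriesSummable_of_one_lt_re (by simp)
  rw [χ.LFunction_eq_LSeries (by simp), LSeries]
  have h := hsum.hasSum
  have hz : HasSum (fun n : ℕ => 1 / (n : ℝ) ^ 2) (Real.pi ^ 2 / 6) := hasSum_zeta_two
  have hz2 : HasSum (fun n : ℕ => if n = 1 then (2 : ℝ) else 0) 2 := by
    convert hasSum_ite_eq 1 (2 : ℝ) using 1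
  have hre := (Complex.hasSum_re h)
  have := hasSum_le (f := fun n : ℕ => (if n = 1 then (2 : ℝ) else 0) - 1 / (n : ℝ) ^ 2)
    (fun n => ?_) (hz2.sub hz) hre
  · have hpi := Real.pi_lt_d2
    have hpi0 := Real.pi_pos
    refine le_trans ?_ this
    nlinarith
  · rcases eq_or_ne n 0 with rfl | hn
    · simp
    rcases eq_or_ne n 1 with rfl | hn1
    · simp [LSeries.term]; norm_num
    · have : |(LSeries.term (fun n => χ (n : ZMod q)) 2 n).re| ≤ 1 / (n : ℝ) ^ 2 := by
        refine (Complex.abs_re_le_norm _).trans ?_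
        rw [LSeries.norm_term_eq, if_neg hn]
        have : ((n : ℝ) ^ (2 : ℂ).re) = (n : ℝ) ^ 2 := by norm_cast
        rw [this]
        gcongr
        exact χ.norm_le_one _
      simp only [hn1, if_false]
      have := (abs_le.1 this).1
      linarith

lemma L_pos (χ : DirichletCharacter ℂ q) (hχ : χ ≠ 1) (h2 : χ ^ 2 = 1) {β : ℝ} (hβ : 0 < β) (hβ2 : β ≤ 2)
    (h : ∀ σ : ℝ, β ≤ σ → σ < 1 → χ.LFunction σ ≠ 0) : 0 < (χ.LFunction β).re := by
  by_contra hneg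
  push Not at hneg
  have hcont : ContinuousOn (fun σ : ℝ => (χ.LFunction σ).re) (Set.Icc β 2) := by
    refine Continuous.continuousOn ?_
    exact continuous_re.comp ((χ.differentiable_LFunction hχ).continuous.comp continuous_ofReal)
  have := intermediate_value_Icc hβ2 hcont
  obtain ⟨σ, hσ, h0⟩ := this (show (0 : ℝ) ∈ Set.Icc _ _ from
    ⟨hneg, by have := L_two χ; push_cast; linarith⟩)
  have hz : χ.LFunction σ = 0 := by
    apply Complex.ext
    · simpa using h0
    · simpa using L_real χ hχ h2 (lt_of_lt_of_le hβ hσ.1)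
  rcases lt_or_ge σ 1 with h1 | h1
  · exact h σ hσ.1 h1 hz
  · exact χ.LFunction_ne_zero_of_one_le_re (Or.inl hχ) (by simpa using h1) hz

end charsum

end PartP4a

section PartP4b

open Filter Topology MeasureTheory Complex

lemma iteratedDeriv_sub_one_mul {H D : ℂ → ℂ} (hD : DifferentiableOn ℂ D {s | 1 < s.re})
    (hHD : ∀ s : ℂ, 1 < s.re → H s = (s - 1) * D s) (k : ℕ) :
    ∀ s : ℂ, 1 < s.re → iteratedDeriv k H s =
      (s - 1) * iteratedDeriv k D s + k * iteratedDeriv (k - 1) D s := by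
  have hopen : IsOpen {s : ℂ | 1 < s.re} := isOpen_lt continuous_const continuous_re
  have hana : AnalyticOnNhd ℂ D {s | 1 < s.re} := hD.analyticOnNhd hopen
  have hdiff : ∀ k, ∀ s : ℂ, 1 < s.re → HasDerivAt (iteratedDeriv k D) (iteratedDeriv (k + 1) D s) s := by
    intro k s hs
    rw [iteratedDeriv_succ]
    have : AnalyticAt ℂ (iteratedDeriv k D) s := by
      rw [iteratedDeriv_eq_iterate]
      exact hana.iterated_deriv k s hs
    exact this.differentiableAt.hasDerivAt
  induction k with
  | zero => intro s hs; simp [hHD s hs]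
  | succ k ih =>
    intro s hs
    rw [iteratedDeriv_succ]
    have hev : iteratedDeriv k H =ᶠ[𝓝 s] fun s =>
        (s - 1) * iteratedDeriv k D s + k * iteratedDeriv (k - 1) D s := by
      filter_upwards [hopen.mem_nhds hs] with z hz using ih z hz
    rw [hev.deriv_eq]
    have h1 : HasDerivAt (fun s : ℂ => (s - 1) * iteratedDeriv k D s)
        (1 * iteratedDeriv k D s + (s - 1) * iteratedDeriv (k + 1) D s) s :=
      ((hasDerivAt_id s).sub_const 1).mul (hdiff k s hs)
    have h2 : HasDerivAt (fun s : ℂ => (k : ℂ) * iteratedDeriv (k - 1) D s)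
        ((k : ℂ) * iteratedDeriv k D s) s := by
      rcases k with _ | k
      · simp; exact hasDerivAt_const _ _
      · exact (hdiff k s hs).const_mul _
    have h3 : HasDerivAt (fun s : ℂ => (s - 1) * iteratedDeriv k D s + k * iteratedDeriv (k - 1) D s)
        (1 * iteratedDeriv k D s + (s - 1) * iteratedDeriv (k + 1) D s +
          (k : ℂ) * iteratedDeriv k D s) s := h1.add h2
    rw [h3.deriv]
    push_cast
    simp
    ring

lemma estermann_aux {H D : ℂ → ℂ} (hH : Differentiable ℂ H)
    (hD : DifferentiableOn ℂ D {s | 1 < s.re})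
    (hHD : ∀ s : ℂ, 1 < s.re → H s = (s - 1) * D s)
    (halt : ∀ k : ℕ, 0 ≤ ((-1) ^ k * iteratedDeriv k D 2).re) {c0 M : ℝ}
    (h0 : c0 ≤ (D 2).re) (hM0 : 0 ≤ M) (hM : ∀ s : ℂ, ‖s - 2‖ = 5 / 4 → ‖H s‖ ≤ M) {β : ℝ}
    (hβ1 : 7 / 8 ≤ β) (hβ2 : β < 1) (hβ : 0 ≤ (H β).re) (K : ℕ) (hK : 0 < K)
    (hKM : 40 * M * (9 / 10 : ℝ) ^ K ≤ c0 / 2) :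
    (1 - β) * (c0 / 2) ≤ (H 1).re * (2 - β) ^ K := by
  set h : ℕ → ℝ := fun k => ((-1) ^ k * iteratedDeriv k H 2).re / (k.factorial : ℝ) with hh
  set b : ℕ → ℝ := fun k => ((-1) ^ k * iteratedDeriv k D 2).re / (k.factorial : ℝ) with hb
  have hb0 : ∀ k, 0 ≤ b k := fun k => div_nonneg (halt k) (by positivity)
  have hrec0 : h 0 = b 0 := by simp [hh, hb, hHD 2 (by simp)]; norm_num
  have hrec : ∀ k, h (k + 1) = b (k + 1) - b k := by
    intro k
    have := iteratedDeriv_sub_one_mul hD hHD (k + 1) 2 (by simp)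
    simp only [hh, hb, this]
    have e : ((-1 : ℂ) ^ (k + 1) * ((2 - 1) * iteratedDeriv (k + 1) D 2 +
        ((k + 1 : ℕ) : ℂ) * iteratedDeriv (k + 1 - 1) D 2)) =
        (-1 : ℂ) ^ (k + 1) * iteratedDeriv (k + 1) D 2 -
        (((k + 1 : ℕ) : ℝ) : ℂ) * ((-1) ^ k * iteratedDeriv k D 2) := by
      rw [pow_succ, Nat.add_sub_cancel]; push_cast; ring
    rw [e, sub_re, re_ofReal_mul, sub_div, Nat.factorial_succ]
    congr 1
    have : ((k + 1 : ℕ) : ℝ) ≠ 0 := by positivity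
    push_cast
    field_simp
  have htay : ∀ x : ℝ, HasSum (fun k => h k * x ^ k) (H ((2 - x : ℝ) : ℂ)).re := by
    intro x
    have h1 := Complex.hasSum_re (Complex.hasSum_taylorSeries_of_entire hH 2 ((2 - x : ℝ) : ℂ))
    refine h1.congr_fun ?_ |> id
    intro k
    have e : ((2 - x : ℝ) : ℂ) - 2 = ((-x : ℝ) : ℂ) := by push_cast; ring
    simp only [hh, smul_eq_mul, e]
    have e2 : ((k.factorial : ℂ))⁻¹ * (((-x : ℝ) : ℂ) ^ k * iteratedDeriv k H 2) =
        ((x ^ k / k.factorial : ℝ) : ℂ) * ((-1) ^ k * iteratedDeriv k H 2) := by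
      push_cast
      rw [neg_pow (x : ℂ)]
      ring
    rw [mul_assoc] at *
    rw [e2, re_ofReal_mul]; ring
  have hbound : ∀ k, |h k| ≤ M * (4 / 5 : ℝ) ^ k := by
    intro k
    have h1 := Complex.norm_iteratedDeriv_le_of_forall_mem_sphere_norm_le (c := (2 : ℂ)) (R := 5 / 4)
      (C := M) (f := H) k (by norm_num) hH.diffContOnCl (by
        intro z hz
        exact hM z (by simpa [dist_eq_norm] using hz))
    have h2 : |((-1) ^ k * iteratedDeriv k H 2).re| ≤ ‖iteratedDeriv k H 2‖ := by
      refine (Complex.abs_re_le_norm _).trans ?_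
      simp
    simp only [hh, abs_div, Nat.abs_cast]
    rw [div_le_iff₀ (by positivity)]
    refine (h2.trans h1).trans (le_of_eq ?_)
    rw [show (5 / 4 : ℝ) = (4 / 5)⁻¹ by norm_num, inv_pow, div_inv_eq_mul]; ring
  set lam := (H 1).re with hlam
  have hsum1 : HasSum h lam := by
    have := htay 1
    simp only [one_pow, mul_one] at this
    convert this using 2
    norm_num
  have hpart : ∀ k, ∑ j ∈ range (k + 1), h j = b k := by
    intro k
    induction k with
    | zero => simp [hrec0]
    | succ k ih => rw [Finset.sum_range_succ, ih, hrec]; ring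
  set e : ℕ → ℝ := fun k => b k - lam with he
  have hebound : ∀ k, |e k| ≤ 4 * M * (4 / 5 : ℝ) ^ k := by
    intro k
    have h1 := hsum1.summable.sum_add_tsum_nat_add (k + 1)
    rw [hpart, hsum1.tsum_eq] at h1
    have h2 : e k = -∑' i, h (i + (k + 1)) := by simp only [he]; linarith
    rw [h2, abs_neg]
    have hg : HasSum (fun i : ℕ => M * (4 / 5 : ℝ) ^ (k + 1) * (4 / 5 : ℝ) ^ i)
        (M * (4 / 5 : ℝ) ^ (k + 1) * (1 - 4 / 5)⁻¹) :=
      (hasSum_geometric_of_lt_one (by norm_num) (by norm_num)).mul_left _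
    have h3 := tsum_of_norm_bounded (f := fun i => h (i + (k + 1))) hg (fun i => by
      rw [Real.norm_eq_abs]
      refine (hbound _).trans (le_of_eq ?_)
      rw [mul_assoc, ← pow_add]; congr 2; ring)
    rw [Real.norm_eq_abs] at h3
    refine h3.trans (le_of_eq ?_)
    rw [pow_succ]; norm_num; ring
  set x := 2 - β with hx
  have hx1 : 1 < x := by linarith
  have hx2 : x ≤ 9 / 8 := by linarith
  have hex : ∀ k, |e k * x ^ k| ≤ 4 * M * (9 / 10 : ℝ) ^ k := by
    intro k
    rw [abs_mul, abs_of_pos (show 0 < x ^ k by positivity)]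
    calc |e k| * x ^ k ≤ (4 * M * (4 / 5 : ℝ) ^ k) * (9 / 8) ^ k := by
          apply mul_le_mul (hebound k) (pow_le_pow_left₀ (by linarith) hx2 k) (by positivity) (by positivity)
      _ = _ := by rw [mul_assoc, ← mul_pow]; norm_num
  have hgeo : HasSum (fun k : ℕ => 4 * M * (9 / 10 : ℝ) ^ k) (4 * M * (1 - 9 / 10)⁻¹) :=
    (hasSum_geometric_of_lt_one (by norm_num) (by norm_num)).mul_left _
  have hesum : Summable (fun k => e k * x ^ k) :=
    Summable.of_norm_bounded hgeo.summable (fun k => by rw [Real.norm_eq_abs]; exact hex k)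
  set E := ∑' k, e k * x ^ k with hE
  have hEx : (H β).re = lam - (x - 1) * E := by
    have h1 := htay x
    rw [show 2 - x = β by rw [hx]; ring] at h1
    have h2 : HasSum (fun k => h (k + 1) * x ^ (k + 1)) ((H β).re - h 0) := by
      have := (hasSum_nat_add_iff' 1).2 h1
      simpa using this
    have h3 : HasSum (fun k => e (k + 1) * x ^ (k + 1)) (E - e 0) := by
      have := (hasSum_nat_add_iff' 1).2 hesum.hasSum
      simpa using this
    have h4 : HasSum (fun k => e (k + 1) * x ^ (k + 1) - x * (e k * x ^ k)) (E - e 0 - x * E) :=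
      h3.sub (hesum.hasSum.mul_left x)
    have h5 : (fun k => h (k + 1) * x ^ (k + 1)) =
        (fun k => e (k + 1) * x ^ (k + 1) - x * (e k * x ^ k)) := by
      funext k; simp only [he, hrec]; ring
    rw [h5] at h2
    have h6 := h2.unique h4
    have h7 : e 0 = h 0 - lam := by simp only [he, hrec0]
    linarith
  have hElow : c0 - lam * ((x ^ K - 1) / (x - 1)) - c0 / 2 ≤ E := by
    have h1 := hesum.sum_add_tsum_nat_add K
    have h2 : |∑' i, e (i + K) * x ^ (i + K)| ≤ c0 / 2 := by
      have hg : HasSum (fun i : ℕ => 4 * M * (9 / 10 : ℝ) ^ K * (9 / 10 : ℝ) ^ i)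
        (4 * M * (9 / 10 : ℝ) ^ K * (1 - 9 / 10)⁻¹) :=
        (hasSum_geometric_of_lt_one (by norm_num) (by norm_num)).mul_left _
      have h3 := tsum_of_norm_bounded (f := fun i => e (i + K) * x ^ (i + K)) hg (fun i => by
        rw [Real.norm_eq_abs]
        refine (hex _).trans (le_of_eq ?_)
        rw [mul_assoc (4 * M), ← pow_add]; congr 2; ring)
      rw [Real.norm_eq_abs] at h3
      refine h3.trans (le_trans (le_of_eq ?_) hKM)
      norm_num; ring
    have h3 : c0 - lam * ((x ^ K - 1) / (x - 1)) ≤ ∑ i ∈ range K, e i * x ^ i := by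
      have e1 : ∑ i ∈ range K, e i * x ^ i =
          ∑ i ∈ range K, b i * x ^ i - lam * ∑ i ∈ range K, x ^ i := by
        rw [Finset.mul_sum, ← Finset.sum_sub_distrib]
        refine Finset.sum_congr rfl fun i _ => ?_
        simp only [he]; ring
      rw [e1, geom_sum_eq hx1.ne']
      have e2 : b 0 * x ^ 0 ≤ ∑ i ∈ range K, b i * x ^ i :=
        Finset.single_le_sum (f := fun i => b i * x ^ i)
          (fun i _ => mul_nonneg (hb0 i) (by positivity)) (Finset.mem_range.2 hK)
      have e3 : c0 ≤ b 0 := by simp only [hb]; simpa using h0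
      simp only [pow_zero, mul_one] at e2
      linarith
    have h4 := (abs_le.1 h2).1
    linarith
  have hx0 : 0 < x - 1 := by linarith
  have h9 : (x - 1) * (c0 - lam * ((x ^ K - 1) / (x - 1)) - c0 / 2) ≤ lam := by
    have := mul_le_mul_of_nonneg_left hElow hx0.le
    linarith
  have h10 : (x - 1) * (c0 - lam * ((x ^ K - 1) / (x - 1)) - c0 / 2) =
      (x - 1) * (c0 / 2) - lam * (x ^ K - 1) := by field_simp; ring
  have h11 : x - 1 = 1 - β := by rw [hx]; ring
  rw [h10, h11] at h9
  linarith

lemma estermann {H D : ℂ → ℂ} (hH : Differentiable ℂ H)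
    (hD : DifferentiableOn ℂ D {s | 1 < s.re})
    (hHD : ∀ s : ℂ, 1 < s.re → H s = (s - 1) * D s)
    (halt : ∀ k : ℕ, 0 ≤ ((-1) ^ k * iteratedDeriv k D 2).re) {c0 M : ℝ} (hc0 : 0 < c0) (hc1 : c0 ≤ 1)
    (h0 : c0 ≤ (D 2).re) (hM1 : 1 ≤ M) (hM : ∀ s : ℂ, ‖s - 2‖ = 5 / 4 → ‖H s‖ ≤ M) {β : ℝ}
    (hβ1 : 7 / 8 ≤ β) (hβ2 : β < 1) (hβ : 0 ≤ (H β).re) :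
    (1 - β) * (c0 / 2) * Real.exp (-((1 - β) * (10 * Real.log (80 * M / c0) + 2))) ≤ (H 1).re := by
  set B := 80 * M / c0 with hB
  have hB1 : 1 ≤ B := by rw [hB, le_div_iff₀ hc0]; nlinarith
  have hlog : 0 ≤ Real.log B := Real.log_nonneg hB1
  set K := ⌈10 * Real.log B⌉₊ + 1 with hK
  have hK1 : 10 * Real.log B ≤ K := by
    rw [hK]; push_cast; linarith [Nat.le_ceil (10 * Real.log B)]
  have hK2 : (K : ℝ) ≤ 10 * Real.log B + 2 := by
    rw [hK]; push_cast; linarith [Nat.ceil_lt_add_one (show 0 ≤ 10 * Real.log B by positivity)]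
  have h1 : (9 / 10 : ℝ) ^ K ≤ B⁻¹ := by
    have e1 : (9 / 10 : ℝ) ≤ Real.exp (-(1 / 10)) := by
      have := Real.add_one_le_exp (-(1 / 10) : ℝ); linarith
    calc (9 / 10 : ℝ) ^ K ≤ (Real.exp (-(1 / 10))) ^ K := pow_le_pow_left₀ (by norm_num) e1 K
      _ = Real.exp (K * (-(1 / 10))) := by rw [Real.exp_nat_mul]
      _ ≤ Real.exp (-Real.log B) := by apply Real.exp_le_exp.2; linarith
      _ = B⁻¹ := by rw [Real.exp_neg, Real.exp_log (by linarith)]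
  have h2 : 40 * M * (9 / 10 : ℝ) ^ K ≤ c0 / 2 := by
    calc 40 * M * (9 / 10 : ℝ) ^ K ≤ 40 * M * B⁻¹ := by gcongr
      _ = c0 / 2 := by rw [hB]; field_simp; norm_num
  have h3 := estermann_aux hH hD hHD halt h0 (by linarith) hM hβ1 hβ2 hβ K (by omega) h2
  set lam := (H 1).re
  have hpos : 0 < (2 - β) ^ K := by apply pow_pos; linarith
  have hlam : 0 < lam := by
    by_contra hneg
    push Not at hneg
    have : 0 < (1 - β) * (c0 / 2) := by apply mul_pos <;> linarith
    nlinarith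
  have h4 : (2 - β) ^ K ≤ Real.exp ((1 - β) * (10 * Real.log B + 2)) := by
    calc (2 - β) ^ K ≤ (Real.exp (1 - β)) ^ K := by
          apply pow_le_pow_left₀ (by linarith)
          have := Real.add_one_le_exp (1 - β); linarith
      _ = Real.exp (K * (1 - β)) := by rw [Real.exp_nat_mul]
      _ ≤ _ := by
        apply Real.exp_le_exp.2
        rw [mul_comm]
        exact mul_le_mul_of_nonneg_left hK2 (by linarith)
  rw [Real.exp_neg, ← div_eq_mul_inv, div_le_iff₀ (Real.exp_pos _)]
  exact h3.trans (mul_le_mul_of_nonneg_left h4 hlam.le)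

end PartP4b

section PartP4c

open Filter Topology MeasureTheory Complex
open scoped ComplexOrder

lemma omega_bound (A : ℝ) (hA : 1 ≤ A) (ε : ℝ) (hε : 0 < ε) :
    ∃ C : ℝ, 0 < C ∧ ∀ n : ℕ, n ≠ 0 → A ^ n.primeFactors.card ≤ C * (n : ℝ) ^ ε := by
  obtain ⟨P, hP⟩ := exists_nat_ge (A ^ (1 / ε))
  refine ⟨A ^ P, by positivity, fun n hn => ?_⟩
  have hle : ∀ p ∈ n.primeFactors, A ≤ (if p < P then A else 1) * (p : ℝ) ^ ε := by
    intro p hp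
    have hp1 : (1 : ℝ) ≤ p := by exact_mod_cast (Nat.prime_of_mem_primeFactors hp).one_lt.le
    split_ifs with h
    · have := Real.one_le_rpow hp1 hε.le
      nlinarith
    · push Not at h
      rw [one_mul]
      have h1 : A ^ (1 / ε) ≤ p := hP.trans (by exact_mod_cast h)
      calc A = (A ^ (1 / ε)) ^ ε := by
            rw [← Real.rpow_mul (by linarith), one_div, inv_mul_cancel₀ hε.ne', Real.rpow_one]
        _ ≤ _ := Real.rpow_le_rpow (by positivity) h1 hε.le
  calc A ^ n.primeFactors.card = ∏ p ∈ n.primeFactors, A := by simp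
    _ ≤ ∏ p ∈ n.primeFactors, ((if p < P then A else 1) * (p : ℝ) ^ ε) :=
        Finset.prod_le_prod (fun _ _ => by linarith) hle
    _ = (∏ p ∈ n.primeFactors, (if p < P then A else 1)) * (∏ p ∈ n.primeFactors, (p : ℝ)) ^ ε := by
        rw [Finset.prod_mul_distrib, ← Real.finsetProd_rpow _ _ (fun i _ => by positivity)]
    _ ≤ A ^ P * (n : ℝ) ^ ε := by
        gcongr
        · rw [Finset.prod_ite, Finset.prod_const, Finset.prod_const_one, mul_one]
          apply pow_le_pow_right₀ hA
          calc _ ≤ (range P).card := by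
                apply Finset.card_le_card
                intro p hp
                simp only [Finset.mem_filter] at hp
                exact Finset.mem_range.2 hp.2
            _ = P := by simp
        · have := Nat.le_of_dvd (Nat.pos_of_ne_zero hn) (Nat.prod_primeFactors_dvd n)
          rw [← Nat.cast_prod]
          exact Nat.cast_le.2 this

lemma alt_of_log {D : ℂ → ℂ} {a : ℕ → ℂ} (ha : 0 ≤ a)
    (hs : ∀ s : ℂ, 1 < s.re → LSeriesSummable a s)
    (hD : ∀ s : ℂ, 1 < s.re → HasDerivAt D (-(LSeries a s) * D s) s) (h2 : 0 ≤ D 2) (k : ℕ) :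
    0 ≤ (-1) ^ k * iteratedDeriv k D 2 := by
  have hab : LSeries.abscissaOfAbsConv a < ((2 : ℝ) : EReal) := by
    refine lt_of_le_of_lt (LSeries.abscissaOfAbsConv_le_of_forall_lt_LSeriesSummable (x := 1) ?_) ?_
    · intro y hy; exact hs _ (by simpa using hy)
    · exact_mod_cast one_lt_two
  have hopen : IsOpen {s : ℂ | 1 < s.re} := isOpen_lt continuous_const continuous_re
  have hmem : {s : ℂ | 1 < s.re} ∈ 𝓝 (2 : ℂ) := hopen.mem_nhds (by simp)
  have hDdiff : DifferentiableOn ℂ D {s | 1 < s.re} := fun s hs =>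
    (hD s hs).differentiableAt.differentiableWithinAt
  have hDcont : ∀ k : ℕ, ContDiffAt ℂ k D 2 := fun k =>
    (hDdiff.analyticOnNhd hopen 2 (by simp)).contDiffAt
  have hAcont : ∀ k : ℕ, ContDiffAt ℂ k (LSeries a) 2 := fun k =>
    (LSeries_analyticOnNhd a 2 (by simpa using hab)).contDiffAt
  induction k using Nat.strong_induction_on with
  | _ k ih =>
  rcases k with _ | k
  · simpa using h2
  · rw [iteratedDeriv_succ']
    have hev : deriv D =ᶠ[𝓝 2] fun s => -(LSeries a s * D s) := by
      filter_upwards [hmem] with s hs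
      rw [(hD s hs).deriv]; ring
    rw [hev.iteratedDeriv_eq, iteratedDeriv_fun_neg, iteratedDeriv_fun_mul (hAcont k) (hDcont k)]
    rw [pow_succ, mul_assoc, neg_one_mul, neg_neg, Finset.mul_sum]
    refine Finset.sum_nonneg fun i hi => ?_
    have hi' : i ≤ k := by simpa [Nat.lt_succ_iff] using hi
    have e : (-1 : ℂ) ^ k = (-1) ^ i * (-1) ^ (k - i) := by rw [← pow_add]; congr 1; omega
    rw [e]
    have h1 := LSeries.iteratedDeriv_alternating ha hab i
    have h3 := ih (k - i) (by omega)
    have h4 : (0 : ℂ) ≤ (k.choose i : ℂ) := by exact_mod_cast Nat.zero_le _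
    calc (0 : ℂ) ≤ (k.choose i : ℂ) * (((-1) ^ i * iteratedDeriv i (LSeries a) (2 : ℝ)) *
          ((-1) ^ (k - i) * iteratedDeriv (k - i) D 2)) := mul_nonneg h4 (mul_nonneg h1 h3)
      _ = _ := by push_cast; ring

/-- `D` has logarithmic derivative minus the Dirichlet series of `a`. -/
def IsLog (D : ℂ → ℂ) (a : ℕ → ℂ) : Prop :=
  (∀ s : ℂ, 1 < s.re → LSeriesSummable a s) ∧
    ∀ s : ℂ, 1 < s.re → HasDerivAt D (-(LSeries a s) * D s) s

lemma IsLog.mul {D E : ℂ → ℂ} {a b : ℕ → ℂ} (h : IsLog D a) (h' : IsLog E b) :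
    IsLog (fun s => D s * E s) (a + b) := by
  refine ⟨fun s hs => (h.1 s hs).add (h'.1 s hs), fun s hs => ?_⟩
  have := (h.2 s hs).mul (h'.2 s hs)
  rw [LSeries_add (h.1 s hs) (h'.1 s hs)]
  exact this.congr_deriv (by ring)

lemma isLog_L {q : ℕ} [NeZero q] (χ : DirichletCharacter ℂ q) :
    IsLog χ.LFunction (fun n => χ (n : ZMod q) * (ArithmeticFunction.vonMangoldt n : ℂ)) := by
  refine ⟨fun s hs => DirichletCharacter.LSeriesSummable_twist_vonMangoldt χ hs, fun s hs => ?_⟩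
  have h1 := DirichletCharacter.LSeries_twist_vonMangoldt_eq χ hs
  have h2 := DirichletCharacter.LSeries_ne_zero_of_one_lt_re χ hs
  have h3 : s ≠ 1 := by rintro rfl; simp at hs
  have h4 := (χ.differentiableAt_LFunction s (.inl h3)).hasDerivAt
  refine h4.congr_deriv ?_
  symm
  rw [χ.deriv_LFunction_eq_deriv_LSeries hs, χ.LFunction_eq_LSeries hs]
  change -(LSeries ((fun n : ℕ => χ (n : ZMod q)) * fun n => (ArithmeticFunction.vonMangoldt n : ℂ)) s) * _ = _
  rw [h1]
  field_simp

end PartP4c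

section PartP4d

open Filter Topology MeasureTheory Complex
open scoped ComplexOrder

/-- The entire function `(s - 1) ζ(s)`. -/
def zetaOne : ℂ → ℂ := DirichletCharacter.LFunctionTrivChar₁ 1

lemma zetaOne_diff : Differentiable ℂ zetaOne := DirichletCharacter.differentiable_LFunctionTrivChar₁ 1

lemma zetaOne_one : zetaOne 1 = 1 := by simp [zetaOne, DirichletCharacter.LFunctionTrivChar₁]

lemma zetaOne_ne {s : ℂ} (hs : s ≠ 1) :
    zetaOne s = (s - 1) * (1 : DirichletCharacter ℂ 1).LFunction s := by
  simp [zetaOne, DirichletCharacter.LFunctionTrivChar₁, Function.update_of_ne hs]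

lemma zetaOne_bound : ∃ C : ℝ, 1 ≤ C ∧ ∀ s : ℂ, ‖s - 2‖ = 5 / 4 → ‖zetaOne s‖ ≤ C := by
  obtain ⟨C, hC⟩ := (isCompact_sphere (2 : ℂ) (5 / 4)).exists_bound_of_continuousOn
    zetaOne_diff.continuous.continuousOn
  exact ⟨max C 1, le_max_right _ _, fun s hs => (hC s (by simpa [dist_eq_norm] using hs)).trans
    (le_max_left _ _)⟩

lemma zetaOne_pos : ∃ η : ℝ, 0 < η ∧ ∀ β : ℝ, 1 - η ≤ β → β ≤ 1 → 0 ≤ (zetaOne β).re := by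
  have hc : Continuous fun β : ℝ => (zetaOne β).re :=
    continuous_re.comp (zetaOne_diff.continuous.comp continuous_ofReal)
  have h1 : (zetaOne ((1 : ℝ) : ℂ)).re = 1 := by rw [ofReal_one, zetaOne_one, one_re]
  have hev := (hc.tendsto 1).eventually (lt_mem_nhds (show 0 < _ by rw [h1]; exact one_pos))
  obtain ⟨η, hη, h⟩ := Metric.eventually_nhds_iff.1 hev
  refine ⟨η / 2, by linarith, fun β h2 h3 => (h ?_).le⟩
  rw [Real.dist_eq, abs_lt]; constructor <;> linarith

lemma L_one_two : 0 ≤ (1 : DirichletCharacter ℂ 1).LFunction 2 ∧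
    1 / 4 ≤ ((1 : DirichletCharacter ℂ 1).LFunction 2).re := by
  have h := L_two (1 : DirichletCharacter ℂ 1)
  refine ⟨?_, h⟩
  rw [Complex.nonneg_iff]
  refine ⟨by linarith, ?_⟩
  rw [DirichletCharacter.LFunction_modOne_eq, riemannZeta_two, show ((Real.pi : ℂ) ^ 2 / 6) =
    ((Real.pi ^ 2 / 6 : ℝ) : ℂ) by push_cast; rfl, ofReal_im]

lemma L_two' {q : ℕ} [NeZero q] (χ : DirichletCharacter ℂ q) (hχ : χ ≠ 1) (h2 : χ ^ 2 = 1) :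
    ∃ r : ℝ, 1 / 4 ≤ r ∧ χ.LFunction 2 = r := by
  refine ⟨(χ.LFunction 2).re, L_two χ, ?_⟩
  have := L_real χ hχ h2 (σ := 2) (by norm_num)
  apply Complex.ext
  · simp
  · simpa using this

lemma L_one_two' : ∃ r : ℝ, 1 / 4 ≤ r ∧ (1 : DirichletCharacter ℂ 1).LFunction 2 = r := by
  refine ⟨_, L_one_two.2, ?_⟩
  apply Complex.ext
  · simp
  · simpa using (Complex.nonneg_iff.1 L_one_two.1).2.symm

lemma L_circle {q : ℕ} [NeZero q] (χ : DirichletCharacter ℂ q) (hχ : χ ≠ 1) (s : ℂ)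
    (hs : ‖s - 2‖ = 5 / 4) : ‖χ.LFunction s‖ ≤ 13 * (q : ℝ) ^ (1 / 2 : ℝ) := by
  have h1 : 3 / 4 ≤ s.re := by
    have := Complex.abs_re_le_norm (s - 2)
    rw [hs, abs_le] at this
    have h := this.1
    simp at h
    linarith
  have h2 : ‖s‖ ≤ 13 / 4 := by
    calc ‖s‖ = ‖(s - 2) + 2‖ := by ring_nf
      _ ≤ ‖s - 2‖ + ‖(2 : ℂ)‖ := norm_add_le _ _
      _ = 13 / 4 := by rw [hs]; norm_num
  refine (L_bound χ hχ (δ := 1 / 2) (by norm_num) (by norm_num) (by linarith)).trans ?_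
  have h3 : (q : ℝ) ^ (1 / 2 : ℝ) / (s.re + 1 / 2 - 1) ≤ (q : ℝ) ^ (1 / 2 : ℝ) * 4 := by
    rw [div_le_iff₀ (by linarith)]
    have : 0 ≤ (q : ℝ) ^ (1 / 2 : ℝ) := by positivity
    nlinarith
  calc _ ≤ (13 / 4 : ℝ) * ((q : ℝ) ^ (1 / 2 : ℝ) * 4) := by
        apply mul_le_mul h2 h3 _ (by norm_num)
        apply div_nonneg (by positivity); linarith
    _ = _ := by ring

lemma quad_val {q : ℕ} [NeZero q] (χ : DirichletCharacter ℂ q) (h2 : χ ^ 2 = 1) (n : ZMod q) :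
    0 ≤ 1 + χ n := by
  rcases MulChar.isQuadratic_iff_sq_eq_one.2 h2 n with h | h | h <;> rw [h] <;> norm_num

lemma siegel_two {C : ℝ} (hC : 1 ≤ C) (hC' : ∀ s : ℂ, ‖s - 2‖ = 5 / 4 → ‖zetaOne s‖ ≤ C)
    {q : ℕ} [NeZero q] (χ : DirichletCharacter ℂ q) (hχ : χ ≠ 1) (h2 : χ ^ 2 = 1)
    {β : ℝ} (hβ1 : 7 / 8 ≤ β) (hβ2 : β < 1) (hZ : 0 ≤ (zetaOne β).re)
    (hL : 0 ≤ (χ.LFunction β).re) :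
    (1 - β) * ((1 / 16) / 2) * Real.exp (-((1 - β) * (10 * Real.log (80 *
      (C * (13 * (q : ℝ) ^ (1 / 2 : ℝ))) / (1 / 16)) + 2))) ≤ (χ.LFunction 1).re := by
  have hq1 : (1 : ℝ) ≤ (q : ℝ) ^ (1 / 2 : ℝ) :=
    Real.one_le_rpow (by exact_mod_cast NeZero.one_le) (by norm_num)
  have hlog := (isLog_L (1 : DirichletCharacter ℂ 1)).mul (isLog_L χ)
  obtain ⟨r, hr, hr'⟩ := L_one_two'
  obtain ⟨r1, hr1, hr1'⟩ := L_two' χ hχ h2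
  have hD2 : (1 : DirichletCharacter ℂ 1).LFunction 2 * χ.LFunction 2 = ((r * r1 : ℝ) : ℂ) := by
    rw [hr', hr1']; push_cast; ring
  have key := estermann (H := fun s => zetaOne s * χ.LFunction s)
    (D := fun s => (1 : DirichletCharacter ℂ 1).LFunction s * χ.LFunction s)
    (c0 := 1 / 16) (M := C * (13 * (q : ℝ) ^ (1 / 2 : ℝ))) (β := β)
    (zetaOne_diff.mul (χ.differentiable_LFunction hχ))
    (fun s hs => (hlog.2 s hs).differentiableAt.differentiableWithinAt)
    (fun s hs => by
      rw [zetaOne_ne (by rintro rfl; simp at hs)]; ring)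
    (fun k => by
      refine (Complex.nonneg_iff.1 (alt_of_log ?_ hlog.1 hlog.2 ?_ k)).1
      · intro n
        have h1 := quad_val χ h2 n
        have h3 : (0 : ℂ) ≤ ((ArithmeticFunction.vonMangoldt n : ℝ) : ℂ) := by
          exact_mod_cast ArithmeticFunction.vonMangoldt_nonneg
        have e : (1 : DirichletCharacter ℂ 1) (n : ZMod 1) = 1 :=
          MulChar.one_apply (isUnit_of_subsingleton _)
        simp only [Pi.zero_apply, Pi.add_apply, e]
        rw [← add_mul]
        exact mul_nonneg h1 h3
      · rw [hD2]
        have : 0 ≤ r * r1 := by nlinarith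
        exact_mod_cast this)
    (by norm_num) (by norm_num)
    (by
      rw [hD2, ofReal_re]
      nlinarith)
    (by nlinarith)
    (fun s hs => by
      rw [norm_mul]
      exact mul_le_mul (hC' s hs) (L_circle χ hχ s hs) (norm_nonneg _) (by linarith))
    hβ1 hβ2 (by
      rw [mul_re, L_real χ hχ h2 (by linarith), mul_zero, sub_zero]
      exact mul_nonneg hZ hL)
  simp only [zetaOne_one, one_mul] at key
  exact key

lemma siegel_four {C : ℝ} (hC : 1 ≤ C) (hC' : ∀ s : ℂ, ‖s - 2‖ = 5 / 4 → ‖zetaOne s‖ ≤ C)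
    {q₁ q₂ q₃ : ℕ} [NeZero q₁] [NeZero q₂] [NeZero q₃] (χ₁ : DirichletCharacter ℂ q₁) (h₁ : χ₁ ≠ 1)
    (h₁' : χ₁ ^ 2 = 1) (χ₂ : DirichletCharacter ℂ q₂) (h₂ : χ₂ ≠ 1)
    (h₂' : χ₂ ^ 2 = 1) (χ₃ : DirichletCharacter ℂ q₃) (h₃ : χ₃ ≠ 1)
    (h₃' : χ₃ ^ 2 = 1) (hmul : ∀ n : ℕ, χ₃ n = χ₁ n * χ₂ n)
    {β : ℝ} (hβ1 : 7 / 8 ≤ β) (hβ2 : β < 1) (hL : χ₁.LFunction β = 0) :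
    (1 - β) * ((1 / 256) / 2) * Real.exp (-((1 - β) * (10 * Real.log (80 *
      (C * (13 * (q₁ : ℝ) ^ (1 / 2 : ℝ)) * (13 * (q₂ : ℝ) ^ (1 / 2 : ℝ)) *
        (13 * (q₃ : ℝ) ^ (1 / 2 : ℝ))) / (1 / 256)) + 2))) ≤
      (χ₁.LFunction 1).re * (χ₂.LFunction 1).re * (χ₃.LFunction 1).re := by
  have hq : ∀ q : ℕ, [NeZero q] → (1 : ℝ) ≤ 13 * (q : ℝ) ^ (1 / 2 : ℝ) := by
    intro q _
    have : (1 : ℝ) ≤ (q : ℝ) ^ (1 / 2 : ℝ) :=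
      Real.one_le_rpow (by exact_mod_cast NeZero.one_le) (by norm_num)
    linarith
  have hlog := (((isLog_L (1 : DirichletCharacter ℂ 1)).mul (isLog_L χ₁)).mul (isLog_L χ₂)).mul
    (isLog_L χ₃)
  obtain ⟨r, hr, hr'⟩ := L_one_two'
  obtain ⟨r1, hr1, hr1'⟩ := L_two' χ₁ h₁ h₁'
  obtain ⟨r2, hr2, hr2'⟩ := L_two' χ₂ h₂ h₂'
  obtain ⟨r3, hr3, hr3'⟩ := L_two' χ₃ h₃ h₃'
  have hD2 : (1 : DirichletCharacter ℂ 1).LFunction 2 * χ₁.LFunction 2 * χ₂.LFunction 2 *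
      χ₃.LFunction 2 = ((r * r1 * r2 * r3 : ℝ) : ℂ) := by
    rw [hr', hr1', hr2', hr3']; push_cast; ring
  have hrr : 1 / 256 ≤ r * r1 * r2 * r3 := by
    calc (1 / 256 : ℝ) = 1 / 4 * (1 / 4) * (1 / 4) * (1 / 4) := by norm_num
      _ ≤ _ := by gcongr
  have key := estermann (H := fun s => zetaOne s * χ₁.LFunction s * χ₂.LFunction s * χ₃.LFunction s)
    (D := fun s => (1 : DirichletCharacter ℂ 1).LFunction s * χ₁.LFunction s * χ₂.LFunction s *
      χ₃.LFunction s)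
    (c0 := 1 / 256) (M := C * (13 * (q₁ : ℝ) ^ (1 / 2 : ℝ)) * (13 * (q₂ : ℝ) ^ (1 / 2 : ℝ)) *
        (13 * (q₃ : ℝ) ^ (1 / 2 : ℝ))) (β := β)
    (((zetaOne_diff.mul (χ₁.differentiable_LFunction h₁)).mul
      (χ₂.differentiable_LFunction h₂)).mul (χ₃.differentiable_LFunction h₃))
    (fun s hs => (hlog.2 s hs).differentiableAt.differentiableWithinAt)
    (fun s hs => by
      rw [zetaOne_ne (by rintro rfl; simp at hs)]; ring)
    (fun k => by
      refine (Complex.nonneg_iff.1 (alt_of_log ?_ hlog.1 hlog.2 ?_ k)).1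
      · intro n
        have h3 : (0 : ℂ) ≤ ((ArithmeticFunction.vonMangoldt n : ℝ) : ℂ) := by
          exact_mod_cast ArithmeticFunction.vonMangoldt_nonneg
        have e : (1 : DirichletCharacter ℂ 1) (n : ZMod 1) = 1 :=
          MulChar.one_apply (isUnit_of_subsingleton _)
        have h4 := mul_nonneg (mul_nonneg (quad_val χ₁ h₁' n) (quad_val χ₂ h₂' n)) h3
        simp only [Pi.zero_apply, Pi.add_apply, e, hmul]
        calc (0 : ℂ) ≤ _ := h4
          _ = _ := by ring
      · rw [hD2]
        have : 0 ≤ r * r1 * r2 * r3 := by linarith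
        exact_mod_cast this)
    (by norm_num) (by norm_num)
    (by
      rw [hD2, ofReal_re]
      exact hrr)
    (by
      calc (1 : ℝ) = 1 * 1 * 1 * 1 := by norm_num
        _ ≤ _ := by
          gcongr
          exacts [hq q₁, hq q₂, hq q₃])
    (fun s hs => by
      rw [norm_mul, norm_mul, norm_mul]
      have a1 := L_circle χ₁ h₁ s hs
      have a2 := L_circle χ₂ h₂ s hs
      have a3 := L_circle χ₃ h₃ s hs
      have a0 := hC' s hs
      gcongr)
    hβ1 hβ2 (by
      rw [hL]; simp)
  simp only [zetaOne_one, one_mul] at key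
  have i1 := L_real χ₁ h₁ h₁' (σ := 1) one_pos
  have i2 := L_real χ₂ h₂ h₂' (σ := 1) one_pos
  have i3 := L_real χ₃ h₃ h₃' (σ := 1) one_pos
  simp only [ofReal_one] at i1 i2 i3
  rw [mul_re, mul_re, i3, i2, mul_zero, mul_zero, sub_zero, sub_zero] at key
  exact key

end PartP4d

section PartP4e

open Filter Topology MeasureTheory Complex
open scoped ComplexOrder

lemma exp_split {t B y : ℝ} (hB : 0 < B) (hy : 0 < y) :
    Real.exp (-(t * (10 * Real.log (B * y) + 2))) =
      Real.exp (-(t * (10 * Real.log B + 2))) * y ^ (-(10 * t)) := by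
  rw [Real.log_mul hB.ne' hy.ne', Real.rpow_def_of_pos hy, ← Real.exp_add]
  congr 1; ring

lemma changeLevel_mul_apply {q₁ q₂ : ℕ} [NeZero q₁] [NeZero q₂] (χ₁ : DirichletCharacter ℂ q₁)
    (χ₂ : DirichletCharacter ℂ q₂) (n : ℕ) :
    (DirichletCharacter.changeLevel (dvd_mul_right q₁ q₂) χ₁ *
      DirichletCharacter.changeLevel (dvd_mul_left q₂ q₁) χ₂) (n : ZMod (q₁ * q₂)) =
      χ₁ n * χ₂ n := by
  rw [MulChar.mul_apply]
  by_cases h : n.Coprime (q₁ * q₂)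
  · have hu : IsUnit (n : ZMod (q₁ * q₂)) := (ZMod.isUnit_iff_coprime n _).2 h
    have e1 := DirichletCharacter.changeLevel_eq_cast_of_dvd χ₁ (dvd_mul_right q₁ q₂) hu.unit
    have e2 := DirichletCharacter.changeLevel_eq_cast_of_dvd χ₂ (dvd_mul_left q₂ q₁) hu.unit
    simp only [IsUnit.unit_spec] at e1 e2
    rw [e1, e2, ZMod.cast_natCast (dvd_mul_right q₁ q₂), ZMod.cast_natCast (dvd_mul_left q₂ q₁)]
  · have hu : ¬ IsUnit (n : ZMod (q₁ * q₂)) := fun h' => h ((ZMod.isUnit_iff_coprime n _).1 h')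
    rw [MulChar.map_nonunit _ hu, zero_mul]
    rw [Nat.coprime_mul_iff_right, not_and_or] at h
    rcases h with h | h
    · rw [MulChar.map_nonunit χ₁ (fun h' => h ((ZMod.isUnit_iff_coprime n _).1 h')), zero_mul]
    · rw [MulChar.map_nonunit χ₂ (fun h' => h ((ZMod.isUnit_iff_coprime n _).1 h')), mul_zero]

lemma euler_factor {q : ℕ} (χ : DirichletCharacter ℂ q) (Q : ℕ) :
    (1 / 2 : ℝ) ^ Q.primeFactors.card ≤ ‖∏ p ∈ Q.primeFactors, (1 - χ p * (p : ℂ) ^ (-(1 : ℂ)))‖ ∧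
    ‖∏ p ∈ Q.primeFactors, (1 - χ p * (p : ℂ) ^ (-(1 : ℂ)))‖ ≤ (3 / 2 : ℝ) ^ Q.primeFactors.card := by
  have hb : ∀ p ∈ Q.primeFactors, ‖χ p * (p : ℂ) ^ (-(1 : ℂ))‖ ≤ 1 / 2 := by
    intro p hp
    have h2 : (2 : ℝ) ≤ p := by exact_mod_cast (Nat.prime_of_mem_primeFactors hp).two_le
    rw [norm_mul, cpow_neg_one, norm_inv, Complex.norm_natCast]
    calc ‖χ p‖ * (p : ℝ)⁻¹ ≤ 1 * (2 : ℝ)⁻¹ := by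
          gcongr
          exact χ.norm_le_one _
      _ = 1 / 2 := by norm_num
  rw [norm_prod]
  constructor
  · rw [← Finset.prod_const]
    refine Finset.prod_le_prod (fun _ _ => by norm_num) fun p hp => ?_
    have := norm_sub_norm_le (1 : ℂ) (χ p * (p : ℂ) ^ (-(1 : ℂ)))
    rw [norm_one] at this
    linarith [hb p hp]
  · rw [← Finset.prod_const]
    refine Finset.prod_le_prod (fun _ _ => norm_nonneg _) fun p hp => ?_
    have := norm_sub_le (1 : ℂ) (χ p * (p : ℂ) ^ (-(1 : ℂ)))
    rw [norm_one] at this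
    linarith [hb p hp]

lemma L_norm_one {q : ℕ} [NeZero q] (χ : DirichletCharacter ℂ q) (hχ : χ ≠ 1) (h2 : χ ^ 2 = 1) :
    0 < (χ.LFunction 1).re ∧ ‖χ.LFunction 1‖ = (χ.LFunction 1).re := by
  have h1 := L_pos χ hχ h2 (β := 1) one_pos (by norm_num) (fun σ h1 h2 => by linarith)
  have h3 := L_real χ hχ h2 (σ := 1) one_pos
  rw [ofReal_one] at h1 h3
  refine ⟨h1, ?_⟩
  rw [← Complex.abs_re_eq_norm.2 h3, abs_of_pos h1]

lemma siegel_triv {q₁ : ℕ} [NeZero q₁] (χ₁ : DirichletCharacter ℂ q₁) (h₁ : χ₁ ≠ 1)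
    (h₁' : χ₁ ^ 2 = 1) {ε : ℝ} (hε : 0 < ε) : ∃ c : ℝ, 0 < c ∧ ∀ (q₂ : ℕ) [NeZero q₂]
    (χ₂ : DirichletCharacter ℂ q₂), χ₂ ^ 2 = 1 → χ₂ ≠ 1 →
      DirichletCharacter.changeLevel (dvd_mul_right q₁ q₂) χ₁ *
      DirichletCharacter.changeLevel (dvd_mul_left q₂ q₁) χ₂ = 1 →
      c * (q₂ : ℝ) ^ (-ε) ≤ (χ₂.LFunction 1).re := by
  obtain ⟨C, hC, hom⟩ := omega_bound 3 (by norm_num) ε hε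
  have hq1 : (0 : ℝ) < q₁ := by exact_mod_cast NeZero.pos q₁
  have hL1 := L_norm_one χ₁ h₁ h₁'
  refine ⟨(χ₁.LFunction 1).re / (C * (q₁ : ℝ) ^ ε), div_pos hL1.1 (by positivity), ?_⟩
  intro q₂ _ χ₂ h₂' h₂ htriv
  have hq2 : (0 : ℝ) < q₂ := by exact_mod_cast NeZero.pos q₂
  have hL2 := L_norm_one χ₂ h₂ h₂'
  have heq : DirichletCharacter.changeLevel (dvd_mul_right q₁ q₂) χ₁ =
      DirichletCharacter.changeLevel (dvd_mul_left q₂ q₁) χ₂ := by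
    have hsq : DirichletCharacter.changeLevel (dvd_mul_left q₂ q₁) χ₂ *
        DirichletCharacter.changeLevel (dvd_mul_left q₂ q₁) χ₂ = 1 := by
      rw [← map_mul, ← pow_two, h₂', map_one]
    exact mul_right_cancel (htriv.trans hsq.symm)
  have e1 := DirichletCharacter.LFunction_changeLevel (dvd_mul_right q₁ q₂) χ₁ (s := 1) (.inl h₁)
  have e2 := DirichletCharacter.LFunction_changeLevel (dvd_mul_left q₂ q₁) χ₂ (s := 1) (.inl h₂)
  rw [heq, e2] at e1
  have e3 := congrArg norm e1
  rw [norm_mul, norm_mul, hL1.2, hL2.2] at e3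
  have f1 := (euler_factor χ₁ (q₁ * q₂)).1
  have f2 := (euler_factor χ₂ (q₁ * q₂)).2
  have hQ := hom (q₁ * q₂) (NeZero.ne _)
  set w := (q₁ * q₂).primeFactors.card
  set l1 := (χ₁.LFunction 1).re
  set l2 := (χ₂.LFunction 1).re
  have g1 : l1 * (1 / 2) ^ w ≤ l2 * (3 / 2) ^ w :=
    calc _ ≤ _ := mul_le_mul_of_nonneg_left f1 hL1.1.le
      _ = _ := e3.symm
      _ ≤ _ := mul_le_mul_of_nonneg_left f2 hL2.1.le
  have g2 : l1 ≤ l2 * 3 ^ w := by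
    have h3 : (3 / 2 : ℝ) ^ w = (1 / 2) ^ w * 3 ^ w := by rw [← mul_pow]; norm_num
    rw [h3] at g1
    have h4 : (0 : ℝ) < (1 / 2) ^ w := by positivity
    nlinarith
  rw [Nat.cast_mul, Real.mul_rpow hq1.le hq2.le] at hQ
  rw [Real.rpow_neg hq2.le, ← div_eq_mul_inv, div_div, div_le_iff₀ (by positivity)]
  calc l1 ≤ l2 * 3 ^ w := g2
    _ ≤ l2 * (C * ((q₁ : ℝ) ^ ε * (q₂ : ℝ) ^ ε)) := mul_le_mul_of_nonneg_left hQ hL2.1.le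
    _ = _ := by ring

theorem siegel {ε : ℝ} (hε : 0 < ε) (hε1 : ε ≤ 1) : ∃ c : ℝ, 0 < c ∧ ∀ (q : ℕ) [NeZero q]
    (χ : DirichletCharacter ℂ q), χ ^ 2 = 1 → χ ≠ 1 → c * (q : ℝ) ^ (-ε) ≤ (χ.LFunction 1).re := by
  obtain ⟨C, hC, hC'⟩ := zetaOne_bound
  obtain ⟨η, hη, hη'⟩ := zetaOne_pos
  set t0 := min η (ε / 20) with ht0
  have ht0p : 0 < t0 := lt_min hη (by linarith)
  have ht1 : t0 ≤ η := min_le_left _ _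
  have ht2 : t0 ≤ ε / 20 := min_le_right _ _
  by_cases hex : ∃ (q : ℕ) (_ : NeZero q) (χ : DirichletCharacter ℂ q) (β : ℝ), χ ^ 2 = 1 ∧ χ ≠ 1 ∧
    1 - t0 ≤ β ∧ β < 1 ∧ χ.LFunction β = 0
  · obtain ⟨q₁, _, χ₁, β, h₁', h₁, hβ1, hβ2, hz⟩ := hex
    obtain ⟨c1, hc1, hc1'⟩ := siegel_triv χ₁ h₁ h₁' hε
    have hL1 := L_norm_one χ₁ h₁ h₁'
    have hq1 : (0 : ℝ) < q₁ := by exact_mod_cast NeZero.pos q₁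
    set l1 := (χ₁.LFunction 1).re with hl1
    set t := 1 - β with ht
    have htp : 0 < t := by linarith
    set B := 80 * (C * 13 * 13 * 13 * q₁) * 256 with hB
    have hBp : 0 < B := by positivity
    set δ := ε / 2 with hδ
    have hδp : 0 < δ := by linarith
    set K := t * ((1 / 256) / 2) * Real.exp (-(t * (10 * Real.log B + 2))) with hK
    have hKp : 0 < K := by positivity
    set c2 := K * δ / (l1 * (q₁ : ℝ) ^ δ) with hc2
    have hc2p : 0 < c2 := div_pos (by positivity) (mul_pos hL1.1 (by positivity))
    refine ⟨min c1 c2, lt_min hc1 hc2p, ?_⟩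
    intro q₂ _ χ₂ h₂' h₂
    have hq2 : (0 : ℝ) < q₂ := by exact_mod_cast NeZero.pos q₂
    have hq21 : (1 : ℝ) ≤ q₂ := by exact_mod_cast NeZero.one_le
    have hL2 := L_norm_one χ₂ h₂ h₂'
    set χ₃ := DirichletCharacter.changeLevel (dvd_mul_right q₁ q₂) χ₁ *
      DirichletCharacter.changeLevel (dvd_mul_left q₂ q₁) χ₂ with hχ₃
    by_cases htriv : χ₃ = 1
    · refine le_trans ?_ (hc1' q₂ χ₂ h₂' h₂ htriv)
      gcongr
      exact min_le_left _ _
    · have h₃' : χ₃ ^ 2 = 1 := by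
        rw [hχ₃, mul_pow, ← map_pow, ← map_pow, h₁', h₂', map_one, map_one, one_mul]
      have hL3 := L_norm_one χ₃ htriv h₃'
      have hb3 := L_bound χ₃ htriv (δ := δ) hδp (by linarith) (s := 1) (by simp; linarith)
      rw [hL3.2] at hb3
      simp only [norm_one, one_mul, one_re, add_sub_cancel_left] at hb3
      have key := siegel_four hC hC' χ₁ h₁ h₁' χ₂ h₂ h₂' χ₃ htriv h₃' (changeLevel_mul_apply χ₁ χ₂)
        (β := β) (by linarith) hβ2 hz
      have earg : 80 * (C * (13 * (q₁ : ℝ) ^ (1 / 2 : ℝ)) * (13 * (q₂ : ℝ) ^ (1 / 2 : ℝ)) *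
        (13 * ((q₁ * q₂ : ℕ) : ℝ) ^ (1 / 2 : ℝ))) / (1 / 256) = B * q₂ := by
        rw [Nat.cast_mul, Real.mul_rpow hq1.le hq2.le, ← Real.sqrt_eq_rpow, ← Real.sqrt_eq_rpow, hB]
        have a1 := Real.mul_self_sqrt hq1.le
        have a2 := Real.mul_self_sqrt hq2.le
        calc _ = 80 * (C * 13 * 13 * 13 * (√(q₁ : ℝ) * √(q₁ : ℝ))) * 256 * (√(q₂ : ℝ) * √(q₂ : ℝ)) := by ring
          _ = _ := by rw [a1, a2]
      rw [earg, exp_split hBp hq2, ← mul_assoc] at key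
      change K * _ ≤ l1 * _ * _ at key
      set l2 := (χ₂.LFunction 1).re
      set l3 := (χ₃.LFunction 1).re
      rw [Nat.cast_mul, Real.mul_rpow hq1.le hq2.le] at hb3
      have k1 : (q₂ : ℝ) ^ (-δ) ≤ (q₂ : ℝ) ^ (-(10 * t)) := by
        apply Real.rpow_le_rpow_of_exponent_le hq21
        linarith
      have k2 : K * (q₂ : ℝ) ^ (-δ) ≤ l1 * l2 * ((q₁ : ℝ) ^ δ * (q₂ : ℝ) ^ δ / δ) :=
        calc _ ≤ K * (q₂ : ℝ) ^ (-(10 * t)) := mul_le_mul_of_nonneg_left k1 hKp.le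
          _ ≤ _ := key
          _ ≤ _ := mul_le_mul_of_nonneg_left hb3 (mul_nonneg hL1.1.le hL2.1.le)
      have k3 : c2 * (q₂ : ℝ) ^ (-ε) ≤ l2 := by
        have e1 : (q₂ : ℝ) ^ (-ε) = (q₂ : ℝ) ^ (-δ) * ((q₂ : ℝ) ^ δ)⁻¹ := by
          rw [← Real.rpow_neg hq2.le, ← Real.rpow_add hq2]; congr 1; rw [hδ]; ring
        have p1 : 0 < (q₁ : ℝ) ^ δ := by positivity
        have p2 : 0 < (q₂ : ℝ) ^ δ := by positivity
        have p3 : 0 < l1 := hL1.1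
        rw [hc2, e1]
        calc K * δ / (l1 * (q₁ : ℝ) ^ δ) * ((q₂ : ℝ) ^ (-δ) * ((q₂ : ℝ) ^ δ)⁻¹)
            = (K * (q₂ : ℝ) ^ (-δ)) * (δ / (l1 * (q₁ : ℝ) ^ δ * (q₂ : ℝ) ^ δ)) := by
              field_simp
          _ ≤ (l1 * l2 * ((q₁ : ℝ) ^ δ * (q₂ : ℝ) ^ δ / δ)) * (δ / (l1 * (q₁ : ℝ) ^ δ * (q₂ : ℝ) ^ δ)) :=
              mul_le_mul_of_nonneg_right k2 (by positivity)
          _ = l2 := by field_simp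
      refine le_trans ?_ k3
      gcongr
      exact min_le_right _ _
  · push Not at hex
    set B := 80 * (C * 13) * 16 with hB
    have hBp : 0 < B := by positivity
    refine ⟨t0 * ((1 / 16) / 2) * Real.exp (-(t0 * (10 * Real.log B + 2))), by positivity, ?_⟩
    intro q _ χ h2 hχ
    have hq : (0 : ℝ) < q := by exact_mod_cast NeZero.pos q
    have hq1 : (1 : ℝ) ≤ q := by exact_mod_cast NeZero.one_le
    have hpos := L_pos χ hχ h2 (β := 1 - t0) (by linarith) (by linarith)
      (fun σ a b => hex q ‹_› χ σ h2 hχ a b)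
    have key := siegel_two hC hC' χ hχ h2 (β := 1 - t0) (by linarith) (by linarith)
      (hη' _ (by linarith) (by linarith)) hpos.le
    have earg : 80 * (C * (13 * (q : ℝ) ^ (1 / 2 : ℝ))) / (1 / 16) = B * (q : ℝ) ^ (1 / 2 : ℝ) := by
      rw [hB]; ring
    rw [earg, sub_sub_cancel, exp_split hBp (by positivity), ← mul_assoc] at key
    refine le_trans ?_ key
    refine mul_le_mul_of_nonneg_left ?_ (by positivity)
    rw [← Real.rpow_mul hq.le]
    apply Real.rpow_le_rpow_of_exponent_le hq1
    linarith

end PartP4e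

section PartP5a

/-- The quadratic character `n ↦ (-m / n)`, extended by zero. -/
def psi (m n : ℕ) : ℤ := if n.Coprime (4 * m) then jacobiSym (-m) n else 0

lemma coprime_odd {m n : ℕ} (h : n.Coprime (4 * m)) : Odd n := by
  have : n.Coprime 2 := Nat.Coprime.coprime_dvd_right ⟨2 * m, by ring⟩ h
  exact Nat.coprime_two_right.1 this

lemma coprime_ne {m n : ℕ} (h : n.Coprime (4 * m)) : n ≠ 0 := by
  have := coprime_odd h
  rintro rfl; simp at this

lemma psi_mul (m a b : ℕ) : psi m (a * b) = psi m a * psi m b := by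
  unfold psi
  by_cases ha : a.Coprime (4 * m)
  · by_cases hb : b.Coprime (4 * m)
    · have : NeZero a := ⟨coprime_ne ha⟩
      have : NeZero b := ⟨coprime_ne hb⟩
      rw [if_pos ha, if_pos hb, if_pos (Nat.Coprime.mul_left ha hb), jacobiSym.mul_right]
    · rw [if_neg hb, if_neg (fun h => hb (Nat.Coprime.coprime_dvd_left (dvd_mul_left b a) h)), mul_zero]
  · rw [if_neg ha, if_neg (fun h => ha (Nat.Coprime.coprime_dvd_left (dvd_mul_right a b) h)), zero_mul]

lemma psi_one (m : ℕ) : psi m 1 = 1 := by simp [psi]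

lemma psi_mod (m n : ℕ) : psi m (n % (4 * m)) = psi m n := by
  unfold psi
  have e : (n % (4 * m)).Coprime (4 * m) ↔ n.Coprime (4 * m) := by
    simp [Nat.coprime_iff_gcd_eq_one]
  by_cases h : n.Coprime (4 * m)
  · rw [if_pos h, if_pos (e.2 h), jacobiSym.mod_right (-(m : ℤ)) (coprime_odd h)]
    simp
  · rw [if_neg h, if_neg (fun h' => h (e.1 h'))]

lemma psi_sq {m n : ℕ} (h : n.Coprime (4 * m)) : psi m n ^ 2 = 1 := by
  rw [psi, if_pos h]
  apply jacobiSym.sq_one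
  have := Nat.Coprime.coprime_dvd_right (dvd_mul_left m 4) h
  simpa [Int.gcd, Nat.coprime_iff_gcd_eq_one, Nat.gcd_comm] using this

lemma psi_zero {m n : ℕ} (h : ¬ n.Coprime (4 * m)) : psi m n = 0 := by rw [psi, if_neg h]

/-- The Dirichlet character attached to `psi`. -/
def chi (m : ℕ) [NeZero m] : DirichletCharacter ℂ (4 * m) where
  toFun a := (psi m a.val : ℂ)
  map_one' := by
    have : Fact (1 < 4 * m) := ⟨by have := NeZero.pos m; omega⟩
    rw [ZMod.val_one, psi_one, Int.cast_one]
  map_mul' a b := by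
    rw [ZMod.val_mul, psi_mod, psi_mul, Int.cast_mul]
  map_nonunit' a ha := by
    rw [psi_zero, Int.cast_zero]
    intro h
    apply ha
    rw [← ZMod.natCast_zmod_val a]
    exact (ZMod.isUnit_iff_coprime _ _).2 h

lemma chi_apply (m : ℕ) [NeZero m] (n : ℕ) : chi m (n : ZMod (4 * m)) = (psi m n : ℂ) := by
  change (psi m (n : ZMod (4 * m)).val : ℂ) = _
  rw [ZMod.val_natCast, psi_mod]

lemma chi_sq (m : ℕ) [NeZero m] : chi m ^ 2 = 1 := by
  ext a
  rw [MulChar.pow_apply_coe, MulChar.one_apply_coe, ← ZMod.natCast_zmod_val (a : ZMod (4 * m)), chi_apply]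
  exact_mod_cast psi_sq (ZMod.val_coe_unit_coprime a)

lemma chi_ne (m : ℕ) [NeZero m] : chi m ≠ 1 := by
  intro h
  have hm := NeZero.pos m
  obtain ⟨k, hk⟩ : ∃ k, 4 * m = k + 1 := ⟨4 * m - 1, by omega⟩
  have hc : k.Coprime (4 * m) := by rw [hk]; simp
  have h1 := chi_apply m k
  rw [h, MulChar.one_apply ((ZMod.isUnit_iff_coprime _ _).2 hc), psi, if_pos hc] at h1
  have h2 : jacobiSym (-m) k = 1 := by exact_mod_cast h1.symm
  have h3 : jacobiSym (-m) k = -1 := by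
    have hodd := coprime_odd hc
    have e : jacobiSym (4 * m : ℤ) k = 1 := by
      have : (4 * m : ℤ) = k + 1 := by exact_mod_cast hk
      rw [this, jacobiSym.mod_left]
      rw [show ((k : ℤ) + 1) % k = 1 % k by simp, ← jacobiSym.mod_left, jacobiSym.one_left]
    have e2 : jacobiSym (4 : ℤ) k = 1 := by
      rw [show (4 : ℤ) = 2 ^ 2 by norm_num]
      apply jacobiSym.sq_one'
      have := Nat.coprime_two_right.2 hodd
      simpa [Int.gcd, Nat.coprime_iff_gcd_eq_one, Nat.gcd_comm] using this
    rw [jacobiSym.mul_left, e2, one_mul] at e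
    rw [neg_eq_neg_one_mul, jacobiSym.mul_left, e, mul_one, jacobiSym.at_neg_one hodd,
      ZMod.χ₄_nat_three_mod_four (by omega)]
  rw [h2] at h3
  norm_num at h3

/-- Number of square roots of `-m` modulo `n`. -/
def rho (m n : ℕ) : ℕ := Nat.card {t : ZMod n // t ^ 2 + (m : ZMod n) = 0}

lemma rho_mul (m : ℕ) {a b : ℕ} (ha : a ≠ 0) (hb : b ≠ 0) (h : a.Coprime b) :
    rho m a * rho m b ≤ rho m (a * b) := by
  have : NeZero a := ⟨ha⟩
  have : NeZero b := ⟨hb⟩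
  unfold rho
  rw [← Nat.card_prod]
  let e := ZMod.chineseRemainder h
  refine Nat.card_le_card_of_injective (fun x => ⟨e.symm (x.1.1, x.2.1), ?_⟩) ?_
  · apply e.injective
    rw [map_add, map_pow, RingEquiv.apply_symm_apply, map_natCast, map_zero]
    ext
    · simpa using x.1.2
    · simpa using x.2.2
  · intro x y hxy
    have h1 := e.symm.injective (Subtype.ext_iff.1 hxy)
    simp only [Prod.mk.injEq] at h1
    exact Prod.ext (Subtype.ext h1.1) (Subtype.ext h1.2)

lemma hensel_root {m p : ℕ} (hp : p.Prime) (h2 : p ≠ 2) (hm : ¬ p ∣ m) {t : ℤ}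
    (ht : (p : ℤ) ∣ t ^ 2 + m) (k : ℕ) : ∃ t : ℤ, (p : ℤ) ^ (k + 1) ∣ t ^ 2 + m := by
  induction k with
  | zero => exact ⟨t, by simpa using ht⟩
  | succ k ih =>
    obtain ⟨t, c, hc⟩ := ih
    have hpp : Prime (p : ℤ) := Nat.prime_iff_prime_int.1 hp
    have hpt : ¬ (p : ℤ) ∣ 2 * t := by
      intro h
      rcases hpp.dvd_or_dvd h with h | h
      · have : p ∣ 2 := by exact_mod_cast h
        exact h2 ((Nat.prime_dvd_prime_iff_eq hp Nat.prime_two).1 this)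
      · apply hm
        have h3 : (p : ℤ) ∣ t ^ 2 + m := ⟨p ^ k * c, by rw [hc]; ring⟩
        have h4 := (Int.dvd_iff_dvd_of_dvd_add h3).1 (dvd_pow h two_ne_zero)
        exact_mod_cast h4
    obtain ⟨a, b, hab⟩ := (hpp.coprime_iff_not_dvd.2 hpt)
    refine ⟨t + p ^ (k + 1) * (-c * b), c * a + p ^ k * (c * b) ^ 2, ?_⟩
    linear_combination hc - (p : ℤ) ^ (k + 1) * c * hab

lemma rho_prime_pow {m p : ℕ} (hp : p.Prime) (hc : p.Coprime (4 * m)) (h1 : psi m p = 1) (k : ℕ) :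
    2 ≤ rho m (p ^ (k + 1)) := by
  have := Fact.mk hp
  have h2 : p ≠ 2 := by rintro rfl; exact absurd (coprime_odd hc) (by decide)
  have hm : ¬ p ∣ m := by
    intro h
    have := Nat.Coprime.coprime_dvd_right (dvd_mul_left m 4) hc
    exact ((Nat.Prime.coprime_iff_not_dvd hp).1 this) h
  rw [psi, if_pos hc, ← jacobiSym.legendreSym.to_jacobiSym] at h1
  have hne : ((-(m : ℤ) : ℤ) : ZMod p) ≠ 0 := by
    push_cast
    rw [neg_ne_zero, Ne, ZMod.natCast_eq_zero_iff]
    exact hm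
  obtain ⟨r, hr⟩ := (legendreSym.eq_one_iff p hne).1 h1
  have ht : (p : ℤ) ∣ ((r.val : ℤ)) ^ 2 + m := by
    rw [← ZMod.intCast_zmod_eq_zero_iff_dvd]
    push_cast at hr ⊢
    rw [ZMod.natCast_zmod_val]
    linear_combination -hr
  obtain ⟨t, ht⟩ := hensel_root hp h2 hm ht k
  have hpk : NeZero (p ^ (k + 1)) := ⟨pow_ne_zero _ hp.ne_zero⟩
  have hroot : ((t : ZMod (p ^ (k + 1)))) ^ 2 + (m : ZMod (p ^ (k + 1))) = 0 := by
    have := (ZMod.intCast_zmod_eq_zero_iff_dvd (t ^ 2 + m) (p ^ (k + 1))).2 (by exact_mod_cast ht)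
    push_cast at this
    exact this
  have hneq : (t : ZMod (p ^ (k + 1))) ≠ -(t : ZMod (p ^ (k + 1))) := by
    intro h
    have h3 : ((2 * t : ℤ) : ZMod (p ^ (k + 1))) = 0 := by
      push_cast
      linear_combination h
    rw [ZMod.intCast_zmod_eq_zero_iff_dvd] at h3
    have hpd : (p : ℤ) ∣ ((p ^ (k + 1) : ℕ) : ℤ) := by
      push_cast
      exact dvd_pow_self _ (by omega)
    have h4 : (p : ℤ) ∣ 2 * t := hpd.trans h3
    have hpp : Prime (p : ℤ) := Nat.prime_iff_prime_int.1 hp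
    rcases hpp.dvd_or_dvd h4 with h | h
    · have : p ∣ 2 := by exact_mod_cast h
      exact h2 ((Nat.prime_dvd_prime_iff_eq hp Nat.prime_two).1 this)
    · apply hm
      have h5 : (p : ℤ) ∣ t ^ 2 + m := (by push_cast at hpd; exact hpd.trans ht)
      have h6 := (Int.dvd_iff_dvd_of_dvd_add h5).1 (dvd_pow h two_ne_zero)
      exact_mod_cast h6
  unfold rho
  have : Finite {t : ZMod (p ^ (k + 1)) // t ^ 2 + (m : ZMod (p ^ (k + 1))) = 0} := inferInstance
  have hnt : Nontrivial {t : ZMod (p ^ (k + 1)) // t ^ 2 + (m : ZMod (p ^ (k + 1))) = 0} :=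
    ⟨⟨⟨t, hroot⟩, ⟨-t, by rw [neg_sq]; exact hroot⟩, fun h => hneq (Subtype.ext_iff.1 h)⟩⟩
  exact Finite.one_lt_card

end PartP5a

section PartP5b

/-- Indicator of being coprime to `4 m`. -/
def triv0 (m : ℕ) : ArithmeticFunction ℝ :=
  ⟨fun n => if n ≠ 0 ∧ n.Coprime (4 * m) then 1 else 0, by simp⟩

/-- `psi` restricted to squarefree integers. -/
def sqf (m : ℕ) : ArithmeticFunction ℝ :=
  ⟨fun n => if Squarefree n then (psi m n : ℝ) else 0, by simp⟩

lemma triv0_apply (m n : ℕ) : triv0 m n = if n.Coprime (4 * m) then 1 else 0 := by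
  change (if n ≠ 0 ∧ n.Coprime (4 * m) then (1 : ℝ) else 0) = _
  by_cases h : n.Coprime (4 * m)
  · rw [if_pos h, if_pos ⟨coprime_ne h, h⟩]
  · rw [if_neg h, if_neg (fun h' => h h'.2)]

lemma sqf_apply (m n : ℕ) : sqf m n = if Squarefree n then (psi m n : ℝ) else 0 := rfl

/-- The convolution of the two. -/
def gfun (m : ℕ) : ArithmeticFunction ℝ := triv0 m * sqf m

lemma triv0_mult (m : ℕ) : (triv0 m).IsMultiplicative := by
  refine ⟨by simp [triv0_apply], fun {a b} _ => ?_⟩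
  rw [triv0_apply, triv0_apply, triv0_apply]
  by_cases ha : a.Coprime (4 * m)
  · by_cases hb : b.Coprime (4 * m)
    · rw [if_pos ha, if_pos hb, if_pos (Nat.Coprime.mul_left ha hb), one_mul]
    · rw [if_neg hb, if_neg (fun h => hb (Nat.Coprime.coprime_dvd_left (dvd_mul_left b a) h)), mul_zero]
  · rw [if_neg ha, if_neg (fun h => ha (Nat.Coprime.coprime_dvd_left (dvd_mul_right a b) h)), zero_mul]

lemma sqf_mult (m : ℕ) : (sqf m).IsMultiplicative := by
  refine ⟨by simp [sqf_apply, psi_one], fun {a b} h => ?_⟩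
  rw [sqf_apply, sqf_apply, sqf_apply, psi_mul]
  simp only [Nat.squarefree_mul h]
  by_cases ha : Squarefree a <;> by_cases hb : Squarefree b <;> simp [ha, hb]

lemma gfun_mult (m : ℕ) : (gfun m).IsMultiplicative := (triv0_mult m).mul (sqf_mult m)

lemma gfun_prime_pow (m : ℕ) {p : ℕ} (hp : p.Prime) (k : ℕ) :
    gfun m (p ^ (k + 1)) = triv0 m (p ^ (k + 1)) + triv0 m (p ^ k) * psi m p := by
  rw [gfun, ArithmeticFunction.mul_apply, Nat.sum_divisorsAntidiagonal' (fun a b => triv0 m a * sqf m b),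
    Nat.sum_divisors_prime_pow hp, Finset.sum_range_succ', Finset.sum_range_succ']
  have h0 : ∑ i ∈ range k, triv0 m (p ^ (k + 1) / p ^ (i + 1 + 1)) * sqf m (p ^ (i + 1 + 1)) = 0 := by
    refine Finset.sum_eq_zero fun i _ => ?_
    rw [sqf_apply, if_neg, mul_zero]
    intro h
    have := h p ⟨p ^ i, by ring⟩
    exact hp.one_lt.ne' (Nat.isUnit_iff.1 this)
  rw [h0]
  have e1 : p ^ (k + 1) / p ^ (0 + 1) = p ^ k := by
    rw [zero_add, pow_one, pow_succ, Nat.mul_div_cancel _ hp.pos]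
  rw [e1, zero_add, zero_add, pow_one, pow_zero, Nat.div_one, sqf_apply, sqf_apply,
    if_pos hp.squarefree, if_pos squarefree_one, psi_one]
  push_cast; ring

lemma gfun_bound (m n : ℕ) (hn : n ≠ 0) : 0 ≤ gfun m n ∧ gfun m n ≤ rho m n := by
  induction n using Nat.recOnPosPrimePosCoprime with
  | zero => exact absurd rfl hn
  | one =>
    rw [(gfun_mult m).map_one]
    refine ⟨zero_le_one, ?_⟩
    have : 1 ≤ rho m 1 := by
      unfold rho
      have : Nonempty {t : ZMod 1 // t ^ 2 + (m : ZMod 1) = 0} := ⟨⟨0, Subsingleton.elim _ _⟩⟩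
      exact Nat.card_pos
    exact_mod_cast this
  | prime_pow p k hp hk =>
    obtain ⟨k, rfl⟩ : ∃ j, k = j + 1 := ⟨k - 1, by omega⟩
    rw [gfun_prime_pow m hp]
    by_cases hc : p.Coprime (4 * m)
    · rw [triv0_apply, triv0_apply, if_pos (hc.pow_left _), if_pos (hc.pow_left _), one_mul]
      have h1 := psi_sq hc
      rcases sq_eq_sq_iff_eq_or_eq_neg.1 (h1.trans (one_pow 2).symm) with h | h
      · have h2 := rho_prime_pow hp hc h k
        rw [h]
        constructor
        · norm_num
        · have : (2 : ℝ) ≤ rho m (p ^ (k + 1)) := by exact_mod_cast h2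
          push_cast; linarith
      · rw [h]
        push_cast
        constructor
        · norm_num
        · norm_num
    · rw [psi_zero hc, triv0_apply, if_neg]
      · simp
      · intro h
        exact hc (Nat.Coprime.coprime_dvd_left (dvd_pow_self p (by omega)) h)
  | coprime a b ha hb hab iha ihb =>
    rw [(gfun_mult m).map_mul_of_coprime hab]
    have h1 := iha (by omega)
    have h2 := ihb (by omega)
    refine ⟨mul_nonneg h1.1 h2.1, ?_⟩
    calc gfun m a * gfun m b ≤ rho m a * rho m b := mul_le_mul h1.2 h2.2 h2.1 (by positivity)
      _ ≤ _ := by exact_mod_cast rho_mul m (by omega) (by omega) hab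

lemma gfun_even (m n : ℕ) (hn : ¬ Odd n) : gfun m n = 0 := by
  rw [gfun, ArithmeticFunction.mul_apply]
  refine Finset.sum_eq_zero fun x hx => ?_
  have hx' := (Nat.mem_divisorsAntidiagonal.1 hx).1
  by_cases h1 : Odd x.1
  · have h2 : ¬ Odd x.2 := fun h2 => hn (hx' ▸ h1.mul h2)
    rw [sqf_apply, psi_zero (fun h => h2 (coprime_odd h))]
    simp
  · rw [triv0_apply, if_neg (fun h => h1 (coprime_odd h)), zero_mul]

lemma gfun_nonneg (m n : ℕ) : 0 ≤ gfun m n := by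
  rcases eq_or_ne n 0 with rfl | hn
  · simp
  · exact (gfun_bound m n hn).1

lemma gfun_sum_le (m X : ℕ) : ∑ n ∈ Icc 1 X, gfun m n ≤ ((rootPairs m X).card : ℝ) := by
  have h1 : (rootPairs m X).card = ∑ b ∈ range (X + 1), #{a ∈ rootPairs m X | a.1 = b} := by
    apply Finset.card_eq_sum_card_fiberwise
    intro a ha
    have := Finset.mem_coe.1 ha
    rw [rootPairs, Finset.mem_filter, Finset.mem_product] at this
    exact this.1.1
  rw [h1]
  push_cast
  calc ∑ n ∈ Icc 1 X, gfun m n ≤ ∑ n ∈ Icc 1 X, (#{a ∈ rootPairs m X | a.1 = n} : ℝ) := by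
        refine Finset.sum_le_sum fun n hn => ?_
        rw [Finset.mem_Icc] at hn
        by_cases hodd : Odd n
        · refine (gfun_bound m n (by omega)).2.trans ?_
          have hne : NeZero n := ⟨by omega⟩
          have hr : rho m n = #{t : ZMod n | t ^ 2 + (m : ZMod n) = 0} := by
            rw [rho, Nat.card_eq_fintype_card, Fintype.card_subtype]
          rw [hr]
          norm_cast
          refine Finset.card_le_card_of_injOn (fun t => (n, t.val)) ?_ ?_
          · intro t ht
            have ht' : t ^ 2 + (m : ZMod n) = 0 := by simpa using ht
            have hlt := ZMod.val_lt t
            simp only [rootPairs, Finset.coe_filter, Set.mem_ofPred_eq, Finset.mem_filter,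
              Finset.mem_product, Finset.mem_range, and_true]
            refine ⟨⟨by omega, by omega⟩, hodd, hlt, ?_⟩
            rw [← ZMod.intCast_zmod_eq_zero_iff_dvd]
            push_cast
            rw [ZMod.natCast_zmod_val]
            exact ht'
          · intro a _ b _ hab
            simp only [Prod.mk.injEq, true_and] at hab
            exact ZMod.val_injective n hab
        · rw [gfun_even m n hodd]; positivity
    _ ≤ _ := by
        refine Finset.sum_le_sum_of_subset_of_nonneg ?_ (fun _ _ _ => by positivity)
        intro n hn
        rw [Finset.mem_Icc] at hn
        exact Finset.mem_range.2 (by omega)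

end PartP5b

section PartP5c

open Filter Topology MeasureTheory Complex

/-- Indicator of squares coprime to `4 m`. -/
def sqInd (m n : ℕ) : ℂ := if IsSquare n ∧ n.Coprime (4 * m) then 1 else 0

lemma sqfree_unique {a j l k : ℕ} (ha : Squarefree a) (hl : Squarefree l) (hk : k ≠ 0)
    (h : a * j ^ 2 = l * k ^ 2) : a = l ∧ j = k := by
  have key : ∀ {a j l k : ℕ}, Squarefree l → k ≠ 0 → a * j ^ 2 = l * k ^ 2 → j ∣ k := by
    intro a j l k hl hk h
    have hd : 0 < Nat.gcd j k := Nat.gcd_pos_of_pos_right _ (Nat.pos_of_ne_zero hk)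
    obtain ⟨d, j', k', hd, hco, rfl, rfl⟩ := Nat.exists_coprime' hd
    have h1 : a * j' ^ 2 = l * k' ^ 2 := by
      have hd2 : 0 < d ^ 2 := by positivity
      apply Nat.eq_of_mul_eq_mul_right hd2
      linarith [h, mul_pow j' d 2, mul_pow k' d 2]
    have h2 : j' ^ 2 ∣ l := by
      have : j' ^ 2 ∣ l * k' ^ 2 := ⟨a, by rw [← h1]; ring⟩
      exact (Nat.Coprime.pow 2 2 hco).dvd_of_dvd_mul_right this
    have h3 := hl j' (by rwa [← pow_two])
    rw [Nat.isUnit_iff.1 h3, one_mul]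
    exact dvd_mul_left _ _
  have hj : j ≠ 0 := by
    rintro rfl
    have : l ≠ 0 := hl.ne_zero
    have h2 : l * k ^ 2 ≠ 0 := by positivity
    apply h2; rw [← h]; simp
  have hjk : j = k := Nat.dvd_antisymm (key hl hk h) (key ha hj h.symm)
  subst hjk
  exact ⟨Nat.eq_of_mul_eq_mul_right (by positivity) h, rfl⟩

lemma conv_psi (m n : ℕ) (hn : n ≠ 0) :
    (LSeries.convolution (fun n => (sqf m n : ℂ)) (sqInd m)) n = (psi m n : ℂ) := by
  rw [LSeries.convolution_def]
  dsimp only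
  obtain ⟨l, k, hkl, hl⟩ := Nat.sq_mul_squarefree n
  have hk : k ≠ 0 := by rintro rfl; apply hn; rw [← hkl]; simp
  rw [Finset.sum_eq_single (l, k ^ 2)]
  · rw [sqf_apply, if_pos hl, ← hkl, psi_mul, pow_two, psi_mul, sqInd]
    by_cases hc : k.Coprime (4 * m)
    · rw [if_pos ⟨⟨k, rfl⟩, hc.mul_left hc⟩]
      have h5 : (psi m k : ℂ) ^ 2 = 1 := by exact_mod_cast psi_sq hc
      push_cast
      linear_combination -(psi m l : ℂ) * h5
    · rw [if_neg, psi_zero hc]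
      · push_cast; ring
      · exact fun h => hc (Nat.Coprime.coprime_dvd_left (dvd_mul_right k k) h.2)
  · rintro ⟨a, b⟩ hab hne
    have hab' := (Nat.mem_divisorsAntidiagonal.1 hab).1
    dsimp only at hab' ⊢
    rw [sqf_apply, sqInd]
    by_cases ha : Squarefree a
    · rw [if_neg (c := IsSquare b ∧ _), mul_zero]
      rintro ⟨⟨j, rfl⟩, -⟩
      have := sqfree_unique ha hl hk (j := j) (by rw [pow_two, hab', ← hkl]; ring)
      apply hne
      rw [this.1, this.2, pow_two]
    · rw [if_neg ha]; simp
  · intro h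
    exfalso; apply h
    rw [Nat.mem_divisorsAntidiagonal]
    exact ⟨by rw [← hkl]; ring, hn⟩

lemma sqInd_bound (m : ℕ) {σ : ℝ} (hσ : 1 < σ) :
    LSeriesSummable (sqInd m) σ ∧ ‖LSeries (sqInd m) σ‖ ≤ 2 := by
  have hinj : Function.Injective (fun k : ℕ => k ^ 2) := fun a b h => Nat.pow_left_injective two_ne_zero h
  have hsupp : ∀ n ∉ Set.range (fun k : ℕ => k ^ 2), ‖LSeries.term (sqInd m) σ n‖ = 0 := by
    intro n hn
    have : sqInd m n = 0 := by
      rw [sqInd, if_neg]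
      rintro ⟨⟨k, rfl⟩, -⟩
      exact hn ⟨k, pow_two k⟩
    rw [LSeries.term_def, this]; simp
  have hterm : ∀ k : ℕ, ‖LSeries.term (sqInd m) σ (k ^ 2)‖ ≤ 1 / (k : ℝ) ^ 2 := by
    intro k
    rcases eq_or_ne k 0 with rfl | hk
    · simp
    have hk1 : (1 : ℝ) ≤ k := by exact_mod_cast Nat.one_le_iff_ne_zero.2 hk
    rw [LSeries.norm_term_eq, if_neg (by positivity)]
    have h1 : ‖sqInd m (k ^ 2)‖ ≤ 1 := by rw [sqInd]; split_ifs <;> simp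
    rw [ofReal_re]
    have h2 : (k : ℝ) ^ 2 ≤ ((k ^ 2 : ℕ) : ℝ) ^ σ := by
      push_cast
      calc (k : ℝ) ^ 2 = ((k : ℝ) ^ 2) ^ (1 : ℝ) := by rw [Real.rpow_one]
        _ ≤ _ := Real.rpow_le_rpow_of_exponent_le (one_le_pow₀ hk1) hσ.le
    exact div_le_div₀ zero_le_one h1 (by positivity) h2
  have hz : HasSum (fun n : ℕ => 1 / (n : ℝ) ^ 2) (Real.pi ^ 2 / 6) := hasSum_zeta_two
  have hs0 : Summable (fun k : ℕ => ‖LSeries.term (sqInd m) σ (k ^ 2)‖) :=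
    Summable.of_nonneg_of_le (fun _ => norm_nonneg _) hterm hz.summable
  have hs1 : Summable (fun n : ℕ => ‖LSeries.term (sqInd m) σ n‖) :=
    (hinj.summable_iff hsupp).1 hs0
  refine ⟨hs1.of_norm, ?_⟩
  have h1 := norm_tsum_le_tsum_norm hs1
  have h2 : ∑' k : ℕ, ‖LSeries.term (sqInd m) σ (k ^ 2)‖ = ∑' n, ‖LSeries.term (sqInd m) σ n‖ :=
    hinj.tsum_eq (f := fun n => ‖LSeries.term (sqInd m) σ n‖) (by
      intro n hn
      by_contra h
      exact hn (hsupp n h))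
  have h3 := hs0.tsum_le_tsum hterm hz.summable
  rw [hz.tsum_eq] at h3
  have h4 : Real.pi ^ 2 / 6 ≤ 2 := by nlinarith [Real.pi_pos, Real.pi_lt_d2]
  calc ‖LSeries (sqInd m) σ‖ ≤ _ := h1
    _ ≤ 2 := by rw [← h2]; linarith

lemma L_prod_le (m : ℕ) [NeZero m] {σ : ℝ} (hσ : 1 < σ) :
    ‖(1 : DirichletCharacter ℂ (4 * m)).LFunction σ‖ * ‖(chi m).LFunction σ‖ ≤
      2 * ‖LSeries (fun n => (gfun m n : ℂ)) σ‖ := by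
  have hσ' : 1 < (σ : ℂ).re := by simpa using hσ
  have hsf : LSeriesSummable (fun n => (sqf m n : ℂ)) σ := by
    refine LSeriesSummable_of_bounded_of_one_lt_re (m := 1) (fun n _ => ?_) hσ'
    rw [sqf_apply]
    split_ifs
    · by_cases hc : n.Coprime (4 * m)
      · rcases sq_eq_sq_iff_eq_or_eq_neg.1 ((psi_sq hc).trans (one_pow 2).symm) with h | h <;> simp [h]
      · simp [psi_zero hc]
    · simp
  have hs0 : LSeriesSummable (fun n => (1 : DirichletCharacter ℂ (4 * m)) (n : ZMod (4 * m))) σ :=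
    DirichletCharacter.LSeriesSummable_of_one_lt_re _ hσ'
  have hh := sqInd_bound m hσ
  have e1 : LSeries (fun n => (gfun m n : ℂ)) σ =
      (1 : DirichletCharacter ℂ (4 * m)).LFunction σ * LSeries (fun n => (sqf m n : ℂ)) σ := by
    rw [DirichletCharacter.LFunction_eq_LSeries _ hσ', ← LSeries_convolution' hs0 hsf]
    refine LSeries_congr (fun {n} hn => ?_) _
    rw [LSeries.convolution_def, gfun, ArithmeticFunction.mul_apply]
    push_cast
    refine Finset.sum_congr rfl fun x _ => ?_
    congr 1
    rw [triv0_apply]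
    split_ifs with h
    · rw [MulChar.one_apply ((ZMod.isUnit_iff_coprime _ _).2 h)]; simp
    · rw [MulChar.map_nonunit _ (fun h' => h ((ZMod.isUnit_iff_coprime _ _).1 h'))]; simp
  have e2 : (chi m).LFunction σ = LSeries (fun n => (sqf m n : ℂ)) σ * LSeries (sqInd m) σ := by
    rw [DirichletCharacter.LFunction_eq_LSeries _ hσ', ← LSeries_convolution' hsf hh.1]
    refine LSeries_congr (fun {n} hn => ?_) _
    rw [conv_psi m n hn, chi_apply]
  rw [e1, e2, norm_mul, norm_mul]
  have a1 := norm_nonneg ((1 : DirichletCharacter ℂ (4 * m)).LFunction σ)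
  have a2 := norm_nonneg (LSeries (fun n => (sqf m n : ℂ)) σ)
  calc _ = (‖(1 : DirichletCharacter ℂ (4 * m)).LFunction σ‖ * ‖LSeries (fun n => (sqf m n : ℂ)) σ‖) *
        ‖LSeries (sqInd m) σ‖ := by ring
    _ ≤ (‖(1 : DirichletCharacter ℂ (4 * m)).LFunction σ‖ * ‖LSeries (fun n => (sqf m n : ℂ)) σ‖) * 2 :=
        mul_le_mul_of_nonneg_left hh.2 (mul_nonneg a1 a2)
    _ = _ := by ring

lemma g_upper (m : ℕ) [NeZero m] (h0 : m % 8 ≠ 0) (h4 : m % 8 ≠ 4) (h7 : m % 8 ≠ 7) {σ : ℝ}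
    (hσ : 1 < σ) : ‖LSeries (fun n => (gfun m n : ℂ)) σ‖ ≤
      σ * (((latSphere 3 m).ncard : ℝ) * (8 / √m * (1 / (σ - 1)) + 4 * (1 / (σ - 1 / 2)))) := by
  set N : ℝ := ((latSphere 3 m).ncard : ℝ) with hN
  have hN0 : 0 ≤ N := by positivity
  have hb : ∀ t : ℝ, 1 ≤ t → ∑ k ∈ Icc 1 ⌊t⌋₊, gfun m k ≤ N * (8 / √m * t + 4 * t ^ (1 / 2 : ℝ)) := by
    intro t ht
    have h1 := (gfun_sum_le m ⌊t⌋₊).trans (rootPairs_card m h0 h4 h7 ⌊t⌋₊)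
    have hfl : (⌊t⌋₊ : ℝ) ≤ t := Nat.floor_le (by linarith)
    have hsq : 1 ≤ √t := by rw [Real.one_le_sqrt]; exact ht
    have hsq2 : √(⌊t⌋₊ : ℝ) ≤ √t := Real.sqrt_le_sqrt hfl
    rw [← Real.sqrt_eq_rpow]
    refine h1.trans ?_
    rw [mul_comm]
    refine mul_le_mul_of_nonneg_left ?_ hN0
    have h2 : 8 * (⌊t⌋₊ : ℝ) / √m ≤ 8 / √m * t := by
      rw [div_mul_eq_mul_div]
      gcongr
    linarith
  have hO : (fun n : ℕ => ∑ k ∈ Icc 1 n, gfun m k) =O[atTop] fun n : ℕ => (n : ℝ) ^ (1 : ℝ) := by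
    refine Asymptotics.IsBigO.of_bound (N * (8 / √m + 4)) ?_
    filter_upwards [eventually_ge_atTop 1] with n hn
    have hn1 : (1 : ℝ) ≤ n := by exact_mod_cast hn
    have h1 := hb n hn1
    rw [Nat.floor_natCast] at h1
    rw [Real.norm_eq_abs, abs_of_nonneg (Finset.sum_nonneg fun k _ => gfun_nonneg m k), Real.rpow_one,
      Real.norm_eq_abs, abs_of_nonneg (by linarith)]
    refine h1.trans ?_
    have h2 : (n : ℝ) ^ (1 / 2 : ℝ) ≤ n := by
      calc (n : ℝ) ^ (1 / 2 : ℝ) ≤ (n : ℝ) ^ (1 : ℝ) :=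
            Real.rpow_le_rpow_of_exponent_le hn1 (by norm_num)
        _ = n := Real.rpow_one _
    rw [mul_assoc]
    refine mul_le_mul_of_nonneg_left ?_ hN0
    rw [add_mul]
    linarith
  rw [LSeries_eq_mul_integral_of_nonneg (gfun m ·) zero_le_one (s := (σ : ℂ)) (by simpa using hσ) hO
    (gfun_nonneg m), norm_mul, Complex.norm_real, Real.norm_eq_abs, abs_of_pos (by linarith)]
  refine mul_le_mul_of_nonneg_left ?_ (by linarith)
  have i1 := integrableOn_Ioi_rpow_of_lt (a := -σ) (c := 1) (by linarith) one_pos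
  have i2 := integrableOn_Ioi_rpow_of_lt (a := -σ - 1 / 2) (c := 1) (by linarith) one_pos
  have v1 := integral_Ioi_rpow_of_lt (a := -σ) (c := 1) (by linarith) one_pos
  have v2 := integral_Ioi_rpow_of_lt (a := -σ - 1 / 2) (c := 1) (by linarith) one_pos
  calc _ ≤ ∫ t in Set.Ioi (1 : ℝ), N * (8 / √m * t ^ (-σ) + 4 * t ^ (-σ - 1 / 2)) := by
        refine norm_integral_le_of_norm_le (((i1.const_mul _).add (i2.const_mul _)).const_mul N) ?_
        refine (ae_restrict_iff' measurableSet_Ioi).2 (Eventually.of_forall fun t ht => ?_)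
        have ht1 : (1 : ℝ) < t := ht
        have ht0 : 0 < t := by linarith
        rw [norm_mul, ← ofReal_sum, Complex.norm_real, Real.norm_eq_abs,
          abs_of_nonneg (Finset.sum_nonneg fun k _ => gfun_nonneg m k),
          Complex.norm_cpow_eq_rpow_re_of_pos ht0]
        have er : (-((σ : ℂ) + 1)).re = -σ - 1 := by simp; ring
        rw [er]
        calc _ ≤ N * (8 / √m * t + 4 * t ^ (1 / 2 : ℝ)) * t ^ (-σ - 1) :=
              mul_le_mul_of_nonneg_right (hb t ht1.le) (by positivity)
          _ = _ := by
              have a1 : t * t ^ (-σ - 1) = t ^ (-σ) := by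
                rw [← Real.rpow_one_add' ht0.le (by linarith)]; congr 1; ring
              have a2 : t ^ (1 / 2 : ℝ) * t ^ (-σ - 1) = t ^ (-σ - 1 / 2) := by
                rw [← Real.rpow_add ht0]; congr 1; ring
              rw [← a1, ← a2]; ring
    _ = _ := by
        rw [integral_const_mul, integral_add (i1.const_mul _) (i2.const_mul _), integral_const_mul,
          integral_const_mul, v1, v2, Real.one_rpow, Real.one_rpow]
        have e1 : -1 / (-σ + 1) = 1 / (σ - 1) := by
          rw [show -σ + 1 = -(σ - 1) by ring, neg_div_neg_eq]
        have e2 : -1 / (-σ - 1 / 2 + 1) = 1 / (σ - 1 / 2) := by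
          rw [show -σ - 1 / 2 + 1 = -(σ - 1 / 2) by ring, neg_div_neg_eq]
        rw [e1, e2]

end PartP5c

section PartP5d

open Filter Topology MeasureTheory Complex

lemma class_number_lower (m : ℕ) [NeZero m] (h0 : m % 8 ≠ 0) (h4 : m % 8 ≠ 4) (h7 : m % 8 ≠ 7) :
    ‖∏ p ∈ (4 * m).primeFactors, (1 - (p : ℂ)⁻¹)‖ * ‖(chi m).LFunction 1‖ ≤
      16 * ((latSphere 3 m).ncard : ℝ) / √m := by
  set N : ℝ := ((latSphere 3 m).ncard : ℝ) with hN
  have hm0 : NeZero (4 * m) := inferInstance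
  have hcast : Tendsto (fun σ : ℝ => (σ : ℂ)) (𝓝[>] 1) (𝓝[≠] 1) := by
    refine tendsto_nhdsWithin_iff.2 ⟨?_, ?_⟩
    · have := (Complex.continuous_ofReal.tendsto (1 : ℝ)).mono_left
        (nhdsWithin_le_nhds (s := Set.Ioi (1 : ℝ)))
      simpa using this
    · filter_upwards [self_mem_nhdsWithin] with σ hσ
      have : (1 : ℝ) < σ := hσ
      simp only [Set.mem_compl_iff, Set.mem_singleton_iff]
      intro h
      have : σ = 1 := by exact_mod_cast h
      linarith
  have t1 := ((DirichletCharacter.LFunctionTrivChar_residue_one (N := 4 * m)).comp hcast).norm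
  have t2 : Tendsto (fun σ : ℝ => ‖(chi m).LFunction σ‖) (𝓝[>] 1) (𝓝 ‖(chi m).LFunction 1‖) := by
    have hc := (DirichletCharacter.differentiable_LFunction (chi_ne m)).continuous.tendsto 1
    exact ((hc.mono_left nhdsWithin_le_nhds).comp hcast).norm
  have t3 : Tendsto (fun σ : ℝ => 2 * (σ * (N * (8 / √m + 4 * ((σ - 1) / (σ - 1 / 2))))))
      (𝓝[>] 1) (𝓝 (2 * (1 * (N * (8 / √m + 4 * ((1 - 1) / (1 - 1 / 2))))))) := by
    refine Tendsto.mono_left ?_ nhdsWithin_le_nhds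
    have : ContinuousAt (fun σ : ℝ => 2 * (σ * (N * (8 / √m + 4 * ((σ - 1) / (σ - 1 / 2)))))) 1 := by
      fun_prop (disch := norm_num)
    exact this.tendsto
  have key := le_of_tendsto_of_tendsto (t1.mul t2) t3 ?_
  · refine key.trans (le_of_eq ?_)
    ring
  · filter_upwards [self_mem_nhdsWithin] with σ hσ
    have hσ : (1 : ℝ) < σ := hσ
    have hp : 0 < σ - 1 := by linarith
    have a := L_prod_le m hσ
    have b := g_upper m h0 h4 h7 hσ
    have e : ‖(σ : ℂ) - 1‖ = σ - 1 := by
      rw [← ofReal_one, ← ofReal_sub, Complex.norm_real, Real.norm_eq_abs, abs_of_pos hp]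
    simp only [Function.comp, norm_mul, e]
    calc _ = (σ - 1) * (‖(1 : DirichletCharacter ℂ (4 * m)).LFunction σ‖ * ‖(chi m).LFunction σ‖) := by
          rw [mul_assoc]
      _ ≤ (σ - 1) * (2 * (σ * (N * (8 / √m * (1 / (σ - 1)) + 4 * (1 / (σ - 1 / 2)))))) := by
          refine mul_le_mul_of_nonneg_left (a.trans ?_) hp.le
          linarith
      _ = _ := by
          have : (σ - 1) * (1 / (σ - 1)) = 1 := by field_simp
          have e2 : (σ - 1) / (σ - 1 / 2) = (σ - 1) * (1 / (σ - 1 / 2)) := by ring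
          rw [e2]
          linear_combination (2 * σ * N * (8 / √m)) * this

theorem sphere_lower {ε : ℝ} (hε : 0 < ε) (hε1 : ε ≤ 1) : ∃ c : ℝ, 0 < c ∧ ∀ m : ℕ,
    m % 8 ≠ 0 → m % 8 ≠ 4 → m % 8 ≠ 7 →
      c * (m : ℝ) ^ (1 / 2 - ε) ≤ ((latSphere 3 m).ncard : ℝ) := by
  obtain ⟨c1, hc1, H1⟩ := siegel (ε := ε / 2) (by linarith) (by linarith)
  obtain ⟨C2, hC2, H2⟩ := omega_bound 2 (by norm_num) (ε / 2) (by linarith)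
  refine ⟨c1 / (C2 * 16 * 4 ^ ε), by positivity, fun m h0 h4 h7 => ?_⟩
  have hm : m ≠ 0 := by rintro rfl; simp at h0
  have : NeZero m := ⟨hm⟩
  have hmp : (0 : ℝ) < m := by positivity
  have hk := class_number_lower m h0 h4 h7
  have hL := (L_norm_one (chi m) (chi_ne m) (chi_sq m)).2
  have hS := H1 (4 * m) (chi m) (chi_sq m) (chi_ne m)
  have hO := H2 (4 * m) (by positivity)
  have hP : ((2 : ℝ) ^ (4 * m).primeFactors.card)⁻¹ ≤ ‖∏ p ∈ (4 * m).primeFactors, (1 - (p : ℂ)⁻¹)‖ := by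
    rw [norm_prod, ← inv_pow, ← Finset.prod_const]
    refine Finset.prod_le_prod (fun _ _ => by norm_num) fun p hp => ?_
    have h2 : (2 : ℝ) ≤ p := by exact_mod_cast (Nat.prime_of_mem_primeFactors hp).two_le
    have := norm_sub_norm_le (1 : ℂ) ((p : ℂ)⁻¹)
    rw [norm_one, norm_inv, Complex.norm_natCast] at this
    have h3 : (p : ℝ)⁻¹ ≤ 2⁻¹ := inv_anti₀ (by norm_num) h2
    linarith
  set q : ℝ := ((4 * m : ℕ) : ℝ) with hq
  have hq0 : 0 < q := by rw [hq]; positivity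
  have hP2 : (C2 * q ^ (ε / 2))⁻¹ ≤ ‖∏ p ∈ (4 * m).primeFactors, (1 - (p : ℂ)⁻¹)‖ :=
    (inv_anti₀ (by positivity) hO).trans hP
  rw [hL] at hk
  have h5 : (C2 * q ^ (ε / 2))⁻¹ * (c1 * q ^ (-(ε / 2))) ≤ 16 * ((latSphere 3 m).ncard : ℝ) / √m :=
    (mul_le_mul hP2 hS (by positivity) (norm_nonneg _)).trans hk
  rw [le_div_iff₀ (by positivity)] at h5
  have e1 : (q ^ (ε / 2))⁻¹ * q ^ (-(ε / 2)) = 4 ^ (-ε) * (m : ℝ) ^ (-ε) := by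
    rw [← Real.rpow_neg hq0.le, ← Real.rpow_add hq0, hq, ← Real.mul_rpow (by norm_num) hmp.le]
    push_cast
    congr 1; ring
  have e2 : (m : ℝ) ^ (1 / 2 - ε) = (m : ℝ) ^ (-ε) * √m := by
    rw [Real.sqrt_eq_rpow, ← Real.rpow_add hmp]; congr 1; ring
  have e3 : (4 : ℝ) ^ (-ε) = (4 ^ ε)⁻¹ := Real.rpow_neg (by norm_num) _
  calc _ = ((C2 * q ^ (ε / 2))⁻¹ * (c1 * q ^ (-(ε / 2))) * √m) / 16 := by
        rw [mul_inv, show C2⁻¹ * (q ^ (ε / 2))⁻¹ * (c1 * q ^ (-(ε / 2))) =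
          C2⁻¹ * c1 * ((q ^ (ε / 2))⁻¹ * q ^ (-(ε / 2))) by ring, e1, e2, e3]
        field_simp
    _ ≤ _ := by linarith

end PartP5d

lemma box_maps (s m : ℕ) (x : Fin s → Fin 3 → ℤ) (hx : ∀ i, x i ∈ latSphere 3 m) :
    ∑ i, x i ∈ Finset.Icc (fun _ : Fin 3 => -((s * Nat.sqrt m : ℕ) : ℤ))
      (fun _ : Fin 3 => ((s * Nat.sqrt m : ℕ) : ℤ)) := by
  have hb : ∀ i j, |x i j| ≤ (Nat.sqrt m : ℤ) := by
    intro i j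
    have h1 : ∑ k, x i k ^ 2 = (m : ℤ) := hx i
    have h2 : x i j ^ 2 ≤ (m : ℤ) := by
      rw [← h1]
      exact Finset.single_le_sum (f := fun k => x i k ^ 2) (fun k _ => sq_nonneg _) (Finset.mem_univ j)
    rw [Int.abs_eq_natAbs]
    have h3 : (x i j).natAbs * (x i j).natAbs ≤ m := by
      zify
      rw [← abs_mul_abs_self] at *
      rw [← sq_abs] at h2
      simp only [abs_abs]
      nlinarith
    exact_mod_cast Nat.le_sqrt.2 h3
  have hs : ∀ j, |(∑ i, x i) j| ≤ ((s * Nat.sqrt m : ℕ) : ℤ) := by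
    intro j
    rw [Finset.sum_apply]
    refine (Finset.abs_sum_le_sum_abs _ _).trans ?_
    refine (Finset.sum_le_sum fun i _ => hb i j).trans ?_
    simp
  rw [Finset.mem_Icc, Pi.le_def, Pi.le_def]
  exact ⟨fun j => (abs_le.1 (hs j)).1, fun j => (abs_le.1 (hs j)).2⟩

lemma box_card (s m : ℕ) (hm : m ≠ 0) :
    ((Finset.Icc (fun _ : Fin 3 => -((s * Nat.sqrt m : ℕ) : ℤ))
      (fun _ : Fin 3 => ((s * Nat.sqrt m : ℕ) : ℤ))).card : ℝ) ≤
      (2 * s + 1) ^ 3 * (m : ℝ) ^ (3 / 2 : ℝ) := by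
  have hc : (Finset.Icc (fun _ : Fin 3 => -((s * Nat.sqrt m : ℕ) : ℤ))
      (fun _ : Fin 3 => ((s * Nat.sqrt m : ℕ) : ℤ))).card = (2 * (s * Nat.sqrt m) + 1) ^ 3 := by
    rw [Pi.card_Icc]
    simp only [Int.card_Icc, Finset.prod_const, Finset.card_univ, Fintype.card_fin]
    congr 1
    omega
  rw [hc]
  push_cast
  have hm1 : (1 : ℝ) ≤ m := by exact_mod_cast Nat.one_le_iff_ne_zero.2 hm
  have h1 : (1 : ℝ) ≤ √m := by rw [Real.one_le_sqrt]; exact hm1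
  have h2 : (Nat.sqrt m : ℝ) ≤ √m := Real.nat_sqrt_le_real_sqrt
  have h3 : (m : ℝ) ^ (3 / 2 : ℝ) = √m ^ 3 := by
    rw [Real.sqrt_eq_rpow, ← Real.rpow_natCast, ← Real.rpow_mul (by linarith)]
    norm_num
  rw [h3, ← mul_pow]
  refine pow_le_pow_left₀ (by positivity) ?_ 3
  have h4 : (s : ℝ) * (Nat.sqrt m : ℝ) ≤ s * √m := mul_le_mul_of_nonneg_left h2 (by positivity)
  nlinarith

section counting
open scoped Classical in
lemma counting {V : Type*} [AddCommMonoid V] (s : ℕ) (A : Finset V) (B : Finset V)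
    (hB : ∀ x : Fin s → V, (∀ i, x i ∈ A) → ∑ i, x i ∈ B) :
    A.card ^ s ≤ B.card * (⨆ n : V, repCount s (A : Set V) n) ∧
    (A.card ^ s) ^ 2 ≤ B.card * addEnergy s (A : Set V) := by
  set F : Finset (Fin s → V) := Fintype.piFinset (fun _ : Fin s => A) with hF
  have hFc : F.card = A.card ^ s := by rw [hF, Fintype.card_piFinset]; simp
  have hr : ∀ n, repCount s (A : Set V) n = (F.filter (fun x => ∑ i, x i = n)).card := by
    intro n
    exact Nat.subtype_card _ (fun x => by simp [hF])
  have hmap : ∀ x ∈ F, ∑ i, x i ∈ B := fun x hx => hB x (by simpa [hF] using hx)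
  have hsum : F.card = ∑ n ∈ B, repCount s (A : Set V) n := by
    rw [Finset.card_eq_sum_card_fiberwise hmap]
    exact Finset.sum_congr rfl fun n _ => (hr n).symm
  have hbdd : BddAbove (Set.range fun n : V => repCount s (A : Set V) n) := by
    refine ⟨F.card, ?_⟩
    rintro _ ⟨n, rfl⟩
    dsimp only
    rw [hr n]
    exact Finset.card_filter_le _ _
  refine ⟨?_, ?_⟩
  · rw [← hFc, hsum, ← smul_eq_mul]
    exact Finset.sum_le_card_nsmul _ _ _ fun n _ => le_ciSup hbdd n
  · have hE : addEnergy s (A : Set V) = ∑ n ∈ B, repCount s (A : Set V) n ^ 2 := by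
      have h1 : addEnergy s (A : Set V) =
          ((F ×ˢ F).filter (fun p => ∑ i, p.1 i = ∑ i, p.2 i)).card := by
        exact Nat.subtype_card _ (fun x => by simp [hF, and_assoc])
      rw [h1, Finset.card_eq_sum_card_fiberwise (f := fun p => ∑ i, p.1 i) (t := B)]
      · refine Finset.sum_congr rfl fun n _ => ?_
        rw [hr n, pow_two, ← Finset.card_product]
        congr 1
        ext p
        simp only [Finset.mem_filter, Finset.mem_product]
        constructor
        · rintro ⟨⟨⟨a, b⟩, c⟩, d⟩
          exact ⟨⟨a, d⟩, b, c ▸ d⟩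
        · rintro ⟨⟨a, d⟩, b, c⟩
          exact ⟨⟨⟨a, b⟩, d.trans c.symm⟩, d⟩
      · intro p hp
        have hp' := (Finset.mem_product.1 (Finset.mem_filter.1 hp).1).1
        exact hmap _ hp'
    rw [← hFc, hsum, hE]
    exact sq_sum_le_card_mul_sum_sq
end counting

theorem statement_5 (s : ℕ) (hs : 3 ≤ s) (ε : ℝ) (hε : 0 < ε) :
    ∃ c : ℝ, 0 < c ∧
      ∀ m : ℕ, m % 8 ≠ 0 → m % 8 ≠ 4 → m % 8 ≠ 7 →
        (latSphere 3 m).Nonempty ∧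
        c * ((latSphere 3 m).ncard : ℝ) ^ ((s : ℝ) - 3 - ε) ≤
          (↑(⨆ n : Fin 3 → ℤ, repCount s (latSphere 3 m) n) : ℝ) ∧
        c * ((latSphere 3 m).ncard : ℝ) ^ (2 * (s : ℝ) - 3 - ε) ≤
          (addEnergy s (latSphere 3 m) : ℝ) := by
  obtain ⟨c0, hc0, H⟩ := sphere_lower (ε := ε / (2 * (3 + ε))) (by positivity)
    (by rw [div_le_one (by positivity)]; linarith)
  refine ⟨c0 ^ (3 + ε) / (2 * s + 1) ^ 3, by positivity, fun m h0 h4 h7 => ?_⟩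
  have hm : m ≠ 0 := by rintro rfl; simp at h0
  have hne : (latSphere 3 m).Nonempty := by
    obtain ⟨x, y, z, _, _, _, h, _⟩ := three_squares_primitive m h0 h4 h7
    refine ⟨![x, y, z], ?_⟩
    simp only [latSphere, Set.mem_ofPred_eq, Fin.sum_univ_three]
    simpa using h
  have hmp : (0 : ℝ) < m := by positivity
  have hfin := latSphere_finite 3 m
  have hl := H m h0 h4 h7
  obtain ⟨k1, k2⟩ := counting s hfin.toFinset _ (fun x hx => box_maps s m x (by simpa using hx))
  rw [hfin.coe_toFinset, ← Set.ncard_eq_toFinset_card _ hfin] at k1 k2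
  have hNp : 0 < (latSphere 3 m).ncard := (Set.ncard_pos hfin).2 hne
  have hb := box_card s m hm
  set B : ℝ := ((Finset.Icc (fun _ : Fin 3 => -((s * Nat.sqrt m : ℕ) : ℤ))
      (fun _ : Fin 3 => ((s * Nat.sqrt m : ℕ) : ℤ))).card : ℝ) with hB
  set R := ⨆ n : Fin 3 → ℤ, repCount s (latSphere 3 m) n
  have k1' : (((latSphere 3 m).ncard : ℝ)) ^ s ≤ B * (R : ℝ) := by rw [hB]; exact_mod_cast k1
  have k2' : (((latSphere 3 m).ncard : ℝ) ^ s) ^ 2 ≤ B * (addEnergy s (latSphere 3 m) : ℝ) := by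
    rw [hB]; exact_mod_cast k2
  set N : ℝ := ((latSphere 3 m).ncard : ℝ) with hN
  have hN0 : 0 < N := by rw [hN]; exact_mod_cast hNp
  have h1 : c0 ^ (3 + ε) * (m : ℝ) ^ (3 / 2 : ℝ) ≤ N ^ (3 + ε) := by
    have h2 := Real.rpow_le_rpow (by positivity) hl (z := 3 + ε) (by linarith)
    rw [Real.mul_rpow hc0.le (by positivity), ← Real.rpow_mul hmp.le] at h2
    have e : (1 / 2 - ε / (2 * (3 + ε))) * (3 + ε) = 3 / 2 := by
      field_simp
      ring
    rwa [e] at h2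
  have hcB : c0 ^ (3 + ε) / (2 * s + 1) ^ 3 * B ≤ N ^ (3 + ε) := by
    rw [div_mul_eq_mul_div, div_le_iff₀ (by positivity)]
    calc _ ≤ c0 ^ (3 + ε) * ((2 * s + 1) ^ 3 * (m : ℝ) ^ (3 / 2 : ℝ)) := by gcongr
      _ = (c0 ^ (3 + ε) * (m : ℝ) ^ (3 / 2 : ℝ)) * (2 * s + 1) ^ 3 := by ring
      _ ≤ _ := by gcongr
  set c := c0 ^ (3 + ε) / (2 * (s : ℝ) + 1) ^ 3 with hc
  have hcp : 0 < c := by rw [hc]; positivity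
  have fin : ∀ (a E : ℝ), 0 ≤ E → N ^ a ≤ B * E → c * N ^ (a - 3 - ε) ≤ E := by
    intro a E hE h
    have hp : 0 < N ^ (3 + ε) := by positivity
    rw [show a - 3 - ε = a - (3 + ε) by ring, Real.rpow_sub hN0, ← mul_div_assoc, div_le_iff₀ hp]
    calc c * N ^ a ≤ c * (B * E) := by gcongr
      _ = (c * B) * E := by ring
      _ ≤ N ^ (3 + ε) * E := by gcongr
      _ = _ := by ring
  refine ⟨hne, fin s R (by positivity) ?_, fin (2 * s) _ (by positivity) ?_⟩
  · rwa [Real.rpow_natCast]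
  · rw [mul_comm, Real.rpow_mul hN0.le, Real.rpow_natCast]
    exact_mod_cast k2'
end
end

section
/- Let s ≥ 2 be a natural number. There is a constant c(s) > 0 such that for every odd natural number m, E_{s,2}(S_{4,m}) ≥ c(s) · |S_{4,m}|^{2s − 2}. -/
open Finset

noncomputable section

/-- The Gaussian integers of norm `a`. -/
def gaussFin (a : ℕ) : Finset GaussianInt :=
  ((Icc (-(a : ℤ)) a ×ˢ Icc (-(a : ℤ)) a).image
    (fun p => (⟨p.1, p.2⟩ : GaussianInt))).filter (fun z => z.norm = a)

lemma gauss_norm (z : GaussianInt) : z.norm = z.re ^ 2 + z.im ^ 2 := by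
  rw [Zsqrtd.norm_def]; ring

lemma mem_gaussFin {a : ℕ} {z : GaussianInt} : z ∈ gaussFin a ↔ z.norm = a := by
  simp only [gaussFin, mem_filter, mem_image, mem_product, mem_Icc, Prod.exists,
    and_iff_right_iff_imp]
  intro h
  rw [gauss_norm] at h
  refine ⟨z.re, z.im, ⟨⟨?_, ?_⟩, ?_, ?_⟩, rfl⟩ <;>
    nlinarith [Int.le_self_sq z.re, Int.le_self_sq z.im, Int.le_self_sq (-z.re),
      Int.le_self_sq (-z.im), sq_nonneg z.re, sq_nonneg z.im]

/-- The divisor sum of the character mod 4. -/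
def rhoSum (a : ℕ) : ℤ := ∑ d ∈ a.divisors, ZMod.χ₄ (d : ZMod 4)

/-- The character mod 4 as an arithmetic function. -/
def chiArith : ArithmeticFunction ℤ := ⟨fun n => ZMod.χ₄ (n : ZMod 4), by simp⟩

lemma rhoSum_eq (a : ℕ) :
    rhoSum a = (chiArith * ((ArithmeticFunction.zeta : ArithmeticFunction ℕ) :
      ArithmeticFunction ℤ)) a := by
  rw [ArithmeticFunction.coe_mul_zeta_apply]; rfl

lemma rhoSum_mul {a b : ℕ} (h : a.Coprime b) : rhoSum (a * b) = rhoSum a * rhoSum b := by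
  have h1 : chiArith.IsMultiplicative := by
    refine ⟨by simp [chiArith], fun {m n} _ => ?_⟩
    change ZMod.χ₄ ((m * n : ℕ) : ZMod 4) = ZMod.χ₄ (m : ZMod 4) * ZMod.χ₄ (n : ZMod 4)
    rw [Nat.cast_mul, map_mul]
  simp only [rhoSum_eq]
  exact (h1.mul ArithmeticFunction.isMultiplicative_zeta.natCast).map_mul_of_coprime h

lemma rhoSum_prime_pow {p k : ℕ} (hp : p.Prime) :
    rhoSum (p ^ k) = ∑ i ∈ range (k + 1), (ZMod.χ₄ (p : ZMod 4)) ^ i := by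
  rw [rhoSum, Nat.sum_divisors_prime_pow hp]
  refine sum_congr rfl fun i _ => ?_
  rw [Nat.cast_pow, map_pow]

lemma gauss_prime_of_norm {p : ℕ} (hp : p.Prime) {z : GaussianInt} (hz : z.norm = p) :
    Prime z := by
  rw [← irreducible_iff_prime]
  refine ⟨fun h => ?_, fun a b hab => ?_⟩
  · rw [← Zsqrtd.norm_eq_one_iff, hz] at h
    simp at h
    exact hp.one_lt.ne' h
  · rw [← Zsqrtd.norm_eq_one_iff, ← Zsqrtd.norm_eq_one_iff]
    have : a.norm.natAbs * b.norm.natAbs = p := by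
      rw [← Int.natAbs_mul, ← Zsqrtd.norm_mul, ← hab, hz]; simp
    rcases (Nat.prime_mul_iff.1 (this ▸ hp)) with h | h
    · exact Or.inr h.2
    · exact Or.inl h.2

lemma gauss_dvd_norm {x y : GaussianInt} (h : x ∣ y) : x.norm ∣ y.norm := by
  obtain ⟨c, rfl⟩ := h
  exact ⟨c.norm, Zsqrtd.norm_mul _ _⟩

lemma gauss_norm_pow (x : GaussianInt) (n : ℕ) : (x ^ n).norm = x.norm ^ n :=
  map_pow (Zsqrtd.normMonoidHom (d := -1)) x n

lemma gauss_aux {p b : ℕ} (hp : p.Prime) (hp2 : p ≠ 2) (hb : ¬ p ∣ b) {w : GaussianInt}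
    (hw : w.norm = p) {n : ℕ} (hn : n ≠ 0) {β γ : GaussianInt} (hβ : β.norm = b)
    (h : star w ^ n * β = w ^ n * γ) : False := by
  have hpr := gauss_prime_of_norm hp hw
  have hd : w ∣ star w ^ n * β := by rw [h]; exact dvd_mul_of_dvd_left (dvd_pow_self _ hn) _
  rcases hpr.dvd_or_dvd hd with h1 | h1
  · have h2 := hpr.dvd_of_dvd_pow h1
    have h3 : w ∣ w + star w := dvd_add dvd_rfl h2
    have h4 := gauss_dvd_norm h3
    have hpp : Prime (p : ℤ) := Nat.prime_iff_prime_int.1 hp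
    have e : (w + star w).norm = 2 ^ 2 * w.re ^ 2 := by
      rw [gauss_norm]; simp; ring
    rw [e, hw] at h4
    have hre : (p : ℤ) ∣ w.re := by
      rcases hpp.dvd_or_dvd h4 with h5 | h5
      · have := hpp.dvd_of_dvd_pow h5
        have h6 : p ∣ 2 := by exact_mod_cast this
        exact absurd ((Nat.prime_dvd_prime_iff_eq hp Nat.prime_two).1 h6) hp2
      · exact hpp.dvd_of_dvd_pow h5
    rw [gauss_norm] at hw
    have him : (p : ℤ) ∣ w.im := by
      apply hpp.dvd_of_dvd_pow (n := 2)
      have : w.im ^ 2 = p - w.re ^ 2 := by linarith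
      rw [this]
      exact dvd_sub dvd_rfl (dvd_pow hre two_ne_zero)
    have h7 : (p : ℤ) ^ 2 ∣ p := by
      nth_rewrite 2 [← hw]
      exact dvd_add (pow_dvd_pow_of_dvd hre 2) (pow_dvd_pow_of_dvd him 2)
    have h8 : p ^ 2 ∣ p := by exact_mod_cast h7
    have := Nat.le_of_dvd hp.pos h8
    nlinarith [hp.two_le]
  · have h2 := gauss_dvd_norm h1
    rw [hw, hβ] at h2
    exact hb (by exact_mod_cast h2)

lemma gauss_aux2 {p b k i j : ℕ} (hp : p.Prime) (hp2 : p ≠ 2) (hb : ¬ p ∣ b) {w : GaussianInt}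
    (hw : w.norm = p) {β γ : GaussianInt} (hβ : β.norm = b)
    (hij : i < j) (hj : j ≤ k)
    (h : w ^ i * star w ^ (k - i) * β = w ^ j * star w ^ (k - j) * γ) : False := by
  have hw0 : w ≠ 0 := (gauss_prime_of_norm hp hw).ne_zero
  have hs0 : star w ≠ 0 := by simpa using hw0
  obtain ⟨n, rfl⟩ := Nat.exists_eq_add_of_lt hij
  obtain ⟨l, rfl⟩ := Nat.exists_eq_add_of_le hj
  have e1 : i + n + 1 + l - i = l + (n + 1) := by omega
  have e2 : i + n + 1 + l - (i + n + 1) = l := by omega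
  rw [e1, e2] at h
  refine gauss_aux hp hp2 hb hw (Nat.succ_ne_zero n) hβ (γ := γ) ?_
  have hne : w ^ i * star w ^ l ≠ 0 := mul_ne_zero (pow_ne_zero _ hw0) (pow_ne_zero _ hs0)
  apply mul_left_cancel₀ hne
  calc _ = w ^ i * star w ^ (l + (n + 1)) * β := by rw [pow_add, Nat.succ_eq_add_one]; ring
    _ = _ := h
    _ = _ := by rw [add_assoc, pow_add, Nat.succ_eq_add_one]; ring

lemma gauss_step {p k b : ℕ} (hp : p.Prime) (hp2 : p ≠ 2) (hb : ¬ p ∣ b) :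
    0 ≤ rhoSum (p ^ k) ∧
      rhoSum (p ^ k) * ((gaussFin b).card : ℤ) ≤ ((gaussFin (p ^ k * b)).card : ℤ) := by
  have hodd : p % 2 = 1 := hp.eq_two_or_odd.resolve_left hp2
  rw [rhoSum_prime_pow hp]
  rcases Nat.odd_mod_four_iff.1 hodd with h4 | h4
  · rw [ZMod.χ₄_nat_one_mod_four h4]
    have := Fact.mk hp
    obtain ⟨x, y, hxy⟩ := Nat.Prime.sq_add_sq (p := p) (by omega)
    set w : GaussianInt := ⟨x, y⟩ with hwdef
    have hw : w.norm = p := by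
      rw [gauss_norm]; simp only [hwdef]; exact_mod_cast hxy
    have hcard : (range (k + 1) ×ˢ gaussFin b).card ≤ (gaussFin (p ^ k * b)).card := by
      apply Finset.card_le_card_of_injOn
        (fun q => w ^ q.1 * star w ^ (k - q.1) * q.2)
      · rintro ⟨i, β⟩ hq
        simp only [coe_product, Set.mem_prod, mem_coe, mem_range, mem_gaussFin] at hq ⊢
        rw [Zsqrtd.norm_mul, Zsqrtd.norm_mul, gauss_norm_pow, gauss_norm_pow, Zsqrtd.norm_conj,
          hw, hq.2, ← pow_add]
        push_cast
        congr 2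
        omega
      · rintro ⟨i, β⟩ hq ⟨j, γ⟩ hq' heq
        simp only [coe_product, Set.mem_prod, mem_coe, mem_range, mem_gaussFin] at hq hq' heq
        rcases lt_trichotomy i j with h | h | h
        · exact (gauss_aux2 hp hp2 hb hw hq.2 h (by omega) heq).elim
        · subst h
          have hw0 : w ≠ 0 := (gauss_prime_of_norm hp hw).ne_zero
          have hs0 : star w ≠ 0 := by simpa using hw0
          have hne : w ^ i * star w ^ (k - i) ≠ 0 :=
            mul_ne_zero (pow_ne_zero _ hw0) (pow_ne_zero _ hs0)
          rw [mul_left_cancel₀ hne heq]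
        · exact (gauss_aux2 hp hp2 hb hw hq'.2 h (by omega) heq.symm).elim
    rw [card_product, card_range] at hcard
    simp only [one_pow, sum_const, card_range, nsmul_eq_mul, mul_one]
    exact ⟨by positivity, by exact_mod_cast hcard⟩
  · rw [ZMod.χ₄_nat_three_mod_four h4, neg_one_geom_sum]
    split_ifs with hk
    · simp
    · refine ⟨by norm_num, ?_⟩
      rw [Nat.even_add_one, not_not] at hk
      obtain ⟨l, rfl⟩ := hk
      rw [one_mul]
      norm_cast
      apply Finset.card_le_card_of_injOn (fun β => ((p ^ l : ℕ) : GaussianInt) * β)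
      · intro β hβ
        simp only [mem_coe, mem_gaussFin] at hβ ⊢
        rw [Zsqrtd.norm_mul, Zsqrtd.norm_natCast, hβ]
        push_cast
        ring
      · intro β _ γ _ h
        have : ((p ^ l : ℕ) : GaussianInt) ≠ 0 := by
          exact_mod_cast pow_ne_zero _ hp.ne_zero
        exact mul_left_cancel₀ this h

lemma gauss_main (a : ℕ) : Odd a →
    0 ≤ rhoSum a ∧ 4 * rhoSum a ≤ ((gaussFin a).card : ℤ) := by
  induction a using Nat.recOnPrimePow with
  | zero => intro h; exact absurd h (by decide)
  | one =>
    intro _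
    have h1 : rhoSum 1 = 1 := by simp [rhoSum]
    rw [h1]
    refine ⟨by norm_num, ?_⟩
    have : ({⟨1, 0⟩, ⟨-1, 0⟩, ⟨0, 1⟩, ⟨0, -1⟩} : Finset GaussianInt) ⊆ gaussFin 1 := by
      intro z hz
      simp only [mem_insert, mem_singleton] at hz
      rw [mem_gaussFin, gauss_norm]
      rcases hz with rfl | rfl | rfl | rfl <;> norm_num
    have := card_le_card this
    have h4 : ({⟨1, 0⟩, ⟨-1, 0⟩, ⟨0, 1⟩, ⟨0, -1⟩} : Finset GaussianInt).card = 4 := by decide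
    rw [h4] at this
    exact_mod_cast this
  | prime_pow_mul a p n hp hpa hn ih =>
    intro hodd
    rw [Nat.odd_mul] at hodd
    obtain ⟨i1, i2⟩ := ih hodd.2
    have hp2 : p ≠ 2 := by
      rintro rfl
      have := (Nat.odd_pow_iff hn.ne').1 hodd.1
      exact absurd this (by decide)
    obtain ⟨s1, s2⟩ := gauss_step (k := n) hp hp2 hpa
    rw [rhoSum_mul (((Nat.Prime.coprime_iff_not_dvd hp).2 hpa).pow_left n)]
    refine ⟨mul_nonneg s1 i1, ?_⟩
    nlinarith [mul_le_mul_of_nonneg_left i2 s1]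

/-- Quadruples `((d, α), (e, β))` of odd numbers with `d α + e β = 2 m`. -/
def quadFin (m : ℕ) : Finset ((ℕ × ℕ) × (ℕ × ℕ)) :=
  ((range (2 * m + 1) ×ˢ range (2 * m + 1)) ×ˢ
    (range (2 * m + 1) ×ˢ range (2 * m + 1))).filter
      (fun q => Odd q.1.1 ∧ Odd q.1.2 ∧ Odd q.2.1 ∧ Odd q.2.2 ∧
        q.1.1 * q.1.2 + q.2.1 * q.2.2 = 2 * m)

lemma mem_quadFin {m d α e β : ℕ} : ((d, α), (e, β)) ∈ quadFin m ↔
    Odd d ∧ Odd α ∧ Odd e ∧ Odd β ∧ d * α + e * β = 2 * m := by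
  simp only [quadFin, mem_filter, mem_product, mem_range, and_iff_right_iff_imp]
  rintro ⟨h1, h2, h3, h4, h⟩
  have := h1.pos
  have := h2.pos
  have := h3.pos
  have := h4.pos
  refine ⟨⟨?_, ?_⟩, ?_, ?_⟩ <;> nlinarith

/-- The weight of a quadruple. -/
def quadWt (q : (ℕ × ℕ) × (ℕ × ℕ)) : ℤ :=
  ZMod.χ₄ (q.1.1 : ZMod 4) * ZMod.χ₄ (q.2.1 : ZMod 4)

lemma chi_flip : ∀ d α e β x : ZMod 4, d * α + e * β = 2 → 2 * d = 2 → 2 * α = 2 → 2 * e = 2 →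
    2 * β = 2 → 2 * x = 2 →
    ZMod.χ₄ d * ZMod.χ₄ e + ZMod.χ₄ (x + (α + β)) * ZMod.χ₄ x = 0 := by
  decide

lemma odd_cast_four {n : ℕ} (h : Odd n) : (2 : ZMod 4) * (n : ZMod 4) = 2 := by
  obtain ⟨k, rfl⟩ := h
  push_cast
  have : (4 : ZMod 4) = 0 := by decide
  linear_combination (k : ZMod 4) * this

/-- Dirichlet's involution. -/
def quadInv (q : (ℕ × ℕ) × (ℕ × ℕ)) : (ℕ × ℕ) × (ℕ × ℕ) :=
  ((q.1.2 + (q.1.2 + q.2.2) * (q.2.1 / (q.1.1 - q.2.1)) + (q.1.2 + q.2.2),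
      q.2.1 % (q.1.1 - q.2.1)),
    (q.1.2 + (q.1.2 + q.2.2) * (q.2.1 / (q.1.1 - q.2.1)),
      (q.1.1 - q.2.1) - q.2.1 % (q.1.1 - q.2.1)))

lemma quad_gt_sum {m : ℕ} (hm : Odd m) :
    ∑ q ∈ (quadFin m).filter (fun q => q.2.1 < q.1.1), quadWt q = 0 := by
  have key : ∀ q ∈ (quadFin m).filter (fun q => q.2.1 < q.1.1),
      quadWt q + quadWt (quadInv q) = 0 ∧
      quadInv q ∈ (quadFin m).filter (fun q => q.2.1 < q.1.1) ∧ quadInv (quadInv q) = q := by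
    rintro ⟨⟨d, α⟩, ⟨e, β⟩⟩ hq
    simp only [mem_filter, mem_quadFin] at hq
    obtain ⟨⟨hd, hα, he, hβ, h⟩, hlt⟩ := hq
    obtain ⟨D, hD⟩ := Nat.exists_eq_add_of_le hlt.le
    have hD0 : 0 < D := by omega
    subst hD
    have hDe : Even D := by
      rcases Nat.even_or_odd D with h' | h'
      · exact h'
      · exact absurd (he.add_odd h') (Nat.not_even_iff_odd.2 hd)
    have hS : Even (α + β) := hα.add_odd hβ
    have hαp := hα.pos
    have hβp := hβ.pos
    have hdm := Nat.div_add_mod e D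
    have hr := Nat.mod_lt e hD0
    have esub : e + D - e = D := by omega
    simp only [quadInv, esub]
    generalize e / D = t at *
    generalize e % D = r at *
    have hrodd : Odd r := by
      rcases Nat.even_or_odd r with h' | h'
      · exact absurd ((hDe.mul_right t).add h') (by rw [hdm]; exact Nat.not_even_iff_odd.2 he)
      · exact h'
    obtain ⟨u, hu⟩ := Nat.exists_eq_add_of_lt hr
    have hDr : D - r = u + 1 := by omega
    have hodd1 : Odd (α + (α + β) * t) := hα.add_even (hS.mul_right t)
    have hodd2 : Odd (α + (α + β) * t + (α + β)) := hodd1.add_even hS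
    have hodd3 : Odd (D - r) := Nat.Even.sub_odd hr.le hDe hrodd
    have heq : (α + (α + β) * t + (α + β)) * r + (α + (α + β) * t) * (D - r) = 2 * m := by
      rw [hDr, ← h, ← hdm, hu]; ring
    refine ⟨?_, ?_, ?_⟩
    · simp only [quadWt]
      have h2m : (((e + D : ℕ) : ZMod 4) * α + e * β) = 2 := by
        rw [← odd_cast_four hm]; exact_mod_cast congrArg (Nat.cast : ℕ → ZMod 4) h
      have := chi_flip ((e + D : ℕ) : ZMod 4) α e β ((α + (α + β) * t : ℕ) : ZMod 4) h2m
        (odd_cast_four hd) (odd_cast_four hα) (odd_cast_four he) (odd_cast_four hβ)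
        (odd_cast_four hodd1)
      rw [Nat.cast_add (α + (α + β) * t) (α + β), Nat.cast_add α β]
      exact this
    · simp only [mem_filter, mem_quadFin]
      exact ⟨⟨hodd2, hrodd, hodd1, hodd3, heq⟩, by omega⟩
    · have e1 : α + (α + β) * t + (α + β) - (α + (α + β) * t) = α + β := by omega
      have e2 : (α + (α + β) * t) / (α + β) = t := by
        rw [Nat.add_mul_div_left _ _ (by omega), Nat.div_eq_of_lt (by omega), zero_add]
      have e3 : (α + (α + β) * t) % (α + β) = α := by
        rw [Nat.add_mul_mod_self_left, Nat.mod_eq_of_lt (by omega)]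
      have e4 : r + (D - r) = D := by omega
      rw [e1, e2, e3, e4]
      have e5 : r + D * t = e := by omega
      rw [e5, Nat.add_sub_cancel_left]
  refine sum_involution (fun q _ => quadInv q) (fun q hq => (key q hq).1) ?_
    (fun q hq => (key q hq).2.1) (fun q hq => (key q hq).2.2)
  intro q hq hne heq
  have := (key q hq).1
  rw [heq] at this
  omega

lemma quad_lt_sum {m : ℕ} (hm : Odd m) :
    ∑ q ∈ (quadFin m).filter (fun q => q.1.1 < q.2.1), quadWt q = 0 := by
  rw [← quad_gt_sum hm]
  refine sum_nbij' Prod.swap Prod.swap ?_ ?_ ?_ ?_ ?_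
  · rintro ⟨⟨d, α⟩, ⟨e, β⟩⟩ hq
    simp only [mem_filter, mem_quadFin, Prod.swap] at hq ⊢
    obtain ⟨⟨hd, hα, he, hβ, h⟩, hlt⟩ := hq
    exact ⟨⟨he, hβ, hd, hα, by omega⟩, hlt⟩
  · rintro ⟨⟨d, α⟩, ⟨e, β⟩⟩ hq
    simp only [mem_filter, mem_quadFin, Prod.swap] at hq ⊢
    obtain ⟨⟨hd, hα, he, hβ, h⟩, hlt⟩ := hq
    exact ⟨⟨he, hβ, hd, hα, by omega⟩, hlt⟩
  · intro q _; simp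
  · intro q _; simp
  · intro q _; simp only [quadWt, Prod.swap]; ring

lemma quad_eq_sum {m : ℕ} :
    (m : ℤ) ≤ ∑ q ∈ (quadFin m).filter (fun q => q.1.1 = q.2.1), quadWt q := by
  have h1 : ∀ q ∈ (quadFin m).filter (fun q => q.1.1 = q.2.1), quadWt q = 1 := by
    rintro ⟨⟨d, α⟩, ⟨e, β⟩⟩ hq
    simp only [mem_filter, mem_quadFin] at hq
    obtain ⟨⟨hd, hα, he, hβ, h⟩, rfl⟩ := hq
    simp only [quadWt]
    have : ∀ x : ZMod 4, 2 * x = 2 → ZMod.χ₄ x * ZMod.χ₄ x = 1 := by decide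
    exact this _ (odd_cast_four hd)
  rw [sum_congr rfl h1, sum_const, nsmul_eq_mul, mul_one]
  norm_cast
  rw [← card_range m]
  conv_rhs => rw [card_range m]
  apply card_le_card_of_injOn (fun i => ((1, 2 * i + 1), (1, 2 * m - (2 * i + 1))))
  · intro i hi
    simp only [mem_coe, mem_range, mem_filter, mem_quadFin] at hi ⊢
    refine ⟨⟨odd_one, ⟨i, rfl⟩, odd_one, ⟨m - i - 1, by omega⟩, by omega⟩, trivial⟩
  · intro i _ j _ h
    simp only [Prod.mk.injEq] at h
    omega

lemma quad_sum {m : ℕ} (hm : Odd m) : (m : ℤ) ≤ ∑ q ∈ quadFin m, quadWt q := by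
  rw [← sum_filter_add_sum_filter_not (quadFin m) (fun q => q.1.1 = q.2.1),
    ← sum_filter_add_sum_filter_not ((quadFin m).filter (fun q => ¬ q.1.1 = q.2.1))
      (fun q => q.1.1 < q.2.1), filter_filter, filter_filter]
  have e1 : (quadFin m).filter (fun q => ¬ q.1.1 = q.2.1 ∧ q.1.1 < q.2.1) =
      (quadFin m).filter (fun q => q.1.1 < q.2.1) := filter_congr (fun q _ => by omega)
  have e2 : (quadFin m).filter (fun q => ¬ q.1.1 = q.2.1 ∧ ¬ q.1.1 < q.2.1) =
      (quadFin m).filter (fun q => q.2.1 < q.1.1) := filter_congr (fun q _ => by omega)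
  rw [e1, e2, quad_lt_sum hm, quad_gt_sum hm]
  simpa using quad_eq_sum (m := m)

lemma rho_conv {m : ℕ} :
    ∑ a ∈ (range (2 * m)).filter Odd, rhoSum a * rhoSum (2 * m - a) =
      ∑ q ∈ quadFin m, quadWt q := by
  rw [← sum_fiberwise_of_maps_to (s := quadFin m) (t := (range (2 * m)).filter Odd)
    (g := fun q => q.1.1 * q.1.2)]
  · refine sum_congr rfl fun a ha => ?_
    simp only [mem_filter, mem_range] at ha
    have hset : (quadFin m).filter (fun q => q.1.1 * q.1.2 = a) =
        a.divisorsAntidiagonal ×ˢ (2 * m - a).divisorsAntidiagonal := by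
      ext ⟨⟨d, α⟩, ⟨e, β⟩⟩
      simp only [mem_filter, mem_quadFin, mem_product, Nat.mem_divisorsAntidiagonal]
      constructor
      · rintro ⟨⟨hd, hα, he, hβ, h⟩, hlt⟩
        have := ha.2.pos
        exact ⟨⟨hlt, by omega⟩, by omega, by omega⟩
      · rintro ⟨⟨h1, h2⟩, h3, h4⟩
        have o1 : Odd (d * α) := h1 ▸ ha.2
        have o2 : Odd (e * β) := by
          rw [h3]; exact Nat.Even.sub_odd ha.1.le (even_two_mul m) ha.2
        rw [Nat.odd_mul] at o1 o2
        exact ⟨⟨o1.1, o1.2, o2.1, o2.2, by omega⟩, h1⟩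
    rw [hset, sum_product]
    simp only [rhoSum, quadWt]
    rw [← Nat.sum_divisorsAntidiagonal (fun d _ => ZMod.χ₄ (d : ZMod 4)),
      ← Nat.sum_divisorsAntidiagonal (fun d _ => ZMod.χ₄ (d : ZMod 4)), sum_mul_sum]
  · rintro ⟨⟨d, α⟩, ⟨e, β⟩⟩ hq
    simp only [mem_filter, mem_quadFin, mem_range] at hq ⊢
    obtain ⟨hd, hα, he, hβ, h⟩ := hq
    have := (he.mul hβ).pos
    exact ⟨by omega, hd.mul hα⟩

/-- The sphere as a finset. -/
def sphFin (m : ℕ) : Finset (Fin 4 → ℤ) :=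
  (Fintype.piFinset (fun _ : Fin 4 => Icc (-(m.sqrt : ℤ)) m.sqrt)).filter
    (fun x => ∑ i, x i ^ 2 = (m : ℤ))

lemma abs_le_of_mem {m : ℕ} {x : Fin 4 → ℤ} (h : ∑ i, x i ^ 2 = (m : ℤ)) (i : Fin 4) :
    |x i| ≤ (m.sqrt : ℤ) := by
  have h1 : x i ^ 2 ≤ (m : ℤ) := by
    rw [← h]
    exact single_le_sum (f := fun i => x i ^ 2) (fun j _ => sq_nonneg (x j)) (mem_univ i)
  have h2 : (x i).natAbs ≤ m.sqrt := by
    rw [Nat.le_sqrt']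
    zify
    simpa using h1
  zify at h2
  exact h2

lemma mem_sphFin {m : ℕ} {x : Fin 4 → ℤ} : x ∈ sphFin m ↔ ∑ i, x i ^ 2 = (m : ℤ) := by
  simp only [sphFin, mem_filter, Fintype.mem_piFinset, mem_Icc, and_iff_right_iff_imp]
  exact fun h i => abs_le.1 (abs_le_of_mem h i)

lemma coe_sphFin (m : ℕ) : (sphFin m : Set (Fin 4 → ℤ)) = latSphere 4 m := by
  ext x; simp [mem_sphFin, latSphere]

/-- Combining two Gaussian integers to a point of the sphere. -/
def comb (z w : GaussianInt) : Fin 4 → ℤ :=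
  ![(z.re + w.re) / 2, (z.re - w.re) / 2, (z.im + w.im) / 2, (z.im - w.im) / 2]

lemma comb_spec {z w : GaussianInt} (h1 : Even (z.re + w.re)) (h2 : Even (z.im + w.im)) :
    z.re = comb z w 0 + comb z w 1 ∧ w.re = comb z w 0 - comb z w 1 ∧
    z.im = comb z w 2 + comb z w 3 ∧ w.im = comb z w 2 - comb z w 3 := by
  obtain ⟨a, ha⟩ := h1
  obtain ⟨b, hb⟩ := h2
  simp only [comb, Matrix.cons_val]
  omega

lemma comb_mem {m : ℕ} {z w : GaussianInt} (h1 : Even (z.re + w.re)) (h2 : Even (z.im + w.im))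
    (h : z.norm + w.norm = 2 * m) : comb z w ∈ sphFin m := by
  obtain ⟨e1, e2, e3, e4⟩ := comb_spec h1 h2
  rw [mem_sphFin, Fin.sum_univ_four]
  rw [gauss_norm, gauss_norm, e1, e2, e3, e4] at h
  linarith

lemma comb_inj {z w z' w' : GaussianInt} (h1 : Even (z.re + w.re)) (h2 : Even (z.im + w.im))
    (h1' : Even (z'.re + w'.re)) (h2' : Even (z'.im + w'.im)) (h : comb z w = comb z' w') :
    z = z' ∧ w = w' := by
  obtain ⟨e1, e2, e3, e4⟩ := comb_spec h1 h2
  obtain ⟨f1, f2, f3, f4⟩ := comb_spec h1' h2'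
  rw [h] at e1 e2 e3 e4
  exact ⟨Zsqrtd.ext (e1.trans f1.symm) (e3.trans f3.symm),
    Zsqrtd.ext (e2.trans f2.symm) (e4.trans f4.symm)⟩

/-- Pairs of Gaussian integers of odd norm with total norm `2m`. -/
def pairFin (m : ℕ) : Finset (GaussianInt × GaussianInt) :=
  ((range (2 * m)).filter Odd).biUnion (fun a => gaussFin a ×ˢ gaussFin (2 * m - a))

lemma odd_norm {z : GaussianInt} (h : Odd z.norm) : Odd (z.re + z.im) := by
  rw [gauss_norm, Int.odd_add, Int.odd_pow' two_ne_zero, Int.even_pow' two_ne_zero] at h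
  rwa [Int.odd_add]

lemma pair_spec {m : ℕ} {z w : GaussianInt} (h : (z, w) ∈ pairFin m) :
    Odd (z.re + z.im) ∧ Odd (w.re + w.im) ∧ z.norm + w.norm = 2 * m := by
  simp only [pairFin, mem_biUnion, mem_filter, mem_range, mem_product, mem_gaussFin] at h
  obtain ⟨a, ⟨ha, ho⟩, hz, hw⟩ := h
  have ho2 : Odd (2 * m - a) := Nat.Even.sub_odd ha.le (even_two_mul m) ho
  refine ⟨odd_norm ?_, odd_norm ?_, ?_⟩
  · rw [hz]; exact_mod_cast ho
  · rw [hw]; exact_mod_cast ho2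
  · rw [hz, hw]; omega

lemma pair_card (m : ℕ) : (pairFin m).card ≤ 2 * (sphFin m).card := by
  rw [← card_filter_add_card_filter_not (s := pairFin m) (fun q => Even (q.1.re + q.2.re)), two_mul]
  apply add_le_add
  · have par : ∀ z w : GaussianInt, (z, w) ∈ (pairFin m).filter (fun q => Even (q.1.re + q.2.re)) →
        Even (z.re + w.re) ∧ Even (z.im + w.im) ∧ z.norm + w.norm = 2 * m := by
      intro z w hq
      rw [mem_filter] at hq
      obtain ⟨h1, h2, h3⟩ := pair_spec hq.1
      refine ⟨hq.2, ?_, h3⟩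
      have := hq.2
      simp only [Int.even_iff, Int.odd_iff] at *
      omega
    apply card_le_card_of_injOn (fun q => comb q.1 q.2)
    · rintro ⟨z, w⟩ hq
      obtain ⟨h1, h2, h3⟩ := par z w hq
      exact comb_mem h1 h2 h3
    · rintro ⟨z, w⟩ hq ⟨z', w'⟩ hq' h
      obtain ⟨h1, h2, h3⟩ := par z w hq
      obtain ⟨h1', h2', h3'⟩ := par z' w' hq'
      obtain ⟨rfl, rfl⟩ := comb_inj h1 h2 h1' h2' h
      rfl
  · have par : ∀ z w : GaussianInt,
        (z, w) ∈ (pairFin m).filter (fun q => ¬ Even (q.1.re + q.2.re)) →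
        Even (z.re + w.im) ∧ Even (z.im + w.re) ∧ z.norm + w.norm = 2 * m := by
      intro z w hq
      rw [mem_filter] at hq
      obtain ⟨h1, h2, h3⟩ := pair_spec hq.1
      have := hq.2
      refine ⟨?_, ?_, h3⟩ <;>
      · simp only [Int.even_iff, Int.odd_iff] at *
        omega
    apply card_le_card_of_injOn (fun q => comb q.1 ⟨q.2.im, q.2.re⟩)
    · rintro ⟨z, w⟩ hq
      obtain ⟨h1, h2, h3⟩ := par z w hq
      refine comb_mem h1 h2 ?_
      rw [← h3, gauss_norm w, gauss_norm ⟨w.im, w.re⟩, add_comm (w.re ^ 2)]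
    · rintro ⟨z, w⟩ hq ⟨z', w'⟩ hq' h
      obtain ⟨h1, h2, h3⟩ := par z w hq
      obtain ⟨h1', h2', h3'⟩ := par z' w' hq'
      obtain ⟨rfl, h5⟩ := comb_inj (w := ⟨w.im, w.re⟩) (w' := ⟨w'.im, w'.re⟩) h1 h2 h1' h2' h
      rw [Zsqrtd.ext_iff] at h5
      rw [Prod.mk.injEq]
      exact ⟨rfl, Zsqrtd.ext h5.2 h5.1⟩

lemma sph_card {m : ℕ} (hm : Odd m) : m ≤ (sphFin m).card := by
  have h1 := pair_card m
  have h2 : (pairFin m).card =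
      ∑ a ∈ (range (2 * m)).filter Odd, (gaussFin a).card * (gaussFin (2 * m - a)).card := by
    rw [pairFin, card_biUnion]
    · simp only [card_product]
    · intro a _ b _ hab
      rw [Function.onFun, disjoint_left]
      rintro ⟨z, w⟩ hz hz'
      simp only [mem_product, mem_gaussFin] at hz hz'
      exact hab (by exact_mod_cast hz.1.symm.trans hz'.1)
  have h3 : 16 * ∑ a ∈ (range (2 * m)).filter Odd, rhoSum a * rhoSum (2 * m - a) ≤
      ((pairFin m).card : ℤ) := by
    rw [h2, mul_sum]
    push_cast
    refine sum_le_sum fun a ha => ?_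
    simp only [mem_filter, mem_range] at ha
    obtain ⟨p1, p2⟩ := gauss_main a ha.2
    obtain ⟨q1, q2⟩ := gauss_main (2 * m - a) (Nat.Even.sub_odd ha.1.le (even_two_mul m) ha.2)
    calc 16 * (rhoSum a * rhoSum (2 * m - a)) = (4 * rhoSum a) * (4 * rhoSum (2 * m - a)) := by ring
      _ ≤ _ := mul_le_mul p2 q2 (by linarith) (by linarith)
  rw [rho_conv] at h3
  have h4 := quad_sum hm
  omega

lemma energy_lower (s m : ℕ) (hs : 1 ≤ s) (hm : 1 ≤ m) :
    (sphFin m).card ^ (2 * s) ≤ 81 * s ^ 4 * m ^ 2 * addEnergy s (latSphere 4 m) := by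
  classical
  set P : Finset (Fin s → Fin 4 → ℤ) := Fintype.piFinset (fun _ => sphFin m) with hP
  set B : Finset (Fin 4 → ℤ) :=
    Fintype.piFinset (fun _ => Icc (-((s * m.sqrt : ℕ) : ℤ)) ((s * m.sqrt : ℕ) : ℤ)) with hB
  have hPc : P.card = (sphFin m).card ^ s := by simp [hP]
  have hmaps : ∀ x ∈ P, ∑ i, x i ∈ B := by
    intro x hx
    rw [hP, Fintype.mem_piFinset] at hx
    rw [hB, Fintype.mem_piFinset]
    intro j
    rw [mem_Icc, ← abs_le, Finset.sum_apply]
    calc |∑ i, x i j| ≤ ∑ i, |x i j| := abs_sum_le_sum_abs _ _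
      _ ≤ ∑ _i : Fin s, (m.sqrt : ℤ) :=
        sum_le_sum fun i _ => abs_le_of_mem (mem_sphFin.1 (hx i)) j
      _ = _ := by simp
  have hBc : B.card ≤ 81 * s ^ 4 * m ^ 2 := by
    have : B.card = (2 * (s * m.sqrt) + 1) ^ 4 := by
      rw [hB, Fintype.card_piFinset]
      simp only [Int.card_Icc, prod_const, card_univ, Fintype.card_fin]
      congr 1
      omega
    rw [this]
    have hq : 1 ≤ m.sqrt := by rw [Nat.le_sqrt]; omega
    have hsq : 1 ≤ s * m.sqrt := Nat.mul_pos hs hq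
    have hq2 : m.sqrt ^ 2 ≤ m := Nat.sqrt_le' m
    calc (2 * (s * m.sqrt) + 1) ^ 4 ≤ (3 * (s * m.sqrt)) ^ 4 := Nat.pow_le_pow_left (by omega) 4
      _ = 81 * s ^ 4 * (m.sqrt ^ 2) ^ 2 := by ring
      _ ≤ _ := by gcongr
  have hE : addEnergy s (latSphere 4 m) =
      ∑ n ∈ B, (P.filter (fun x => ∑ i, x i = n)).card ^ 2 := by
    have e1 : addEnergy s (latSphere 4 m) =
        ((P ×ˢ P).filter (fun p => ∑ i, p.1 i = ∑ i, p.2 i)).card := by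
      refine Nat.subtype_card _ ?_
      rintro ⟨x, y⟩
      simp only [hP, mem_filter, mem_product, Fintype.mem_piFinset, mem_sphFin, latSphere,
        Set.mem_ofPred_eq, and_assoc]
    rw [e1, card_eq_sum_card_fiberwise (f := fun p => ∑ i, p.1 i) (t := B)]
    · refine sum_congr rfl fun n _ => ?_
      rw [sq, ← card_product]
      congr 1
      ext ⟨x, y⟩
      simp only [mem_filter, mem_product]
      constructor
      · rintro ⟨⟨⟨h1, h2⟩, h3⟩, h4⟩
        exact ⟨⟨h1, h4⟩, h2, h3.symm.trans h4⟩
      · rintro ⟨⟨h1, h4⟩, h2, h3⟩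
        exact ⟨⟨⟨h1, h2⟩, h4.trans h3.symm⟩, h4⟩
    · rintro ⟨x, y⟩ hx
      simp only [coe_filter, mem_product, Set.mem_ofPred_eq] at hx
      exact hmaps x hx.1.1
  have hsum : P.card = ∑ n ∈ B, (P.filter (fun x => ∑ i, x i = n)).card :=
    card_eq_sum_card_fiberwise hmaps
  have hcs := sq_sum_le_card_mul_sum_sq (s := B)
    (f := fun n => (P.filter (fun x => ∑ i, x i = n)).card)
  rw [← hsum, ← hE, hPc, ← pow_mul, mul_comm s 2] at hcs
  exact hcs.trans (Nat.mul_le_mul_right _ (by exact_mod_cast hBc))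

theorem statement_6 (s : ℕ) (hs : 2 ≤ s) :
    ∃ c : ℝ, 0 < c ∧
      ∀ m : ℕ, Odd m →
        c * ((latSphere 4 m).ncard : ℝ) ^ (2 * (s : ℝ) - 2) ≤
          (addEnergy s (latSphere 4 m) : ℝ) := by
  have hs0 : (0 : ℝ) < s := by exact_mod_cast (by omega : 0 < s)
  refine ⟨1 / (81 * (s : ℝ) ^ 4), by positivity, fun m hm => ?_⟩
  have h1 := energy_lower s m (by omega) hm.pos
  have h2 := sph_card hm
  rw [← coe_sphFin, Set.ncard_coe_finset, coe_sphFin]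
  set N := (sphFin m).card
  set E := addEnergy s (latSphere 4 m)
  have hN : 0 < N := lt_of_lt_of_le hm.pos h2
  have hexp : (2 * (s : ℝ) - 2) = ((2 * s - 2 : ℕ) : ℝ) := by
    rw [Nat.cast_sub (by omega)]; push_cast; ring
  rw [hexp, Real.rpow_natCast, one_div, inv_mul_le_iff₀ (by positivity)]
  have h3 : N ^ 2 * N ^ (2 * s - 2) ≤ N ^ 2 * (81 * s ^ 4 * E) := by
    rw [← pow_add, show 2 + (2 * s - 2) = 2 * s by omega]
    calc _ ≤ _ := h1
      _ ≤ 81 * s ^ 4 * N ^ 2 * E := by gcongr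
      _ = _ := by ring
  exact_mod_cast Nat.le_of_mul_le_mul_left h3 (by positivity)
end
end
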